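/- arXiv:2110.07779 — 2 statements merged into one kernel-verified Lean document; each statement's English description precedes it below -/
import Mathlib

section
/- Let n ≥ m ≥ 1 be integers, let p ≥ 1 be an integer and set c = 2p+1. If n ≥ c, then r(S_c(n,m)) = 2(n+m+p) − 1, i.e. r(S_c(n,m)) = 2(n+m) + c − 2. -/
open SimpleGraph

/-- The relation generating the edges of the linked double star `S_c(n,m)`:
vertices are `a_1, …, a_c` (the link, modelled by `Fin c`), the spokes
`v_1, …, v_n` of the `n`-star at `a_1` (modelled by `Fin n`), and the spokes
`w_1, …, w_m` of the `m`-star at `a_c` (modelled by `Fin m`). -/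
def ldsRel (c n m : ℕ) : (Fin c ⊕ Fin n ⊕ Fin m) → (Fin c ⊕ Fin n ⊕ Fin m) → Prop
  | Sum.inl i, Sum.inl j => (j : ℕ) = (i : ℕ) + 1
  | Sum.inl i, Sum.inr (Sum.inl _) => (i : ℕ) = 0
  | Sum.inl i, Sum.inr (Sum.inr _) => (i : ℕ) = c - 1
  | _, _ => False

/-- The linked double star `S_c(n,m)`. -/
def LinkedDoubleStar (c n m : ℕ) : SimpleGraph (Fin c ⊕ Fin n ⊕ Fin m) :=
  SimpleGraph.fromRel (ldsRel c n m)

/-- `G` contains a (not necessarily induced) subgraph isomorphic to `H`. -/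
def HasCopy {α β : Type*} (H : SimpleGraph α) (G : SimpleGraph β) : Prop :=
  ∃ f : α → β, Function.Injective f ∧ ∀ ⦃a b⦄, H.Adj a b → G.Adj (f a) (f b)

/-- A 2-coloring of the complete graph on `β` is encoded by the graph `G` of red
edges (so `Gᶜ` is the graph of blue edges).  `HasMonoLDS G c n m` says this
coloring contains a monochromatic copy of `S_c(n,m)`. -/
def HasMonoLDS {β : Type*} (G : SimpleGraph β) (c n m : ℕ) : Prop :=
  HasCopy (LinkedDoubleStar c n m) G ∨ HasCopy (LinkedDoubleStar c n m) Gᶜ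

/-- Every 2-coloring of the edges of `K_r` contains a monochromatic `S_c(n,m)`. -/
def IsRamseyLDS (c n m r : ℕ) : Prop :=
  ∀ G : SimpleGraph (Fin r), HasMonoLDS G c n m

/-- The Ramsey number of the linked double star `S_c(n,m)`: the least positive
`r` such that every 2-coloring of the edges of `K_r` contains a monochromatic
copy of `S_c(n,m)`. -/
noncomputable def ramseyLDS (c n m : ℕ) : ℕ :=
  sInf {r | 0 < r ∧ IsRamseyLDS c n m r}

/-- `f` exhibits a cycle on `L` vertices in `G` (the vertices `f 0, f 1, …`
arranged cyclically, consecutive ones adjacent in `G`). -/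
def IsCycleMap {β : Type*} {L : ℕ} (G : SimpleGraph β) (f : ZMod L → β) : Prop :=
  Function.Injective f ∧ ∀ i : ZMod L, G.Adj (f i) (f (i + 1))

/-- For a monochromatic cycle with vertex set `C`, all of whose edges have the
color given by the graph `H`, `cycStat H C` is the maximum over vertices
`z ∉ C` of the number of `H`-edges from `z` into `C` (denoted `s(C)`). -/
noncomputable def cycStat {β : Type*} (H : SimpleGraph β) (C : Set β) : ℕ :=
  sSup ((fun z => ({w ∈ C | H.Adj z w}).ncard) '' Cᶜ)

/-- Neighbour finset with classical decidability. -/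
noncomputable def nb {V : Type*} [Fintype V] (G : SimpleGraph V) (v : V) : Finset V := by
  classical exact Finset.univ.filter (G.Adj v)

lemma mem_nb {V : Type*} [Fintype V] (G : SimpleGraph V) (v w : V) :
    w ∈ nb G v ↔ G.Adj v w := by
  simp [nb]

lemma nb_card_compl {V : Type*} [Fintype V] (G : SimpleGraph V) (v : V) :
    (nb G v).card + (nb Gᶜ v).card + 1 = Fintype.card V := by
  classical
  have h1 : Disjoint (nb G v) (nb Gᶜ v) := by
    rw [Finset.disjoint_left]; intro a; simp only [mem_nb, compl_adj]; tauto
  have h2 : v ∉ nb G v ∪ nb Gᶜ v := by simp [mem_nb]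
  rw [← Finset.card_union_of_disjoint h1, ← Finset.card_insert_of_notMem h2, ← Finset.card_univ]
  congr 1
  ext a
  simp only [Finset.mem_insert, Finset.mem_union, mem_nb, compl_adj, Finset.mem_univ, iff_true]
  by_cases h : a = v
  · simp [h]
  · by_cases h' : G.Adj v a
    · simp [h']
    · right; right; exact ⟨fun e => h e.symm, h'⟩

/-- Choosing disjoint leaf sets. -/
lemma hall_two {V : Type*} [DecidableEq V] (S T : Finset V) (n m : ℕ) (hS : n ≤ S.card)
    (hT : m ≤ T.card) (hST : n + m ≤ (S ∪ T).card) :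
    ∃ A B : Finset V, A ⊆ S ∧ B ⊆ T ∧ Disjoint A B ∧ A.card = n ∧ B.card = m := by
  have key : ∃ B : Finset V, B ⊆ T ∧ B.card = m ∧ n ≤ (S \ B).card := by
    by_cases h : m ≤ (T \ S).card
    · obtain ⟨B, hB, hBc⟩ := Finset.exists_subset_card_eq h
      refine ⟨B, hB.trans Finset.sdiff_subset, hBc, ?_⟩
      rw [Finset.sdiff_eq_self_of_disjoint]
      · exact hS
      · rw [Finset.disjoint_left]; intro a ha hb
        exact (Finset.mem_sdiff.1 (hB hb)).2 ha
    · push Not at h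
      obtain ⟨B, hB1, hB2, hBc⟩ := Finset.exists_subsuperset_card_eq
        (Finset.sdiff_subset (s := T) (t := S)) h.le hT
      refine ⟨B, hB2, hBc, ?_⟩
      have : (S ∪ T) \ B ⊆ S \ B := by
        intro a ha
        simp only [Finset.mem_sdiff, Finset.mem_union] at ha ⊢
        refine ⟨?_, ha.2⟩
        by_contra hh
        exact ha.2 (hB1 (Finset.mem_sdiff.2 ⟨by tauto, hh⟩))
      have h3 := Finset.card_le_card this
      have h4 := Finset.le_card_sdiff B (S ∪ T)
      omega
  obtain ⟨B, hB, hBc, hn⟩ := key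
  obtain ⟨A, hA, hAc⟩ := Finset.exists_subset_card_eq hn
  refine ⟨A, B, hA.trans Finset.sdiff_subset, hB, ?_, hAc, hBc⟩
  rw [Finset.disjoint_left]; intro a ha
  exact (Finset.mem_sdiff.1 (hA ha)).2

/-- Embedding lemma: a path plus sufficiently many neighbours of its endpoints. -/
lemma embed {V : Type*} [Fintype V] [DecidableEq V] (G : SimpleGraph V) (n m p : ℕ)
    (l : List V) (hl : l.length = 2 * p + 1) (hnd : l.Nodup) (hch : l.IsChain G.Adj)
    (x y : V) (hy : l.head? = some y) (hx : l.getLast? = some x)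
    (h1 : n ≤ (nb G x \ l.toFinset).card) (h2 : m ≤ (nb G y \ l.toFinset).card)
    (h3 : n + m ≤ ((nb G x \ l.toFinset) ∪ (nb G y \ l.toFinset)).card) :
    HasCopy (LinkedDoubleStar (2 * p + 1) n m) G := by
  obtain ⟨A, B, hA, hB, hAB, hAc, hBc⟩ := hall_two _ _ n m h1 h2 h3
  let eA : Fin n ≃ A := (Fintype.equivFinOfCardEq (by simp [hAc])).symm
  let eB : Fin m ≃ B := (Fintype.equivFinOfCardEq (by simp [hBc])).symm
  have hx' : l[2 * p]'(by omega) = x := by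
    rw [List.getLast?_eq_getElem?] at hx
    have : l.length - 1 = 2 * p := by omega
    rw [this, List.getElem?_eq_getElem (by omega)] at hx
    exact Option.some.inj hx
  have hy' : l[0]'(by omega) = y := by
    rw [List.head?_eq_getElem?, List.getElem?_eq_getElem (by omega)] at hy
    exact Option.some.inj hy
  let f : (Fin (2 * p + 1) ⊕ Fin n ⊕ Fin m) → V := fun
    | Sum.inl i => l[2 * p - (i : ℕ)]'(by omega)
    | Sum.inr (Sum.inl i) => eA i
    | Sum.inr (Sum.inr i) => eB i
  have hAl : ∀ i, (eA i : V) ∉ l := fun i hi => by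
    have := hA (eA i).2
    simp only [Finset.mem_sdiff, List.mem_toFinset] at this
    exact this.2 hi
  have hBl : ∀ i, (eB i : V) ∉ l := fun i hi => by
    have := hB (eB i).2
    simp only [Finset.mem_sdiff, List.mem_toFinset] at this
    exact this.2 hi
  have hrel : ∀ a b, ldsRel (2 * p + 1) n m a b → G.Adj (f a) (f b) := by
    rintro (i | i | i) (j | j | j) h <;> simp only [ldsRel] at h
    · have hi := i.2
      have hj := j.2
      have := hch.getElem (2 * p - (j : ℕ)) (by omega)
      have e : 2 * p - (j : ℕ) + 1 = 2 * p - (i : ℕ) := by omega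
      simp only [e] at this
      exact this.symm
    · have := hA (eA j).2
      simp only [Finset.mem_sdiff, mem_nb] at this
      simp only [f, h, Nat.sub_zero, hx']
      exact this.1
    · have := hB (eB j).2
      simp only [Finset.mem_sdiff, mem_nb] at this
      have e : 2 * p - (i : ℕ) = 0 := by omega
      simp only [f, e, hy']
      exact this.1
  refine ⟨f, ?_, ?_⟩
  · rintro (i | i | i) (j | j | j) h <;> simp only [f] at h
    · have := (List.Nodup.getElem_inj_iff hnd).1 h
      congr 1; ext; omega
    · exact absurd (h ▸ List.getElem_mem _) (hAl j)
    · exact absurd (h ▸ List.getElem_mem _) (hBl j)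
    · exact absurd (h ▸ List.getElem_mem _) (hAl i)
    · rw [eA.injective (Subtype.ext h)]
    · exact absurd (h ▸ (eB j).2) (Finset.disjoint_left.1 hAB (eA i).2)
    · exact absurd (h ▸ List.getElem_mem _) (hBl i)
    · exact absurd (h ▸ (eB i).2) (Finset.disjoint_left.1 hAB (eA j).2)
    · rw [eB.injective (Subtype.ext h)]
  · intro a b hab
    rw [LinkedDoubleStar, SimpleGraph.fromRel_adj] at hab
    rcases hab.2 with h | h
    · exact hrel _ _ h
    · exact (hrel _ _ h).symm

/-- Alternating paths through a set of vertices with many pairwise common neighbours. -/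
lemma alt_path {V : Type*} [Fintype V] [DecidableEq V] (G : SimpleGraph V) (p : ℕ)
    (X : Finset V) (hX : X.card = p + 1)
    (hc : ∀ x ∈ X, ∀ y ∈ X, 2 * p + 1 ≤ (nb G x ∩ nb G y).card) :
    ∀ k ≤ p, ∃ (l : List V) (x y : V), l.length = 2 * k + 1 ∧ l.Nodup ∧ l.IsChain G.Adj ∧
      l.head? = some y ∧ l.getLast? = some x ∧ x ∈ X ∧ y ∈ X ∧
      (X ∩ l.toFinset).card = k + 1 := by
  intro k
  induction k with
  | zero =>
    intro _
    obtain ⟨x, hx⟩ : X.Nonempty := by rw [← Finset.card_pos]; omega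
    exact ⟨[x], x, x, by simp [hx]⟩
  | succ k ih =>
    intro hk
    obtain ⟨l, x, y, hl, hnd, hch, hy, hx, hxX, hyX, hcard⟩ := ih (by omega)
    have hlc : l.toFinset.card = 2 * k + 1 := by rw [List.toFinset_card_of_nodup hnd, hl]
    obtain ⟨z, hz⟩ : (X \ l.toFinset).Nonempty := by
      rw [← Finset.card_pos]
      have := Finset.card_sdiff_add_card_inter X l.toFinset
      omega
    simp only [Finset.mem_sdiff, List.mem_toFinset] at hz
    obtain ⟨u, hu⟩ : ((nb G z ∩ nb G y) \ (X ∪ l.toFinset)).Nonempty := by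
      rw [← Finset.card_pos]
      have h1 := Finset.le_card_sdiff (X ∪ l.toFinset) (nb G z ∩ nb G y)
      have h2 := Finset.card_union_add_card_inter X l.toFinset
      have h3 := hc z hz.1 y hyX
      omega
    simp only [Finset.mem_sdiff, Finset.mem_inter, mem_nb, Finset.mem_union, List.mem_toFinset,
      not_or] at hu
    obtain ⟨⟨hzu, hyu⟩, huX, hul⟩ := hu
    refine ⟨z :: u :: l, x, z, ?_, ?_, ?_, rfl, ?_, hxX, hz.1, ?_⟩
    · simp [hl]; omega
    · have : z ≠ u := fun h => huX (h ▸ hz.1)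
      simp [hnd, hul, hz.2, this]
    · refine List.isChain_cons_cons.2 ⟨hzu, hch.cons ?_⟩
      intro w hw
      rw [hy] at hw
      simp only [Option.mem_def, Option.some.injEq] at hw
      subst hw; exact hyu.symm
    · cases l with
      | nil => simp at hl
      | cons a t => simpa [List.getLast?_cons_cons] using hx
    · have : X ∩ (z :: u :: l).toFinset = insert z (X ∩ l.toFinset) := by
        ext a
        simp only [Finset.mem_inter, List.mem_toFinset, List.mem_cons, Finset.mem_insert]
        constructor
        · rintro ⟨h1, rfl | rfl | h⟩
          · exact Or.inl rfl
          · exact absurd h1 huX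
          · exact Or.inr ⟨h1, h⟩
        · rintro (rfl | ⟨h1, h⟩)
          · exact ⟨hz.1, Or.inl rfl⟩
          · exact ⟨h1, Or.inr (Or.inr h)⟩
      rw [this, Finset.card_insert_of_notMem, hcard]
      simp [hz.2]

/-- Number of neighbours outside a path containing the vertex. -/
lemma nb_sdiff_card {V : Type*} [Fintype V] [DecidableEq V] (G : SimpleGraph V) (v : V)
    (l : List V) (hv : v ∈ l) : (nb G v).card + 1 ≤ (nb G v \ l.toFinset).card + l.length := by
  have h1 : nb G v ⊆ (nb G v \ l.toFinset) ∪ (l.toFinset.erase v) := by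
    intro a ha
    have : a ≠ v := by rintro rfl; simp [mem_nb] at ha
    simp only [Finset.mem_union, Finset.mem_sdiff, Finset.mem_erase]
    tauto
  have h2 := Finset.card_le_card h1
  have h3 := Finset.card_union_le (nb G v \ l.toFinset) (l.toFinset.erase v)
  have h4 := Finset.card_erase_add_one (List.mem_toFinset.2 hv)
  have h5 := List.toFinset_card_le l
  omega

lemma union_card_of_left {V : Type*} [DecidableEq V] (S T : Finset V) (k : ℕ) (h : k ≤ S.card) :
    k ≤ (S ∪ T).card := h.trans (Finset.card_le_card Finset.subset_union_left)

/-- Many vertices of high degree force a copy. -/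
lemma high_many {V : Type*} [Fintype V] [DecidableEq V] (G : SimpleGraph V) (n m p : ℕ)
    (hV : Fintype.card V + 1 = 2 * (n + m + p))
    (X : Finset V) (hX : X.card = p + 1) (hd : ∀ x ∈ X, n + m + 2 * p ≤ (nb G x).card) :
    HasCopy (LinkedDoubleStar (2 * p + 1) n m) G := by
  obtain ⟨l, x, y, hl, hnd, hch, hy, hx, hxX, hyX, -⟩ := alt_path G p X hX (by
    intro x hx y hy
    have h1 := Finset.card_union_add_card_inter (nb G x) (nb G y)
    have h2 := Finset.card_le_univ (nb G x ∪ nb G y)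
    have h3 := hd x hx
    have h4 := hd y hy
    omega) p le_rfl
  have hxl : x ∈ l := List.mem_of_getLast? hx
  have hyl : y ∈ l := List.mem_of_head? hy
  have h1 := nb_sdiff_card G x l hxl
  have h2 := nb_sdiff_card G y l hyl
  have h3 := hd x hxX
  have h4 := hd y hyX
  exact embed G n m p l hl hnd hch x y hy hx (by omega) (by omega)
    (union_card_of_left _ _ _ (by omega))

/-- A large complete bipartite graph contains a copy. -/
lemma bip_copy {V : Type*} [Fintype V] [DecidableEq V] (G : SimpleGraph V) (n m p : ℕ)
    (hq : 2 * p + 1 ≤ n + m + p)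
    (X D : Finset V) (hX : X.card = p + 1) (hD : n + m + p ≤ D.card)
    (hXD : ∀ x ∈ X, ∀ d ∈ D, G.Adj x d) :
    HasCopy (LinkedDoubleStar (2 * p + 1) n m) G := by
  have hsub : ∀ x ∈ X, D ⊆ nb G x := fun x hx d hd => (mem_nb _ _ _).2 (hXD x hx d hd)
  obtain ⟨l, x, y, hl, hnd, hch, hy, hx, hxX, hyX, hc⟩ := alt_path G p X hX (by
    intro x hx y hy
    have := Finset.card_le_card (Finset.subset_inter (hsub x hx) (hsub y hy))
    omega) p le_rfl
  have hdis : Disjoint X D := by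
    rw [Finset.disjoint_left]; intro a h1 h2; exact G.loopless.irrefl a (hXD a h1 a h2)
  have hlc : l.toFinset.card = 2 * p + 1 := by rw [List.toFinset_card_of_nodup hnd, hl]
  have h5 : (D ∩ l.toFinset).card ≤ p := by
    have e1 : Disjoint (D ∩ l.toFinset) (X ∩ l.toFinset) :=
      Finset.disjoint_of_subset_left Finset.inter_subset_left
        (Finset.disjoint_of_subset_right Finset.inter_subset_left hdis.symm)
    have e2 := Finset.card_le_card
      (Finset.union_subset (Finset.inter_subset_right (s₁ := D) (s₂ := l.toFinset))
        (Finset.inter_subset_right (s₁ := X) (s₂ := l.toFinset)))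
    rw [Finset.card_union_of_disjoint e1] at e2
    omega
  have h6 := Finset.card_sdiff_add_card_inter D l.toFinset
  have h7 : ∀ x ∈ X, n + m ≤ (nb G x \ l.toFinset).card := fun x hx => by
    have := Finset.card_le_card (Finset.sdiff_subset_sdiff (hsub x hx) (Finset.Subset.refl l.toFinset))
    omega
  have h8 := h7 x hxX
  have h9 := h7 y hyX
  exact embed G n m p l hl hnd hch x y hy hx (by omega) (by omega)
    (union_card_of_left _ _ _ (by omega))

lemma preds {V : Type*} [DecidableEq V] (P : V → Prop) [DecidablePred P] :
    ∀ (t : List V) (a : V), (a :: t).Nodup → ∃ E : Finset V, E ⊆ (a :: t).toFinset ∧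
      E.card = (t.toFinset.filter P).card ∧
      ∀ e ∈ E, ∃ l1 z l2, a :: t = l1 ++ e :: z :: l2 ∧ P z := by
  intro t
  induction t with
  | nil => intro a _; exact ⟨∅, by simp⟩
  | cons b t ih =>
    intro a hnd
    obtain ⟨hna, hnd'⟩ := List.nodup_cons.1 hnd
    obtain ⟨E, hE1, hE2, hE3⟩ := ih b hnd'
    have hbt := (List.nodup_cons.1 hnd').1
    have hlift : ∀ e ∈ E, ∃ l1 z l2, a :: b :: t = l1 ++ e :: z :: l2 ∧ P z := by
      intro e he
      obtain ⟨l1, z, l2, h, hz⟩ := hE3 e he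
      exact ⟨a :: l1, z, l2, by rw [h]; rfl, hz⟩
    by_cases hb : P b
    · refine ⟨insert a E, ?_, ?_, ?_⟩
      · intro e he
        rcases Finset.mem_insert.1 he with rfl | he
        · simp
        · have := hE1 he
          simp only [List.mem_toFinset] at this ⊢
          exact List.mem_cons_of_mem _ this
      · have h1 : a ∉ E := fun h => hna (List.mem_toFinset.1 (hE1 h))
        rw [Finset.card_insert_of_notMem h1, hE2, List.toFinset_cons, Finset.filter_insert,
          if_pos hb, Finset.card_insert_of_notMem]
        simp [hbt]
      · intro e he
        rcases Finset.mem_insert.1 he with rfl | he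
        · exact ⟨[], b, t, rfl, hb⟩
        · exact hlift e he
    · refine ⟨E, ?_, ?_, hlift⟩
      · intro e he
        have := hE1 he
        simp only [List.mem_toFinset] at this ⊢
        exact List.mem_cons_of_mem _ this
      · rw [hE2, List.toFinset_cons, Finset.filter_insert, if_neg hb]

/-- Posa rotation. -/
lemma rotate_path {V : Type*} (G : SimpleGraph V) (y e z : V) (l1 l2 : List V)
    (hch : (l1 ++ e :: z :: l2).IsChain G.Adj) (hy : (l1 ++ e :: z :: l2).head? = some y)
    (hyz : G.Adj y z) : (e :: (l1.reverse ++ z :: l2)).IsChain G.Adj := by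
  have e1 : e :: (l1.reverse ++ z :: l2) = (l1 ++ [e]).reverse ++ z :: l2 := by simp
  have e2 : l1 ++ e :: z :: l2 = (l1 ++ [e]) ++ z :: l2 := by simp
  rw [e1]
  rw [e2] at hch hy
  refine List.IsChain.append ?_ hch.right_of_append ?_
  · rw [List.isChain_reverse]
    exact hch.left_of_append.imp (fun a b h => h.symm)
  · intro a ha b hb
    rw [List.getLast?_reverse] at ha
    have : (l1 ++ [e]).head? = some y := by
      cases l1 with
      | nil => simpa using hy
      | cons c l1 => simpa using hy
    rw [this] at ha
    simp only [Option.mem_def, Option.some.injEq, List.head?_cons] at ha hb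
    subst ha; subst hb; exact hyz

/-- Case of a vertex of very large degree. -/
lemma case_high {V : Type*} [Fintype V] [DecidableEq V] (G : SimpleGraph V) (n m p : ℕ)
    (hm : 1 ≤ m) (hn : 2 * p + 1 ≤ n)
    (hV : Fintype.card V + 1 = 2 * (n + m + p)) (x : V) (hx : n + m + 2 * p ≤ (nb G x).card)
    (Z : Finset V) (hZ : Z.card ≤ p) (hZd : ∀ v, v ∉ Z → (nb Gᶜ v).card < n + m + 2 * p)
    (hxZ : x ∉ Z) : HasMonoLDS G (2 * p + 1) n m := by
  by_contra hno
  simp only [HasMonoLDS, not_or] at hno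
  have hdeg : ∀ v, v ∉ Z → n + m ≤ (nb G v).card + 1 := by
    intro v hv
    have h1 := nb_card_compl G v
    have h2 := hZd v hv
    omega
  have hpath : ∀ k ≤ 2 * p, ∃ (l : List V) (y : V), l.length = k + 1 ∧ l.Nodup ∧
      l.IsChain G.Adj ∧ l.head? = some y ∧ l.getLast? = some x ∧ (∀ v ∈ l, v ∉ Z) := by
    intro k
    induction k with
    | zero => intro _; exact ⟨[x], x, by simp [hxZ]⟩
    | succ k ih =>
      intro hk
      obtain ⟨l, y, hl, hnd, hch, hy, hlx, hlZ⟩ := ih (by omega)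
      by_contra hstuck
      -- the general extension principle
      have hext : ∀ (l' : List V) (e : V), l'.Perm l → l'.IsChain G.Adj → l'.head? = some e →
          l'.getLast? = some x → ∀ v, v ∉ Z → v ∉ l → ¬ G.Adj e v := by
        intro l' e hperm hch' he hlast v hvZ hvl hadj
        apply hstuck
        refine ⟨v :: l', v, ?_, ?_, ?_, rfl, ?_, ?_⟩
        · simp [hperm.length_eq, hl]
        · exact List.nodup_cons.2 ⟨fun h => hvl (hperm.mem_iff.1 h), hperm.nodup_iff.2 hnd⟩
        · refine hch'.cons ?_
          intro w hw
          rw [he] at hw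
          simp only [Option.mem_def, Option.some.injEq] at hw
          subst hw; exact hadj.symm
        · cases l' with
          | nil => simp at he
          | cons a t => simpa [List.getLast?_cons_cons] using hlast
        · intro w hw
          rcases List.mem_cons.1 hw with rfl | hw
          · exact hvZ
          · exact hlZ w (hperm.mem_iff.1 hw)
      cases l with
      | nil => simp at hl
      | cons y' t =>
        simp only [List.head?_cons, Option.some.injEq] at hy
        subst hy
        classical
        obtain ⟨E, hE1, hE2, hE3⟩ := preds (fun z => G.Adj y' z) t y' hnd
        have hEstuck : ∀ e ∈ E, ∀ v, v ∉ Z → v ∉ y' :: t → ¬ G.Adj e v := by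
          intro e he
          obtain ⟨l1, z, l2, hsplit, hz⟩ := hE3 e he
          refine hext (e :: (l1.reverse ++ z :: l2)) e ?_ ?_ rfl ?_
          · rw [hsplit]
            refine List.Perm.trans ?_ List.perm_middle.symm
            exact List.Perm.cons _ (List.Perm.append_right _ (List.reverse_perm l1))
          · rw [hsplit] at hch
            exact rotate_path G y' e z l1 l2 hch (by rw [← hsplit]; rfl) hz
          · rw [hsplit] at hlx
            simpa [List.getLast?_append, List.getLast?_cons] using hlx
        have hy'stuck : ∀ v, v ∉ Z → v ∉ y' :: t → ¬ G.Adj y' v :=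
          hext (y' :: t) y' (List.Perm.refl _) hch rfl hlx
        have hlc : (y' :: t).toFinset.card = k + 1 := by rw [List.toFinset_card_of_nodup hnd, hl]
        have hEcard : p + 1 ≤ E.card := by
          have hsub : nb G y' ⊆ (t.toFinset.filter (fun z => G.Adj y' z)) ∪ Z := by
            intro v hv
            rw [mem_nb] at hv
            by_cases hvZ : v ∈ Z
            · simp [hvZ]
            · by_cases hvl : v ∈ y' :: t
              · rcases List.mem_cons.1 hvl with rfl | hvt
                · exact absurd hv (G.loopless.irrefl _)
                · simp [hvt, hv]
              · exact absurd hv (hy'stuck v hvZ hvl)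
          have h1 := Finset.card_le_card hsub
          have h2 := Finset.card_union_le (t.toFinset.filter (fun z => G.Adj y' z)) Z
          have h3 := hdeg y' (hlZ y' (by simp))
          omega
        obtain ⟨X, hXE, hXc⟩ := Finset.exists_subset_card_eq hEcard
        apply hno.2
        refine bip_copy Gᶜ n m p (by omega) X (Finset.univ \ ((y' :: t).toFinset ∪ Z)) hXc ?_ ?_
        · have h1 := Finset.le_card_sdiff ((y' :: t).toFinset ∪ Z) Finset.univ
          have h2 := Finset.card_union_le (y' :: t).toFinset Z
          rw [Finset.card_univ] at h1
          omega
        · intro e he d hd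
          simp only [Finset.mem_sdiff, Finset.mem_univ, true_and, Finset.mem_union, not_or,
            List.mem_toFinset] at hd
          rw [compl_adj]
          refine ⟨?_, hEstuck e (hXE he) d hd.2 hd.1⟩
          rintro rfl
          exact hd.1 (List.mem_toFinset.1 (hE1 (hXE he)))
  obtain ⟨l, y, hl, hnd, hch, hy, hlx, hlZ⟩ := hpath (2 * p) le_rfl
  have hyl : y ∈ l := List.mem_of_head? hy
  have h1 := nb_sdiff_card G x l (List.mem_of_getLast? hlx)
  have h2 := nb_sdiff_card G y l hyl
  have h3 := hdeg y (hlZ y hyl)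
  exact hno.1 (embed G n m p l hl hnd hch x y hy hlx (by omega) (by omega)
    (union_card_of_left _ _ _ (by omega)))

lemma consec {V : Type*} [DecidableEq V] (P : V → Prop) [DecidablePred P] :
    ∀ l : List V, (∃ l1 a b l2, l = l1 ++ a :: b :: l2 ∧ P a ∧ P b) ∨
      2 * (l.toFinset.filter P).card ≤ l.length + 1
  | [] => by simp
  | [a] => by
    right
    have := Finset.card_le_card (Finset.filter_subset P [a].toFinset)
    simp at this ⊢
    omega
  | a :: b :: t => by
    by_cases ha : P a
    · by_cases hb : P b
      · exact Or.inl ⟨[], a, b, t, rfl, ha, hb⟩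
      · rcases consec P t with ⟨l1, c, d, l2, h, hc, hd⟩ | h
        · exact Or.inl ⟨a :: b :: l1, c, d, l2, by rw [h]; rfl, hc, hd⟩
        · right
          rw [List.toFinset_cons, List.toFinset_cons, Finset.filter_insert, if_pos ha,
            Finset.filter_insert, if_neg hb]
          have := Finset.card_insert_le a (t.toFinset.filter P)
          simp only [List.length_cons]
          omega
    · rcases consec P (b :: t) with ⟨l1, c, d, l2, h, hc, hd⟩ | h
      · exact Or.inl ⟨a :: l1, c, d, l2, by rw [h]; rfl, hc, hd⟩
      · right
        rw [List.toFinset_cons, Finset.filter_insert, if_neg ha]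
        simp only [List.length_cons] at h ⊢
        omega

/-- Greedy extension of a path inside a set of large minimum degree. -/
lemma greedy {V : Type*} [Fintype V] [DecidableEq V] (G : SimpleGraph V) (S : Finset V) (d : ℕ)
    (hS : ∀ v ∈ S, d ≤ (nb G v ∩ S).card) (k : ℕ) :
    ∀ (l : List V) (w : V), l.head? = some w → w ∈ S → l.Nodup → l.IsChain G.Adj →
      l.length + k ≤ d + 1 →
      ∃ (t : List V) (y : V), t.length = k ∧ (∀ v ∈ t, v ∈ S) ∧ (t ++ l).Nodup ∧
        (t ++ l).IsChain G.Adj ∧ (t ++ l).head? = some y ∧ y ∈ S := by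
  induction k with
  | zero => intro l w h1 h2 h3 h4 _; exact ⟨[], w, by simp, by simp, h3, h4, h1, h2⟩
  | succ k ih =>
    intro l w h1 h2 h3 h4 hlen
    have hwl : w ∈ l := List.mem_of_head? h1
    obtain ⟨v, hv⟩ : ((nb G w ∩ S) \ (l.toFinset.erase w)).Nonempty := by
      rw [← Finset.card_pos]
      have e1 := Finset.le_card_sdiff (l.toFinset.erase w) (nb G w ∩ S)
      have e2 := Finset.card_erase_add_one (List.mem_toFinset.2 hwl)
      have e3 := List.toFinset_card_le l
      have e4 := hS w h2
      omega
    simp only [Finset.mem_sdiff, Finset.mem_inter, mem_nb, Finset.mem_erase, List.mem_toFinset,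
      not_and] at hv
    obtain ⟨⟨hwv, hvS⟩, hvl⟩ := hv
    have hvl' : v ∉ l := hvl hwv.ne'
    obtain ⟨t, y, ht, htS, htn, htc, hth, hyS⟩ := ih (v :: l) v rfl hvS
      (List.nodup_cons.2 ⟨hvl', h3⟩)
      (h4.cons (by
        intro a ha
        rw [h1] at ha
        simp only [Option.mem_def, Option.some.injEq] at ha
        subst ha; exact hwv.symm)) (by simp; omega)
    have e : t ++ v :: l = (t ++ [v]) ++ l := by simp
    rw [e] at htn htc hth
    refine ⟨t ++ [v], y, by simp [ht], ?_, htn, htc, hth, hyS⟩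
    intro a ha
    rcases List.mem_append.1 ha with ha | ha
    · exact htS a ha
    · simp at ha; subst ha; exact hvS

/-- Paths from `U` to `W` with `s` vertices in `W` and at most `s - e` vertices in `U`. -/
structure GP {V : Type*} [DecidableEq V] (G : SimpleGraph V) (U W : Finset V) (e s : ℕ)
    (l : List V) : Prop where
  nd : l.Nodup
  ch : l.IsChain G.Adj
  sub : ∀ v ∈ l, v ∈ U ∪ W
  head : ∃ w ∈ W, l.head? = some w
  last : ∃ u ∈ U, l.getLast? = some u
  cW : (W ∩ l.toFinset).card = s
  cU : (U ∩ l.toFinset).card + e ≤ s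

lemma inter_insert_card_mem {V : Type*} [DecidableEq V] (W L : Finset V) (w : V) (hw : w ∈ W)
    (hL : w ∉ L) : (W ∩ insert w L).card = (W ∩ L).card + 1 := by
  rw [Finset.inter_insert_of_mem hw, Finset.card_insert_of_notMem]
  simp [hL]

lemma GP.consW {V : Type*} [DecidableEq V] {G : SimpleGraph V} {U W : Finset V} {e s : ℕ}
    {l : List V} (hUW : Disjoint U W) (h : GP G U W e s l) {w v : V} (hw : l.head? = some w)
    (hv : v ∈ W) (hvl : v ∉ l) (hadj : G.Adj w v) : GP G U W e (s + 1) (v :: l) := by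
  have hvU : v ∉ U := Finset.disjoint_right.1 hUW hv
  refine ⟨List.nodup_cons.2 ⟨hvl, h.nd⟩, h.ch.cons ?_, ?_, ⟨v, hv, rfl⟩, ?_, ?_, ?_⟩
  · intro a ha
    rw [hw] at ha
    simp only [Option.mem_def, Option.some.injEq] at ha
    subst ha; exact hadj.symm
  · intro a ha
    rcases List.mem_cons.1 ha with rfl | ha
    · exact Finset.mem_union_right _ hv
    · exact h.sub a ha
  · obtain ⟨u, hu, hl⟩ := h.last
    refine ⟨u, hu, ?_⟩
    cases l with
    | nil => simp at hw
    | cons a t => simpa [List.getLast?_cons_cons] using hl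
  · rw [List.toFinset_cons, inter_insert_card_mem _ _ _ hv (by simpa using hvl), h.cW]
  · rw [List.toFinset_cons, Finset.inter_insert_of_notMem hvU]
    have := h.cU
    omega

lemma GP.consUW {V : Type*} [DecidableEq V] {G : SimpleGraph V} {U W : Finset V} {e s : ℕ}
    {l : List V} (hUW : Disjoint U W) (h : GP G U W e s l) {w y v : V} (hw : l.head? = some w)
    (hy : y ∈ U) (hyl : y ∉ l) (hwy : G.Adj w y)
    (hv : v ∈ W) (hvl : v ∉ l) (hadj : G.Adj y v) : GP G U W e (s + 1) (v :: y :: l) := by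
  have hvU : v ∉ U := Finset.disjoint_right.1 hUW hv
  have hyW : y ∉ W := Finset.disjoint_left.1 hUW hy
  refine ⟨?_, ?_, ?_, ⟨v, hv, rfl⟩, ?_, ?_, ?_⟩
  · simp [h.nd, hvl, hyl, hadj.ne']
  · refine List.isChain_cons_cons.2 ⟨hadj.symm, h.ch.cons ?_⟩
    intro a ha
    rw [hw] at ha
    simp only [Option.mem_def, Option.some.injEq] at ha
    subst ha; exact hwy.symm
  · intro a ha
    rcases List.mem_cons.1 ha with rfl | ha
    · exact Finset.mem_union_right _ hv
    rcases List.mem_cons.1 ha with rfl | ha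
    · exact Finset.mem_union_left _ hy
    · exact h.sub a ha
  · obtain ⟨u, hu, hl⟩ := h.last
    refine ⟨u, hu, ?_⟩
    cases l with
    | nil => simp at hw
    | cons a t => simpa [List.getLast?_cons_cons] using hl
  · rw [List.toFinset_cons, inter_insert_card_mem _ _ _ hv (by simp [hvl, hadj.ne']),
      List.toFinset_cons, Finset.inter_insert_of_notMem hyW, h.cW]
  · rw [List.toFinset_cons, Finset.inter_insert_of_notMem hvU, List.toFinset_cons,
      inter_insert_card_mem _ _ _ hy (by simpa using hyl)]
    have := h.cU
    omega

lemma GP.insertW {V : Type*} [DecidableEq V] {G : SimpleGraph V} {U W : Finset V} {e s : ℕ}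
    {l1 l2 : List V} {a b v : V} (hUW : Disjoint U W) (h : GP G U W e s (l1 ++ a :: b :: l2))
    (hv : v ∈ W) (hvl : v ∉ l1 ++ a :: b :: l2) (ha : G.Adj v a) (hb : G.Adj v b) :
    GP G U W e (s + 1) (l1 ++ a :: v :: b :: l2) := by
  have hvU : v ∉ U := Finset.disjoint_right.1 hUW hv
  have hperm : (l1 ++ a :: v :: b :: l2).Perm (v :: (l1 ++ a :: b :: l2)) := by
    have e1 : l1 ++ a :: v :: b :: l2 = (l1 ++ [a]) ++ v :: b :: l2 := by simp
    have e2 : l1 ++ a :: b :: l2 = (l1 ++ [a]) ++ b :: l2 := by simp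
    rw [e1, e2]; exact List.perm_middle
  have hfs : (l1 ++ a :: v :: b :: l2).toFinset = insert v (l1 ++ a :: b :: l2).toFinset := by
    rw [List.toFinset_eq_of_perm _ _ hperm, List.toFinset_cons]
  refine ⟨hperm.nodup_iff.2 (List.nodup_cons.2 ⟨hvl, h.nd⟩), ?_, ?_, ?_, ?_, ?_, ?_⟩
  · have hc := h.ch
    rw [List.isChain_append] at hc ⊢
    obtain ⟨c1, c2, c3⟩ := hc
    rw [List.isChain_cons_cons] at c2
    refine ⟨c1, ?_, by simpa using c3⟩
    rw [List.isChain_cons_cons, List.isChain_cons_cons]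
    exact ⟨ha.symm, hb, c2.2⟩
  · intro x hx
    rcases List.mem_cons.1 (hperm.mem_iff.1 hx) with rfl | hx
    · exact Finset.mem_union_right _ hv
    · exact h.sub x hx
  · obtain ⟨w, hw, hl⟩ := h.head
    refine ⟨w, hw, ?_⟩
    cases l1 <;> simpa using hl
  · obtain ⟨u, hu, hl⟩ := h.last
    refine ⟨u, hu, ?_⟩
    simpa [List.getLast?_append, List.getLast?_cons] using hl
  · rw [hfs, inter_insert_card_mem _ _ _ hv (fun hh => hvl (List.mem_toFinset.1 hh)), h.cW]
  · rw [hfs, Finset.inter_insert_of_notMem hvU]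
    have := h.cU
    omega

lemma key_step {V : Type*} [Fintype V] [DecidableEq V] (G : SimpleGraph V) (U W : Finset V)
    (hUW : Disjoint U W) (δ r e s : ℕ) (hN : ∀ w ∈ W, nb G w ⊆ U ∪ W)
    (hδ : ∀ w ∈ W, δ ≤ (nb G w).card) (hU : ∀ w ∈ W, ∃ u ∈ U, G.Adj w u)
    (hnum : U.card + 3 * r ≤ 2 * δ + 3) (hWr : r ≤ W.card) (her : e + 1 ≤ r)
    (hs : s < r) (l : List V) (h : GP G U W e s l) :
    (∃ l', GP G U W e (s + 1) l') ∨ ∃ l', GP G U W e r l' := by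
  by_contra hno
  simp only [not_or, not_exists] at hno
  obtain ⟨hno1, hno2⟩ := hno
  obtain ⟨w, hwW, hw⟩ := h.head
  have hwl : w ∈ l := List.mem_of_head? hw
  have hY : nb G w \ l.toFinset ⊆ U := by
    intro v hv
    simp only [Finset.mem_sdiff, List.mem_toFinset] at hv
    rcases Finset.mem_union.1 (hN w hwW hv.1) with h1 | h1
    · exact h1
    · exact absurd (h.consW hUW hw h1 hv.2 ((mem_nb _ _ _).1 hv.1)) (hno1 _)
  have hYW : ∀ y ∈ nb G w \ l.toFinset, ∀ v ∈ W \ l.toFinset, ¬ G.Adj y v := by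
    intro y hy v hv hadj
    have hyU := hY hy
    simp only [Finset.mem_sdiff, List.mem_toFinset] at hv hy
    exact hno1 _ (h.consUW hUW hw hyU hy.2 ((mem_nb _ _ _).1 hy.1) hv.1 hv.2 hadj)
  have hlen : l.length = s + (U ∩ l.toFinset).card := by
    rw [← List.toFinset_card_of_nodup h.nd]
    have h1 : l.toFinset = (W ∩ l.toFinset) ∪ (U ∩ l.toFinset) := by
      ext v
      simp only [Finset.mem_union, Finset.mem_inter, List.mem_toFinset]
      constructor
      · intro hv
        have := h.sub v hv
        rw [Finset.mem_union] at this
        tauto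
      · tauto
    have h2 : Disjoint (W ∩ l.toFinset) (U ∩ l.toFinset) :=
      Finset.disjoint_of_subset_left Finset.inter_subset_left
        (Finset.disjoint_of_subset_right Finset.inter_subset_left hUW.symm)
    conv_lhs => rw [h1]
    rw [Finset.card_union_of_disjoint h2, h.cW]
  have hYc := nb_sdiff_card G w l hwl
  have hdw := hδ w hwW
  have hcU := h.cU
  -- the minimum degree inside `W \ l`
  have hmin : ∀ v ∈ W \ l.toFinset, r ≤ (nb G v ∩ (W \ l.toFinset)).card := by
    intro v hv
    have hv' := hv
    simp only [Finset.mem_sdiff, List.mem_toFinset] at hv'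
    classical
    have hc : 2 * (l.toFinset.filter (fun a => G.Adj v a)).card ≤ l.length + 1 := by
      rcases consec (fun a => G.Adj v a) l with ⟨l1, a, b, l2, hl, ha, hb⟩ | hc
      · subst hl
        exact absurd (h.insertW hUW hv'.1 hv'.2 ha hb) (hno1 _)
      · exact hc
    have hsub : nb G v ⊆ (l.toFinset.filter (fun a => G.Adj v a)) ∪
        ((U \ (nb G w \ l.toFinset)) \ (U ∩ l.toFinset)) ∪ (nb G v ∩ (W \ l.toFinset)) := by
      intro a ha
      have haUW := hN v hv'.1 ha
      have hadj := (mem_nb _ _ _).1 ha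
      by_cases hal : a ∈ l
      · refine Finset.mem_union_left _ (Finset.mem_union_left _ ?_)
        simp [hal, hadj]
      · rcases Finset.mem_union.1 haUW with hU' | hW'
        · refine Finset.mem_union_left _ (Finset.mem_union_right _ ?_)
          refine Finset.mem_sdiff.2 ⟨Finset.mem_sdiff.2 ⟨hU', ?_⟩, by simp [hal]⟩
          intro hh
          exact hYW a hh v hv hadj.symm
        · refine Finset.mem_union_right _ (Finset.mem_inter.2 ⟨ha, ?_⟩)
          simp [hW', hal]
    have e1 := Finset.card_le_card hsub
    have e2 := Finset.card_union_le ((l.toFinset.filter (fun a => G.Adj v a)) ∪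
        ((U \ (nb G w \ l.toFinset)) \ (U ∩ l.toFinset))) (nb G v ∩ (W \ l.toFinset))
    have e3 := Finset.card_union_le (l.toFinset.filter (fun a => G.Adj v a))
        ((U \ (nb G w \ l.toFinset)) \ (U ∩ l.toFinset))
    have e4 := Finset.card_sdiff_add_card_eq_card hY
    have e5 : U ∩ l.toFinset ⊆ U \ (nb G w \ l.toFinset) := by
      intro a ha
      simp only [Finset.mem_inter, Finset.mem_sdiff, List.mem_toFinset] at ha ⊢
      tauto
    have e6 := Finset.card_sdiff_add_card_eq_card e5
    have e7 := hδ v hv'.1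
    omega
  obtain ⟨v, hv⟩ : (W \ l.toFinset).Nonempty := by
    rw [← Finset.card_pos]
    have := Finset.card_sdiff_add_card_inter W l.toFinset
    have := h.cW
    omega
  have hv' := hv
  simp only [Finset.mem_sdiff, List.mem_toFinset] at hv'
  obtain ⟨u, hu, hvu⟩ := hU v hv'.1
  obtain ⟨t, y, ht, htS, htn, htc, hth, hyS⟩ := greedy G (W \ l.toFinset) r hmin (r - 1) [v, u] v
    rfl hv (by simp [hvu.ne]) (by simp [hvu]) (by simp; omega)
  have htW : ∀ a ∈ t, a ∈ W := fun a ha => (Finset.mem_sdiff.1 (htS a ha)).1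
  have huW : u ∉ W := Finset.disjoint_left.1 hUW hu
  have hvU : v ∉ U := Finset.disjoint_right.1 hUW hv'.1
  have hndt := List.nodup_append.1 htn
  refine hno2 (t ++ [v, u]) ⟨htn, htc, ?_, ⟨y, (Finset.mem_sdiff.1 hyS).1, hth⟩,
    ⟨u, hu, by simp⟩, ?_, ?_⟩
  · intro a ha
    rw [Finset.mem_union]
    rcases List.mem_append.1 ha with ha | ha
    · exact Or.inr (htW a ha)
    · simp only [List.mem_cons, List.not_mem_nil, or_false] at ha
      rcases ha with rfl | rfl
      · exact Or.inr hv'.1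
      · exact Or.inl hu
  · have e1 : W ∩ (t ++ [v, u]).toFinset = insert v t.toFinset := by
      ext a
      simp only [Finset.mem_inter, List.mem_toFinset, List.mem_append, List.mem_cons,
        List.not_mem_nil, or_false, Finset.mem_insert]
      constructor
      · rintro ⟨h1, h2 | h2 | h2⟩
        · exact Or.inr h2
        · exact Or.inl h2
        · exact absurd (h2 ▸ h1) huW
      · rintro (rfl | h2)
        · exact ⟨hv'.1, Or.inr (Or.inl rfl)⟩
        · exact ⟨htW a h2, Or.inl h2⟩
    rw [e1, Finset.card_insert_of_notMem, List.toFinset_card_of_nodup hndt.1, ht]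
    · omega
    · rw [List.mem_toFinset]
      intro hh
      exact hndt.2.2 v hh v (by simp) rfl
  · have e1 : U ∩ (t ++ [v, u]).toFinset ⊆ {u} := by
      intro a ha
      simp only [Finset.mem_inter, List.mem_toFinset, List.mem_append, List.mem_cons,
        List.not_mem_nil, or_false] at ha
      rw [Finset.mem_singleton]
      rcases ha with ⟨h1, h2 | h2 | h2⟩
      · exact absurd (htW a h2) (Finset.disjoint_left.1 hUW h1)
      · exact absurd (h2 ▸ h1) hvU
      · exact h2
    have := Finset.card_le_card e1
    rw [Finset.card_singleton] at this
    omega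

lemma key {V : Type*} [Fintype V] [DecidableEq V] (G : SimpleGraph V) (U W : Finset V)
    (hUW : Disjoint U W) (δ r e : ℕ) (hN : ∀ w ∈ W, nb G w ⊆ U ∪ W)
    (hδ : ∀ w ∈ W, δ ≤ (nb G w).card) (hU : ∀ w ∈ W, ∃ u ∈ U, G.Adj w u)
    (hnum : U.card + 3 * r ≤ 2 * δ + 3) (hWr : r ≤ W.card) (her : e + 1 ≤ r) :
    ∀ (k s : ℕ), s + k = r → (∃ l, GP G U W e s l) → ∃ l, GP G U W e r l := by
  intro k
  induction k with
  | zero => intro s hs h; simpa [← hs] using h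
  | succ k ih =>
    rintro s hs ⟨l, hl⟩
    rcases key_step G U W hUW δ r e s hN hδ hU hnum hWr her (by omega) l hl with h | h
    · exact ih (s + 1) (by omega) h
    · exact h

lemma head?_append_ne {V : Type*} (l t : List V) (w : V) (h : l.head? = some w) :
    (l ++ t).head? = some w := by
  cases l with
  | nil => simp at h
  | cons a l => simpa using h

/-- Appending the starting vertex `x` to a path ending in `U = N(x)`. -/
lemma append_start {V : Type*} (G : SimpleGraph V) (l : List V) (x u : V) (hnd : l.Nodup)
    (hch : l.IsChain G.Adj) (hx : x ∉ l) (hu : l.getLast? = some u) (hxu : G.Adj x u) :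
    (l ++ [x]).Nodup ∧ (l ++ [x]).IsChain G.Adj := by
  constructor
  · rw [List.nodup_append]
    refine ⟨hnd, by simp, ?_⟩
    intro a ha b hb
    simp only [List.mem_singleton] at hb
    subst hb
    rintro rfl
    exact hx ha
  · refine hch.append (by simp) ?_
    intro a ha b hb
    rw [hu] at ha
    simp only [Option.mem_def, Option.some.injEq, List.head?_cons] at ha hb
    subst ha; subst hb; exact hxu.symm

lemma core {V : Type*} [Fintype V] [DecidableEq V] (G : SimpleGraph V) (n m p : ℕ)
    (hm : 1 ≤ m) (hp : 1 ≤ p) (hn : 2 * p + 1 ≤ n)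
    (hV : Fintype.card V + 1 = 2 * (n + m + p)) (x : V)
    (hmax1 : ∀ v, (nb G v).card ≤ (nb G x).card) (hmax2 : ∀ v, (nb Gᶜ v).card ≤ (nb G x).card)
    (hx : (nb G x).card < n + m + 2 * p) : HasCopy (LinkedDoubleStar (2 * p + 1) n m) G := by
  obtain ⟨r, hr⟩ : ∃ r, (nb G x).card + r = n + m + 2 * p := ⟨_, Nat.add_sub_cancel' hx.le⟩
  have hr1 : 1 ≤ r := by omega
  have hrp : r ≤ p + 1 := by
    have h1 := nb_card_compl G x
    have h2 := hmax2 x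
    omega
  obtain ⟨δ, hδdef⟩ : ∃ δ, δ + 2 = n + m + r := ⟨n + m + r - 2, by omega⟩
  have hdeg : ∀ v, δ ≤ (nb G v).card := by
    intro v
    have h1 := nb_card_compl G v
    have h2 := hmax2 v
    omega
  set U := nb G x with hUdef
  set W := nb Gᶜ x with hWdef
  have hUW : Disjoint U W := by
    rw [Finset.disjoint_left]; intro a; simp only [hUdef, hWdef, mem_nb, compl_adj]; tauto
  have hWc : W.card = δ := by
    have h1 := nb_card_compl G x
    rw [← hUdef, ← hWdef] at h1
    omega
  have hxU : x ∉ U := by simp [hUdef, mem_nb]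
  have hxW : x ∉ W := by simp [hWdef, mem_nb]
  have hcover : ∀ v, v ≠ x → v ∈ U ∪ W := by
    intro v hv
    simp only [Finset.mem_union, hUdef, hWdef, mem_nb, compl_adj]
    by_cases h : G.Adj x v
    · exact Or.inl h
    · exact Or.inr ⟨hv.symm, h⟩
  have hN : ∀ w ∈ W, nb G w ⊆ U ∪ W := by
    intro w hw v hv
    apply hcover
    rintro rfl
    rw [hWdef, mem_nb, compl_adj] at hw
    exact hw.2 ((mem_nb _ _ _).1 hv).symm
  have hWU : ∀ w ∈ W, ∃ u ∈ U, G.Adj w u := by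
    intro w hw
    by_contra hcon
    push Not at hcon
    have hsub : nb G w ⊆ W.erase w := by
      intro v hv
      have hadj := (mem_nb _ _ _).1 hv
      rw [Finset.mem_erase]
      refine ⟨hadj.ne', ?_⟩
      rcases Finset.mem_union.1 (hN w hw hv) with h | h
      · exact absurd hadj (hcon v h)
      · exact h
    have h1 := Finset.card_le_card hsub
    have h2 := Finset.card_erase_add_one hw
    have h3 := hdeg w
    omega
  have hkey : ∀ e, e + 1 ≤ r → ∀ s ≤ r, (∃ l, GP G U W e s l) → ∃ l, GP G U W e r l := by
    intro e he s hs h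
    exact key G U W hUW δ r e hN (fun w _ => hdeg w) hWU (by omega) (by omega) he (r - s) s
      (by omega) h
  -- finishing with a path having `r` vertices in `W` and at most `2 p - r` vertices in `U`
  have hlen : ∀ e s l, GP G U W e s l → l.length = s + (U ∩ l.toFinset).card := by
    intro e s l h
    rw [← List.toFinset_card_of_nodup h.nd]
    have h1 : l.toFinset = (W ∩ l.toFinset) ∪ (U ∩ l.toFinset) := by
      ext v
      simp only [Finset.mem_union, Finset.mem_inter, List.mem_toFinset]
      constructor
      · intro hv
        have := h.sub v hv
        rw [Finset.mem_union] at this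
        tauto
      · tauto
    have h2 : Disjoint (W ∩ l.toFinset) (U ∩ l.toFinset) :=
      Finset.disjoint_of_subset_left Finset.inter_subset_left
        (Finset.disjoint_of_subset_right Finset.inter_subset_left hUW.symm)
    conv_lhs => rw [h1]
    rw [Finset.card_union_of_disjoint h2, h.cW]
  have hxnot : ∀ e s l, GP G U W e s l → x ∉ l := by
    intro e s l h hxl
    rcases Finset.mem_union.1 (h.sub x hxl) with h1 | h1
    · exact hxU h1
    · exact hxW h1
  have hfin : ∀ e l, GP G U W e r l → l.length ≤ 2 * p →
      HasCopy (LinkedDoubleStar (2 * p + 1) n m) G := by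
    intro e l h hl
    obtain ⟨u, huU, hu⟩ := h.last
    obtain ⟨w, hwW, hw⟩ := h.head
    obtain ⟨hnd, hch⟩ := append_start G l x u h.nd h.ch (hxnot _ _ _ h) hu
      ((mem_nb _ _ _).1 huU)
    obtain ⟨t, y, ht, -, htn, htc, hth, -⟩ := greedy G Finset.univ δ
      (fun v _ => by rw [Finset.inter_univ]; exact hdeg v) (2 * p - l.length) (l ++ [x]) w
      (head?_append_ne _ _ _ hw) (Finset.mem_univ _) hnd hch (by simp; omega)
    have hL : (t ++ (l ++ [x])).length = 2 * p + 1 := by simp [ht]; omega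
    have hyl : y ∈ t ++ (l ++ [x]) := List.mem_of_head? hth
    have h1 := nb_sdiff_card G y _ hyl
    have h2 := hdeg y
    have h3 : n + m ≤ (U \ (t ++ (l ++ [x])).toFinset).card := by
      set L := (t ++ (l ++ [x])).toFinset with hLdef
      have hLc : L.card = 2 * p + 1 := by rw [hLdef, List.toFinset_card_of_nodup htn, hL]
      have e1 := Finset.card_sdiff_add_card_inter U L
      have e2 : insert x ((U ∩ L) ∪ (W ∩ l.toFinset)) ⊆ L := by
        intro a ha
        simp only [Finset.mem_insert, Finset.mem_union, Finset.mem_inter, List.mem_toFinset] at ha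
        rcases ha with rfl | h | h
        · simp [hLdef]
        · exact h.2
        · simp [hLdef, h.2]
      have e3 := Finset.card_le_card e2
      rw [Finset.card_insert_of_notMem (by simp [hxU, hxW]), Finset.card_union_of_disjoint
        (Finset.disjoint_of_subset_left Finset.inter_subset_left
          (Finset.disjoint_of_subset_right Finset.inter_subset_left hUW)), h.cW] at e3
      omega
    exact embed G n m p _ hL htn htc x y hth (by simp) (by rw [← hUdef]; omega) (by omega)
      (union_card_of_left _ _ _ h3)
  have hWne : W.Nonempty := by rw [← Finset.card_pos]; omega
  by_cases hrp' : r ≤ p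
  · obtain ⟨w, hw⟩ := hWne
    obtain ⟨u, hu, hwu⟩ := hWU w hw
    have huW : u ∉ W := Finset.disjoint_left.1 hUW hu
    have hwU' : w ∉ U := Finset.disjoint_right.1 hUW hw
    obtain ⟨l, hl⟩ := hkey 0 (by omega) 1 hr1 ⟨[w, u], by simp [hwu.ne], by simp [hwu],
      by simp [hu, hw], ⟨w, hw, rfl⟩, ⟨u, hu, rfl⟩,
      by simp [Finset.inter_insert_of_mem hw, Finset.inter_singleton_of_notMem huW],
      by simp [Finset.inter_insert_of_notMem hwU', Finset.inter_singleton_of_mem hu]⟩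
    have h1 := hlen _ _ _ hl
    have h2 := hl.cU
    exact hfin 0 l hl (by omega)
  · -- the regular case
    have hr' : r = p + 1 := by omega
    have hedge : ∃ w1 ∈ W, ∃ w2 ∈ W, G.Adj w1 w2 := by
      by_contra hcon
      push Not at hcon
      have hEq : ∀ w ∈ W, nb G w = U := by
        intro w hw
        apply Finset.eq_of_subset_of_card_le
        · intro v hv
          rcases Finset.mem_union.1 (hN w hw hv) with h | h
          · exact h
          · exact absurd ((mem_nb _ _ _).1 hv) (hcon w hw v h)
        · have := hdeg w
          omega
      obtain ⟨w, hw⟩ := hWne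
      obtain ⟨u, hu, -⟩ := hWU w hw
      have hsub : insert x W ⊆ nb G u := by
        intro v hv
        rw [mem_nb]
        rcases Finset.mem_insert.1 hv with rfl | hv
        · exact ((mem_nb _ _ _).1 hu).symm
        · have : u ∈ nb G v := by rw [hEq v hv]; exact hu
          exact ((mem_nb _ _ _).1 this).symm
      have h1 := Finset.card_le_card hsub
      rw [Finset.card_insert_of_notMem hxW] at h1
      have h2 := hmax1 u
      omega
    obtain ⟨w1, hw1, w2, hw2, hw12⟩ := hedge
    obtain ⟨u, hu, hwu⟩ := hWU w1 hw1
    have huW : u ∉ W := Finset.disjoint_left.1 hUW hu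
    have hw1U : w1 ∉ U := Finset.disjoint_right.1 hUW hw1
    have hw2U : w2 ∉ U := Finset.disjoint_right.1 hUW hw2
    have hw2u : w2 ≠ u := by rintro rfl; exact huW hw2
    obtain ⟨l, hl⟩ := hkey 1 (by omega) 2 (by omega) ⟨[w2, w1, u],
      by simp [hwu.ne, hw12.ne', hw2u], by simp [hwu, hw12.symm],
      by simp [hu, hw1, hw2], ⟨w2, hw2, rfl⟩, ⟨u, hu, rfl⟩,
      by
        simp only [List.toFinset_cons, List.toFinset_nil]
        rw [inter_insert_card_mem _ _ _ hw2 (by simp [hw12.ne', hw2u]),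
          inter_insert_card_mem _ _ _ hw1 (by simp [hwu.ne]), Finset.inter_insert_of_notMem huW]
        simp,
      by
        simp only [List.toFinset_cons, List.toFinset_nil]
        rw [Finset.inter_insert_of_notMem hw2U, Finset.inter_insert_of_notMem hw1U,
          inter_insert_card_mem _ _ _ hu (by simp)]
        simp⟩
    have h1 := hlen _ _ _ hl
    have h2 := hl.cU
    by_cases hll : l.length ≤ 2 * p
    · exact hfin 1 l hl hll
    · have hll' : l.length = 2 * p + 1 := by omega
      have hUl : (U ∩ l.toFinset).card = p := by omega
      obtain ⟨u', hu'U, hu'⟩ := hl.last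
      obtain ⟨w, hwW, hw⟩ := hl.head
      have hxl := hxnot _ _ _ hl
      have hnd := hl.nd
      have hch := hl.ch
      clear hl
      match l, hll', hw, hu', hxl, hnd, hch, hUl with
      | [a], hll', _, _, _, _, _, _ => exact absurd hll' (by simp; omega)
      | a :: y :: t, hll', hw, hu', hxl, hnd, hch, hUl =>
        simp only [List.head?_cons, Option.some.injEq] at hw
        subst hw
        rw [List.isChain_cons_cons] at hch
        obtain ⟨hal, hnd'⟩ := List.nodup_cons.1 hnd
        rw [List.getLast?_cons_cons] at hu'
        have hxl' : x ∉ y :: t := fun h => hxl (List.mem_cons_of_mem _ h)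
        obtain ⟨hnd2, hch2⟩ := append_start G (y :: t) x u' hnd' hch.2 hxl' hu'
          ((mem_nb _ _ _).1 hu'U)
        have hL : ((y :: t) ++ [x]).length = 2 * p + 1 := by
          simp only [List.length_append, List.length_cons, List.length_nil] at hll' ⊢
          omega
        have hax : a ≠ x := by rintro rfl; exact hxl (by simp)
        have haU : a ∉ U := Finset.disjoint_right.1 hUW hwW
        have hanot : a ∉ (y :: t) ++ [x] := by
          rw [List.mem_append, not_or]
          exact ⟨hal, by simpa using hax⟩
        have e1 := Finset.card_sdiff_add_card_inter U ((y :: t) ++ [x]).toFinset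
        have e2 : U ∩ ((y :: t) ++ [x]).toFinset ⊆ U ∩ (a :: y :: t).toFinset := by
          intro v hv
          simp only [Finset.mem_inter, List.mem_toFinset, List.mem_append, List.mem_singleton]
            at hv ⊢
          refine ⟨hv.1, ?_⟩
          rcases hv.2 with h | h
          · exact List.mem_cons_of_mem _ h
          · exact absurd (h ▸ hv.1) hxU
        have e3 := Finset.card_le_card e2
        have e4 := nb_sdiff_card G y ((y :: t) ++ [x]) (by simp)
        have e5 := hdeg y
        have e6 : insert a (U \ ((y :: t) ++ [x]).toFinset) ⊆
            (U \ ((y :: t) ++ [x]).toFinset) ∪ (nb G y \ ((y :: t) ++ [x]).toFinset) := by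
          intro v hv
          rcases Finset.mem_insert.1 hv with rfl | hv
          · refine Finset.mem_union_right _ (Finset.mem_sdiff.2 ⟨?_, ?_⟩)
            · exact (mem_nb _ _ _).2 hch.1.symm
            · rw [List.mem_toFinset]; exact hanot
          · exact Finset.mem_union_left _ hv
        have e7 := Finset.card_le_card e6
        rw [Finset.card_insert_of_notMem (by simp [haU])] at e7
        exact embed G n m p _ hL hnd2 hch2 x y rfl List.getLast?_concat
          (by rw [← hUdef]; omega) (by omega) (by rw [← hUdef]; omega)

lemma high_case {V : Type*} [Fintype V] [DecidableEq V] (G : SimpleGraph V) (n m p : ℕ)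
    (hm : 1 ≤ m) (hp : 1 ≤ p) (hn : 2 * p + 1 ≤ n)
    (hV : Fintype.card V + 1 = 2 * (n + m + p)) (x : V) (hx : n + m + 2 * p ≤ (nb G x).card) :
    HasMonoLDS G (2 * p + 1) n m := by
  classical
  by_cases hZ : p + 1 ≤ (Finset.univ.filter (fun v => n + m + 2 * p ≤ (nb Gᶜ v).card)).card
  · obtain ⟨X, hX, hXc⟩ := Finset.exists_subset_card_eq hZ
    exact Or.inr (high_many Gᶜ n m p hV X hXc (fun v hv => (Finset.mem_filter.1 (hX hv)).2))
  · refine case_high G n m p hm hn hV x hx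
      (Finset.univ.filter (fun v => n + m + 2 * p ≤ (nb Gᶜ v).card)) (by omega) ?_ ?_
    · intro v hv
      simpa using hv
    · simp only [Finset.mem_filter, Finset.mem_univ, true_and, not_le]
      have := nb_card_compl G x
      omega

lemma upper {V : Type*} [Fintype V] [DecidableEq V] (G : SimpleGraph V) (n m p : ℕ)
    (hm : 1 ≤ m) (hp : 1 ≤ p) (hn : 2 * p + 1 ≤ n)
    (hV : Fintype.card V + 1 = 2 * (n + m + p)) : HasMonoLDS G (2 * p + 1) n m := by
  by_cases h1 : ∃ x, n + m + 2 * p ≤ (nb G x).card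
  · obtain ⟨x, hx⟩ := h1
    exact high_case G n m p hm hp hn hV x hx
  by_cases h2 : ∃ x, n + m + 2 * p ≤ (nb Gᶜ x).card
  · obtain ⟨x, hx⟩ := h2
    have := high_case Gᶜ n m p hm hp hn hV x hx
    rw [HasMonoLDS, compl_compl] at this
    exact this.symm
  push Not at h1 h2
  have hne : (Finset.univ : Finset V).Nonempty := by
    rw [← Finset.card_pos, Finset.card_univ]; omega
  obtain ⟨x, -, hx⟩ := Finset.exists_max_image Finset.univ (fun v => (nb G v).card) hne
  obtain ⟨y, -, hy⟩ := Finset.exists_max_image Finset.univ (fun v => (nb Gᶜ v).card) hne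
  rcases le_total (nb Gᶜ y).card (nb G x).card with h | h
  · exact Or.inl (core G n m p hm hp hn hV x (fun v => hx v (Finset.mem_univ _))
      (fun v => (hy v (Finset.mem_univ _)).trans h) (h1 x))
  · exact Or.inr (core Gᶜ n m p hm hp hn hV y (fun v => hy v (Finset.mem_univ _))
      (fun v => by rw [compl_compl]; exact (hx v (Finset.mem_univ _)).trans h) (h2 y))


lemma side_card {α : Type*} [Fintype α] {r M : ℕ} (hr : r ≤ 2 * M) (g : α → Fin r)
    (hg : Function.Injective g) (P : Prop) (h : ∀ a, ((g a : ℕ) < M ↔ P)) :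
    Fintype.card α ≤ M := by
  by_cases hP : P
  · have := Fintype.card_le_of_injective (fun a => (⟨(g a : ℕ), (h a).2 hP⟩ : Fin M)) (by
      intro a b hab
      simp only [Fin.mk.injEq] at hab
      exact hg (Fin.ext hab))
    simpa using this
  · have hge : ∀ a, M ≤ (g a : ℕ) := fun a => by
      by_contra hc
      exact hP ((h a).1 (by omega))
    have := Fintype.card_le_of_injective
      (fun a => (⟨(g a : ℕ) - M, by have := (g a).2; have := hge a; omega⟩ : Fin M)) (by
      intro a b hab
      simp only [Fin.mk.injEq] at hab
      have h1 := hge a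
      have h2 := hge b
      exact hg (Fin.ext (by omega)))
    simpa using this

/-- The graph made of two disjoint cliques, on `{i < M}` and on `{i ≥ M}`. -/
def twoCliques (r M : ℕ) : SimpleGraph (Fin r) where
  Adj a b := a ≠ b ∧ ((a : ℕ) < M ↔ (b : ℕ) < M)
  symm := ⟨fun _ _ h => ⟨h.1.symm, h.2.symm⟩⟩
  loopless := ⟨fun _ h => h.1 rfl⟩

lemma lower (n m p r : ℕ) (hm : 1 ≤ m) (hr : r ≤ 2 * (n + m + p - 1)) :
    ¬ IsRamseyLDS (2 * p + 1) n m r := by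
  intro H
  have hlink : ∀ i (hi : i + 1 < 2 * p + 1), (LinkedDoubleStar (2 * p + 1) n m).Adj
      (Sum.inl ⟨i, by omega⟩) (Sum.inl ⟨i + 1, hi⟩) := by
    intro i hi
    simp [LinkedDoubleStar, ldsRel]
  have hv : ∀ j, (LinkedDoubleStar (2 * p + 1) n m).Adj
      (Sum.inl ⟨0, by omega⟩) (Sum.inr (Sum.inl j)) := by
    intro j
    simp [LinkedDoubleStar, ldsRel]
  have hw : ∀ j, (LinkedDoubleStar (2 * p + 1) n m).Adj
      (Sum.inl ⟨2 * p, by omega⟩) (Sum.inr (Sum.inr j)) := by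
    intro j
    simp [LinkedDoubleStar, ldsRel]
  rcases H (twoCliques r (n + m + p - 1)) with ⟨f, hf, hadj⟩ | ⟨f, hf, hadj⟩
  · have hS : ∀ a b, (LinkedDoubleStar (2 * p + 1) n m).Adj a b →
        ((f a : ℕ) < n + m + p - 1 ↔ (f b : ℕ) < n + m + p - 1) := fun a b h => (hadj h).2
    have hl : ∀ i (hi : i < 2 * p + 1), ((f (Sum.inl ⟨i, hi⟩) : ℕ) < n + m + p - 1 ↔
        (f (Sum.inl ⟨0, by omega⟩) : ℕ) < n + m + p - 1) := by
      intro i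
      induction i with
      | zero => intro hi; rfl
      | succ i ih =>
        intro hi
        rw [← ih (by omega)]
        exact (hS _ _ (hlink i hi)).symm
    have := side_card hr f hf ((f (Sum.inl ⟨0, by omega⟩) : ℕ) < n + m + p - 1) (by
      rintro (⟨i, hi⟩ | j | j)
      · exact hl i hi
      · exact (hS _ _ (hv j)).symm
      · exact (hS _ _ (hw j)).symm.trans (hl _ _))
    simp only [Fintype.card_sum, Fintype.card_fin] at this
    omega
  · have hS : ∀ a b, (LinkedDoubleStar (2 * p + 1) n m).Adj a b →
        ((f b : ℕ) < n + m + p - 1 ↔ ¬ (f a : ℕ) < n + m + p - 1) := by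
      intro a b h
      have h1 := (compl_adj _ _ _).1 (hadj h)
      have h2 : ¬ ((f a : ℕ) < n + m + p - 1 ↔ (f b : ℕ) < n + m + p - 1) :=
        fun h3 => h1.2 ⟨h1.1, h3⟩
      tauto
    have hl : ∀ i (hi : 2 * i < 2 * p + 1), ((f (Sum.inl ⟨2 * i, hi⟩) : ℕ) < n + m + p - 1 ↔
        (f (Sum.inl ⟨0, by omega⟩) : ℕ) < n + m + p - 1) := by
      intro i
      induction i with
      | zero => intro hi; rfl
      | succ i ih =>
        intro hi
        rw [← ih (by omega)]
        have h1 := hS _ _ (hlink (2 * i) (by omega))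
        have h2 := hS _ _ (hlink (2 * i + 1) (by omega))
        rw [h1, not_not] at h2
        exact h2
    have hinj : Function.Injective
        (fun i : Fin p => (⟨2 * (i : ℕ) + 1, by omega⟩ : Fin (2 * p + 1))) := by
      intro i j hij
      have hij' : 2 * (i : ℕ) + 1 = 2 * (j : ℕ) + 1 := congrArg Fin.val hij
      exact Fin.ext (by omega)
    have := side_card (α := Fin p ⊕ Fin n ⊕ Fin m) hr
      (fun a => f (Sum.map (fun i : Fin p => (⟨2 * (i : ℕ) + 1, by omega⟩ : Fin (2 * p + 1))) id a))
      (hf.comp (Sum.map_injective.2 ⟨hinj, Function.injective_id⟩))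
      (¬ (f (Sum.inl ⟨0, by omega⟩) : ℕ) < n + m + p - 1) (by
      rintro (⟨i, hi⟩ | j | j)
      · simp only [Sum.map_inl]
        rw [hS _ _ (hlink (2 * i) (by omega)), hl i (by omega)]
      · exact hS _ _ (hv j)
      · simp only [Sum.map_inr, id]
        rw [hS _ _ (hw j), hl p (by omega)])
    simp only [Fintype.card_sum, Fintype.card_fin] at this
    omega

/-- if `n ≥ c = 2p+1` then `r(S_c(n,m)) = 2(n+m+p) − 1
  = 2(n+m) + c − 2`. -/
theorem lds_ramsey_eq_one (n m p : ℕ) (hm : 1 ≤ m) (hmn : m ≤ n) (hp : 1 ≤ p)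
    (hn : 2 * p + 1 ≤ n) :
    ramseyLDS (2 * p + 1) n m = 2 * (n + m + p) - 1 ∧
    ramseyLDS (2 * p + 1) n m = 2 * (n + m) + (2 * p + 1) - 2 := by
  have hmem : 2 * (n + m + p) - 1 ∈ {r | 0 < r ∧ IsRamseyLDS (2 * p + 1) n m r} :=
    ⟨by omega, fun G => upper G n m p hm hp hn (by simp only [Fintype.card_fin]; omega)⟩
  have h1 : ramseyLDS (2 * p + 1) n m ≤ 2 * (n + m + p) - 1 := Nat.sInf_le hmem
  have h2 : ramseyLDS (2 * p + 1) n m ∈ {r | 0 < r ∧ IsRamseyLDS (2 * p + 1) n m r} :=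
    Nat.sInf_mem ⟨_, hmem⟩
  have h3 : ¬ ramseyLDS (2 * p + 1) n m ≤ 2 * (n + m + p - 1) :=
    fun h => lower n m p _ hm h h2.2
  constructor <;> omega
end

section
/- Let p ≥ 4 be an integer, set c = 2p+1, and let n be an integer with 2 ≤ n ≤ p − 2. Then r(S_c(n,2)) = n + 3p + 3. -/
open SimpleGraph

/-- list form of a copy of the linked double star with link of odd order -/
def HasT {V : Type*} (G : SimpleGraph V) (p n : ℕ) : Prop :=
  ∃ (l : List V) (hd ls : V) (A B : Finset V), l.IsChain G.Adj ∧ l.Nodup ∧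
    l.length = 2 * p + 1 ∧ l.head? = some hd ∧ l.getLast? = some ls ∧ A.card = n ∧
    B.card = 2 ∧ Disjoint A B ∧ (∀ a ∈ A, a ∉ l ∧ G.Adj hd a) ∧ (∀ b ∈ B, b ∉ l ∧ G.Adj ls b)

theorem HasT.hasCopy {V : Type*} {G : SimpleGraph V} {p n : ℕ} (h : HasT G p n) :
    HasCopy (LinkedDoubleStar (2 * p + 1) n 2) G := by
  obtain ⟨l, hd, ls, A, B, hc, hnd, hlen, hhd, hls, hA, hB, hAB, hA2, hB2⟩ := h
  let eA := (Finset.equivFinOfCardEq hA).symm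
  let eB := (Finset.equivFinOfCardEq hB).symm
  let f : (Fin (2 * p + 1) ⊕ Fin n ⊕ Fin 2) → V := fun x => match x with
    | Sum.inl i => l[(i : ℕ)]'(by rw [hlen]; exact i.2)
    | Sum.inr (Sum.inl j) => (eA j : V)
    | Sum.inr (Sum.inr j) => (eB j : V)
  have hrel : ∀ a b, ldsRel (2 * p + 1) n 2 a b → G.Adj (f a) (f b) := by
    rintro (i | i | i) (j | j | j) hab <;> simp only [ldsRel] at hab
    · have := (List.isChain_iff_getElem.1 hc) (i : ℕ) (by have := j.2; omega)
      simpa [f, hab] using this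
    · have h0 : l[(i : ℕ)]'(by rw [hlen]; exact i.2) = hd := by
        rw [List.head?_eq_getElem?] at hhd
        obtain ⟨_, h⟩ := List.getElem?_eq_some_iff.1 hhd
        simpa [hab] using h
      simp only [f, h0]
      exact (hA2 _ (eA j).2).2
    · have h0 : l[(i : ℕ)]'(by rw [hlen]; exact i.2) = ls := by
        rw [List.getLast?_eq_getElem?] at hls
        obtain ⟨_, h⟩ := List.getElem?_eq_some_iff.1 hls
        simpa [hab, hlen] using h
      simp only [f, h0]
      exact (hB2 _ (eB j).2).2
  refine ⟨f, ?_, ?_⟩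
  · have hl : ∀ i : Fin (2 * p + 1), f (Sum.inl i) ∈ l := fun i => List.getElem_mem _
    have hdis : ∀ i j, (eA i : V) ≠ eB j := fun i j h =>
      Finset.disjoint_left.1 hAB (eA i).2 (h ▸ (eB j).2)
    rintro (i | i | i) (j | j | j) hab
    · have := (List.Nodup.getElem_inj_iff hnd).1 hab
      exact congrArg _ (Fin.ext this)
    · have h1 := hl i
      rw [hab] at h1
      exact absurd h1 (hA2 _ (eA j).2).1
    · have h1 := hl i
      rw [hab] at h1
      exact absurd h1 (hB2 _ (eB j).2).1
    · have h1 := hl j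
      rw [← hab] at h1
      exact absurd h1 (hA2 _ (eA i).2).1
    · have := eA.injective (Subtype.ext hab)
      rw [this]
    · exact absurd hab (hdis _ _)
    · have h1 := hl j
      rw [← hab] at h1
      exact absurd h1 (hB2 _ (eB i).2).1
    · exact absurd hab.symm (hdis _ _)
    · have := eB.injective (Subtype.ext hab)
      rw [this]
  · intro a b hab
    obtain ⟨_, h | h⟩ := (SimpleGraph.fromRel_adj _ _ _).1 hab
    · exact hrel _ _ h
    · exact (hrel _ _ h).symm

theorem mini_hall {V : Type*} [DecidableEq V] (A' B' : Finset V) (n m : ℕ) (hA : n ≤ A'.card)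
    (hB : m ≤ B'.card) (hAB : n + m ≤ (A' ∪ B').card) :
    ∃ A B : Finset V, A ⊆ A' ∧ B ⊆ B' ∧ A.card = n ∧ B.card = m ∧ Disjoint A B := by
  -- choose B with as much as possible outside the other set
  by_cases h : m ≤ (B' \ A').card
  · obtain ⟨B, hB1, hB2⟩ := Finset.exists_subset_card_eq h
    obtain ⟨A, hA1, hA2⟩ := Finset.exists_subset_card_eq hA
    refine ⟨A, B, hA1, hB1.trans Finset.sdiff_subset, hA2, hB2, ?_⟩
    rw [Finset.disjoint_left]
    intro a ha hb
    exact (Finset.mem_sdiff.1 (hB1 hb)).2 (hA1 ha)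
  · push Not at h
    obtain ⟨B, hB0, hB1, hB2⟩ := Finset.exists_subsuperset_card_eq
      (Finset.sdiff_subset : B' \ A' ⊆ B') h.le hB
    have hsub : (A' ∪ B') ⊆ (A' \ B) ∪ B := by
      intro x hx
      simp only [Finset.mem_union, Finset.mem_sdiff] at hx ⊢
      by_cases hxB : x ∈ B
      · exact Or.inr hxB
      · refine Or.inl ⟨?_, hxB⟩
        rcases hx with hx | hx
        · exact hx
        · by_contra hxa
          exact hxB (hB0 (Finset.mem_sdiff.2 ⟨hx, hxa⟩))
    have h1 := Finset.card_le_card hsub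
    have h2 := Finset.card_union_le (A' \ B) B
    obtain ⟨A, hA1, hA2⟩ := Finset.exists_subset_card_eq (show n ≤ (A' \ B).card by omega)
    refine ⟨A, B, hA1.trans Finset.sdiff_subset, hB1, hA2, hB2, ?_⟩
    rw [Finset.disjoint_left]
    intro a ha hb
    exact (Finset.mem_sdiff.1 (hA1 ha)).2 hb


theorem chain_app {V : Type*} {R : V → V → Prop} {a b : List V} {u w : V} (ha : a.IsChain R)
    (hb : b.IsChain R) (hu : a.getLast? = some u) (hw : b.head? = some w) (h : R u w) :
    (a ++ b).IsChain R := by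
  rw [List.isChain_append]
  refine ⟨ha, hb, ?_⟩
  intro x hx y hy
  rw [hu] at hx
  rw [hw] at hy
  simp only [Option.mem_def, Option.some.injEq] at hx hy
  subst hx hy
  exact h

theorem chain_rev {V : Type*} {R : V → V → Prop} (hR : ∀ a b, R a b → R b a) {a : List V}
    (ha : a.IsChain R) : a.reverse.IsChain R := by
  rw [List.isChain_reverse]
  exact ha.imp (fun a b h => hR _ _ h)

/-- one step of the path cover lemma -/
theorem path_step {V : Type*} [DecidableEq V] {R : V → V → Prop} (hsym : ∀ a b, R a b → R b a)
    [DecidableRel R] {X Y : Finset V} (hXY : Disjoint X Y)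
    (hR : ∀ a b, R a b → (a ∈ X ∧ b ∈ Y) ∨ (a ∈ Y ∧ b ∈ X)) (k : ℕ)
    (hdeg : ∀ x ∈ X, k ≤ (Y.filter (R x)).card) (hY : Y.card + 2 ≤ 2 * k)
    {l : List V} {xl xb x0 : V} {m : ℕ} (hl : l.IsChain R) (hnd : l.Nodup)
    (hhd : l.head? = some xl) (hls : l.getLast? = some xb) (hxl : xl ∈ X) (hxb : xb ∈ X)
    (hx0 : x0 ∈ X) (hx0l : x0 ∉ l) (hm2 : 2 ≤ m) (hmk : m ≤ k) (hlen : l.length + 1 = 2 * m)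
    (hlX : (X.filter (· ∈ l)).card = m) (hmem : ∀ v ∈ l, v ∈ X ∨ v ∈ Y) :
    ∃ l' : List V, l'.IsChain R ∧ l'.Nodup ∧ l'.head? = some xl ∧ l'.getLast? = some xb ∧
      l'.length = l.length + 2 ∧ (∀ v ∈ X, v ∈ l' ↔ (v ∈ l ∨ v = x0)) ∧
      (∀ v ∈ l', v ∈ X ∨ v ∈ Y) := by
  have hXnY : ∀ v, v ∈ X → v ∉ Y := fun v h h' => Finset.disjoint_left.1 hXY h h'
  have hlY : (Y.filter (· ∈ l)).card + 1 = m := by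
    have h1 : l.toFinset = X.filter (· ∈ l) ∪ Y.filter (· ∈ l) := by
      ext v
      simp only [List.mem_toFinset, Finset.mem_union, Finset.mem_filter]
      constructor
      · intro hv
        rcases hmem v hv with h | h
        · exact Or.inl ⟨h, hv⟩
        · exact Or.inr ⟨h, hv⟩
      · rintro (h | h) <;> exact h.2
    have h2 := List.toFinset_card_of_nodup hnd
    rw [h1, Finset.card_union_of_disjoint] at h2
    · omega
    · exact Finset.disjoint_filter_filter hXY
  set S := Y.filter (· ∉ l) with hS
  have hScard : S.card + m = Y.card + 1 := by
    have h0 : (Y.filter (· ∈ l)).card + S.card = Y.card := by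
      rw [hS]
      convert Finset.card_filter_add_card_filter_not (s := Y) (· ∈ l)
    omega
  have hNS : ∀ x ∈ X, k + 1 ≤ (S.filter (R x)).card + m := by
    intro x hx
    have h1 := hdeg x hx
    have h2 : (Y.filter (R x)) ⊆ (S.filter (R x)) ∪ Y.filter (· ∈ l) := by
      intro v hv
      simp only [hS, Finset.mem_union, Finset.mem_filter] at hv ⊢
      tauto
    have h3 := Finset.card_le_card h2
    have h4 := Finset.card_union_le (S.filter (R x)) (Y.filter (· ∈ l))
    omega
  let g : ℕ → V := fun i => l.getD i x0
  have hg : ∀ i (h : i < l.length), g i = l[i] := fun i h => by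
    simp only [g]; rw [List.getD_eq_getElem _ _ h]
  have hglast : g (l.length - 1) = xb := by
    rw [hg _ (by omega)]
    rw [List.getLast?_eq_getElem?] at hls
    exact (List.getElem?_eq_some_iff.1 hls).2
  set J := (Finset.range l.length).filter (fun i => g i ∈ Y ∧ R x0 (g i)) with hJ
  have hJlt : ∀ i ∈ J, i + 1 < l.length := by
    intro i hi
    simp only [hJ, Finset.mem_filter, Finset.mem_range] at hi
    by_contra hcon
    have : i = l.length - 1 := by omega
    rw [this, hglast] at hi
    exact hXnY _ hxb hi.2.1
  have hchain : ∀ i, i + 1 < l.length → R (g i) (g (i + 1)) := by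
    intro i hi
    rw [hg _ (by omega), hg _ hi]
    exact List.isChain_iff_getElem.1 hl i hi
  have hJX : ∀ i ∈ J, g (i + 1) ∈ X := by
    intro i hi
    have h1 := hchain i (hJlt i hi)
    simp only [hJ, Finset.mem_filter, Finset.mem_range] at hi
    rcases hR _ _ h1 with h | h
    · exact absurd hi.2.1 (hXnY _ h.1)
    · exact h.2
  set Q := S.filter (R x0) with hQ
  have hQcard : k ≤ Q.card + J.card := by
    have h1 := hdeg x0 hx0
    have h2 : (Y.filter (R x0)) ⊆ Q ∪ J.image g := by
      intro v hv
      simp only [hQ, hS, hJ, Finset.mem_union, Finset.mem_filter, Finset.mem_image,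
        Finset.mem_range] at hv ⊢
      by_cases hvl : v ∈ l
      · right
        obtain ⟨i, hi, rfl⟩ := List.getElem_of_mem hvl
        refine ⟨i, ⟨hi, ?_⟩, hg i hi⟩
        rw [hg i hi]
        exact hv
      · left
        tauto
    have h3 := Finset.card_le_card h2
    have h4 := Finset.card_union_le Q (J.image g)
    have h5 : (J.image g).card ≤ J.card := Finset.card_image_le
    omega
  have htake : ∀ i, i < l.length → (l.take (i + 1)).getLast? = some (g i) := by
    intro i hi
    rw [hg i hi, List.getLast?_take]
    simp [hi]
  have hdrop : ∀ i, i < l.length → (l.drop i).head? = some (g i) := by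
    intro i hi
    rw [hg i hi, List.head?_drop]
    simp [hi]
  have hheadtake : ∀ i, (l.take (i + 1)).head? = some xl := by
    intro i
    rw [List.head?_take]
    simp [hhd]
  have hlastdrop : ∀ i, i < l.length → (l.drop i).getLast? = some xb := by
    intro i hi
    rw [List.getLast?_drop]
    simp [hls]
    omega
  have hSl : ∀ q ∈ S, q ∈ Y ∧ q ∉ l := fun q hq => by simpa [hS] using hq
  have hne : ∀ q ∈ S, x0 ≠ q := fun q hq h => hXnY _ hx0 (h ▸ (hSl q hq).1)
  -- a permutation argument
  have hperm : ∀ (l' : List V) (q : V), q ∈ S → l'.Perm (x0 :: q :: l) →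
      l'.Nodup ∧ l'.length = l.length + 2 ∧ (∀ v ∈ X, v ∈ l' ↔ (v ∈ l ∨ v = x0)) ∧
      (∀ v ∈ l', v ∈ X ∨ v ∈ Y) := by
    intro l' q hq hp
    have hq2 := hSl q hq
    refine ⟨?_, ?_, ?_, ?_⟩
    · rw [hp.nodup_iff]
      simp [hnd, hx0l, hq2.2, hne q hq]
    · simpa using hp.length_eq
    · intro v hv
      rw [hp.mem_iff]
      have : v ≠ q := fun h => hXnY _ hv (h ▸ hq2.1)
      simp [this, or_comm]
    · intro v hv
      rw [hp.mem_iff] at hv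
      simp only [List.mem_cons] at hv
      rcases hv with h | h | h
      · exact Or.inl (h ▸ hx0)
      · exact Or.inr (h ▸ hq2.1)
      · exact hmem v h
  -- (I1)
  by_cases hI1 : ∃ i ∈ J, ∃ q ∈ Q, R (g (i + 1)) q
  · obtain ⟨i, hi, q, hq, hiq⟩ := hI1
    have hi' := hJlt i hi
    have hq' : q ∈ S ∧ R x0 q := by simpa [hQ] using hq
    have hi2 : g i ∈ Y ∧ R x0 (g i) := (Finset.mem_filter.1 hi).2
    have hp : (l.take (i + 1) ++ ([x0, q] ++ l.drop (i + 1))).Perm (x0 :: q :: l) := by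
      have h1 : (l.take (i + 1) ++ ([x0, q] ++ l.drop (i + 1))).Perm
        ([x0, q] ++ (l.take (i + 1) ++ l.drop (i + 1))) := by
          rw [← List.append_assoc, ← List.append_assoc]
          exact List.Perm.append_right _ List.perm_append_comm
      rw [List.take_append_drop] at h1
      exact h1
    obtain ⟨h1, h2, h3, h4⟩ := hperm _ q hq'.1 hp
    refine ⟨_, ?_, h1, ?_, ?_, h2, h3, h4⟩
    · refine chain_app (hl.take _) (chain_app ?_ (hl.drop _) (u := q) ?_ (hdrop _ hi') ?_)
        (htake i (by omega)) (w := x0) ?_ ?_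
      · simpa using hq'.2
      · simp
      · exact hsym _ _ hiq
      · simp
      · exact hsym _ _ hi2.2
    · rw [List.head?_append, hheadtake]; rfl
    · rw [List.getLast?_append, List.getLast?_append, hlastdrop _ hi']; rfl
  by_cases hI3 : ∃ i ∈ J, ∃ j ∈ J, i < j ∧ ∃ r ∈ S, R (g (i + 1)) r ∧ R (g (j + 1)) r
  · obtain ⟨i, hi, j, hj, hij, r, hr, hir, hjr⟩ := hI3
    have hi' := hJlt i hi
    have hj' := hJlt j hj
    have hi2 : g i ∈ Y ∧ R x0 (g i) := (Finset.mem_filter.1 hi).2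
    have hj2 : g j ∈ Y ∧ R x0 (g j) := (Finset.mem_filter.1 hj).2
    set b := (l.take (j + 1)).drop (i + 1) with hb
    have hlb : l.take (i + 1) ++ (b ++ l.drop (j + 1)) = l := by
      have h1 : l.take (i + 1) = (l.take (j + 1)).take (i + 1) := by
        rw [List.take_take]; congr 1; omega
      rw [h1, ← List.append_assoc, hb, List.take_append_drop, List.take_append_drop]
    have hbh : b.head? = some (g (i + 1)) := by
      rw [hb, List.head?_drop, List.getElem?_take, if_pos (by omega), hg _ hi']
      simp [hi']
    have hbl : b.getLast? = some (g j) := by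
      rw [hb, List.getLast?_drop, htake j (by omega), if_neg]
      simp
      omega
    have hp : (l.take (i + 1) ++ ([x0] ++ (b.reverse ++ ([r] ++ l.drop (j + 1))))).Perm
        (x0 :: r :: l) := by
      rw [List.perm_iff_count]
      intro a
      conv_rhs => rw [← hlb]
      simp only [List.count_append, List.count_cons, List.count_reverse, List.count_nil]
      omega
    obtain ⟨h1, h2, h3, h4⟩ := hperm _ r hr hp
    refine ⟨_, ?_, h1, ?_, ?_, h2, h3, h4⟩
    · refine chain_app (w := x0) (hl.take _) (chain_app (u := x0) (w := g j) (by simp)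
        (chain_app (u := g (i + 1)) (w := r) (chain_rev hsym ((hl.take _).drop _))
        (chain_app (u := r) (by simp) (hl.drop _) (by simp) (hdrop _ hj') ?_)
        ?_ (by simp) ?_) (by simp) ?_ ?_) (htake i (by omega)) ?_ ?_
      · exact hsym _ _ hjr
      · rw [List.getLast?_reverse, hbh]
      · exact hir
      · rw [List.head?_append, List.head?_reverse, hbl]; rfl
      · exact hj2.2
      · simp
      · exact hsym _ _ hi2.2
    · rw [List.head?_append, hheadtake]; rfl
    · rw [List.getLast?_append, List.getLast?_append, List.getLast?_append, List.getLast?_append,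
        hlastdrop _ hj']; rfl
  push Not at hI1 hI3
  rcases Nat.eq_zero_or_pos J.card with hJ0 | hJpos
  · -- μ = 0
    have hQk : k ≤ Q.card := by omega
    have hQx : ∀ x ∈ X, 2 ≤ (Q.filter (R x)).card := by
      intro x hx
      have h1 := hNS x hx
      have h2 : S.filter (R x) ⊆ Q.filter (R x) ∪ (S \ Q) := by
        intro v hv
        simp only [Finset.mem_union, Finset.mem_filter, Finset.mem_sdiff] at hv ⊢
        tauto
      have h3 := Finset.card_le_card h2
      have h4 := Finset.card_union_le (Q.filter (R x)) (S \ Q)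
      have h5 : (S \ Q).card + Q.card = S.card :=
        Finset.card_sdiff_add_card_eq_card (Finset.filter_subset _ _)
      omega
    match l, hl, hnd, hhd, hls, hlen, hmem, hchain, hg, hSl, hx0l, hQ, hS with
    | x1 :: y1 :: x2 :: rest, hl, hnd, hhd, hls, hlen, hmem, hchain, hg, hSl, hx0l, hQ, hS =>
      have e1 : x1 = xl := by simpa using hhd
      subst e1
      simp only [List.isChain_cons_cons] at hl
      have hy1 : y1 ∈ Y := by
        rcases hR _ _ hl.1 with h | h
        · exact h.2
        · exact absurd h.1 (hXnY _ hxl)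
      have hx2 : x2 ∈ X := by
        rcases hR _ _ hl.2.1 with h | h
        · exact absurd hy1 (hXnY _ h.1)
        · exact h.2
      obtain ⟨q, hq⟩ : (Q.filter (R x1)).Nonempty := by
        rw [← Finset.card_pos]; have := hQx _ hxl; omega
      obtain ⟨q', hq', hqq⟩ := Finset.exists_mem_ne (hQx _ hx2) q
      have hq1 : q ∈ Q ∧ R x1 q := by simpa using hq
      have hq1' : q' ∈ Q ∧ R x2 q' := by simpa using hq'
      have hq2 : q ∈ S ∧ R x0 q := Finset.mem_filter.1 hq1.1
      have hq2' : q' ∈ S ∧ R x0 q' := Finset.mem_filter.1 hq1'.1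
      have hq3 := hSl q hq2.1
      have hq3' := hSl q' hq2'.1
      have hn1 := hne q hq2.1
      have hn2 := hne q' hq2'.1
      refine ⟨x1 :: q :: x0 :: q' :: x2 :: rest, ?_, ?_, rfl, ?_, ?_, ?_, ?_⟩
      · simp only [List.isChain_cons_cons]
        exact ⟨hq1.2, hsym _ _ hq2.2, hq2'.2, hsym _ _ hq1'.2, hl.2.2⟩
      · simp only [List.nodup_cons, List.mem_cons, not_or] at *
        grind
      · simpa using hls
      · simp
      · intro v hv
        have a1 : v ≠ q := fun h => hXnY _ hv (h ▸ hq3.1)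
        have a2 : v ≠ q' := fun h => hXnY _ hv (h ▸ hq3'.1)
        have a3 : v ≠ y1 := fun h => hXnY _ hv (h ▸ hy1)
        simp [a1, a2, a3]
        tauto
      · intro v hv
        simp only [List.mem_cons] at hv hmem
        rcases hv with h | h | h | h | h | h
        · exact Or.inl (h ▸ hxl)
        · exact Or.inr (h ▸ hq3.1)
        · exact Or.inl (h ▸ hx0)
        · exact Or.inr (h ▸ hq3'.1)
        · exact Or.inl (h ▸ hx2)
        · exact hmem v (by tauto)
    | [], hl, hnd, hhd, hls, hlen, _, _, _, _, _, _, _ => simp at hhd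
    | [a], hl, hnd, hhd, hls, hlen, _, _, _, _, _, _, _ => simp at hlen; omega
    | [a, b], hl, hnd, hhd, hls, hlen, _, _, _, _, _, _, _ => simp at hlen; omega
  · exfalso
    have hd : ((J.biUnion fun i => S.filter (R (g (i + 1)))) ∪ Q).card ≤ S.card := by
      apply Finset.card_le_card
      intro v hv
      simp only [Finset.mem_union, Finset.mem_biUnion, hQ, Finset.mem_filter] at hv
      rcases hv with ⟨_, _, h, _⟩ | h
      · exact h
      · exact h.1
    rw [Finset.card_union_of_disjoint, Finset.card_biUnion] at hd
    · have h1 : J.card * (k + 1 - m) ≤ ∑ i ∈ J, (S.filter (R (g (i + 1)))).card := by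
        rw [← smul_eq_mul]
        apply Finset.card_nsmul_le_sum
        intro i hi
        have := hNS _ (hJX i hi)
        omega
      obtain ⟨d, rfl⟩ := Nat.exists_eq_add_of_le hmk
      have h2 : m + d + 1 - m = d + 1 := by omega
      rw [h2] at h1
      have h3 : d ≤ J.card * d := Nat.le_mul_of_pos_left d hJpos
      have h4 : J.card * (d + 1) = J.card * d + J.card := by ring
      omega
    · intro i hi j hj hij
      simp only [Finset.disjoint_left, Finset.mem_filter]
      rintro v ⟨hv, h1⟩ ⟨_, h2⟩
      rcases lt_or_gt_of_ne hij with h | h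
      · exact hI3 i hi j hj h v hv h1 h2
      · exact hI3 j hj i hi h v hv h2 h1
    · rw [Finset.disjoint_left]
      intro v hv hvQ
      simp only [Finset.mem_biUnion, Finset.mem_filter] at hv
      obtain ⟨i, hi, _, h⟩ := hv
      exact hI1 i hi v hvQ h

/-- weak Jackson lemma: covering `X` by an alternating path with prescribed ends -/
theorem path_cover {V : Type*} [DecidableEq V] {B : SimpleGraph V} [DecidableRel B.Adj]
    {X Y : Finset V} (hXY : Disjoint X Y) (k : ℕ)
    (hdeg : ∀ x ∈ X, k ≤ (Y.filter (B.Adj x)).card) (hX : X.card ≤ k + 1)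
    (hY : Y.card + 2 ≤ 2 * k) {xl xb : V} (hxl : xl ∈ X) (hxb : xb ∈ X) (hne : xl ≠ xb) :
    ∃ l : List V, l.IsChain B.Adj ∧ l.Nodup ∧ l.head? = some xl ∧ l.getLast? = some xb ∧
      l.length + 1 = 2 * X.card ∧ (∀ v ∈ X, v ∈ l) ∧ (∀ v ∈ l, v ∈ X ∨ v ∈ Y) ∧
      (Y.filter (· ∈ l)).card + 1 = X.card := by
  have hXnY : ∀ v, v ∈ X → v ∉ Y := fun v h h' => Finset.disjoint_left.1 hXY h h'
  let R : V → V → Prop := fun a b => B.Adj a b ∧ ((a ∈ X ∧ b ∈ Y) ∨ (a ∈ Y ∧ b ∈ X))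
  have hsym : ∀ a b, R a b → R b a := fun a b h => ⟨h.1.symm, by tauto⟩
  have hdR : DecidableRel R := fun a b => Classical.dec _
  have hR : ∀ a b, R a b → (a ∈ X ∧ b ∈ Y) ∨ (a ∈ Y ∧ b ∈ X) := fun a b h => h.2
  have hdeg' : ∀ x ∈ X, k ≤ (Y.filter (R x)).card := by
    intro x hx
    have : Y.filter (R x) = Y.filter (B.Adj x) := by
      ext v
      simp only [R, Finset.mem_filter]
      tauto
    rw [this]
    exact hdeg x hx
  have main : ∀ m, 2 ≤ m → m ≤ X.card → ∃ l : List V, l.IsChain R ∧ l.Nodup ∧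
      l.head? = some xl ∧ l.getLast? = some xb ∧ l.length + 1 = 2 * m ∧
      (X.filter (· ∈ l)).card = m ∧ (∀ v ∈ l, v ∈ X ∨ v ∈ Y) := by
    intro m hm
    induction m, hm using Nat.le_induction with
    | base =>
      intro _
      have h1 := hdeg' xl hxl
      have h2 := hdeg' xb hxb
      have h3 : ((Y.filter (R xl)) ∪ (Y.filter (R xb))).card ≤ Y.card :=
        Finset.card_le_card (by simp [Finset.union_subset_iff])
      have h4 := Finset.card_union_add_card_inter (Y.filter (R xl)) (Y.filter (R xb))
      obtain ⟨y, hy⟩ : ((Y.filter (R xl)) ∩ (Y.filter (R xb))).Nonempty := by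
        rw [← Finset.card_pos]; omega
      simp only [Finset.mem_inter, Finset.mem_filter] at hy
      have y1 : xl ≠ y := fun h => hXnY _ hxl (h ▸ hy.1.1)
      have y2 : y ≠ xb := fun h => hXnY _ hxb (h ▸ hy.1.1)
      refine ⟨[xl, y, xb], ?_, ?_, rfl, rfl, rfl, ?_, ?_⟩
      · simp [hy.1.2, hsym _ _ hy.2.2]
      · simp [y1, y2, hne]
      · have : X.filter (· ∈ [xl, y, xb]) = {xl, xb} := by
          ext v
          simp only [Finset.mem_filter, List.mem_cons, List.not_mem_nil, or_false,
            Finset.mem_insert, Finset.mem_singleton]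
          constructor
          · rintro ⟨h, h' | h' | h'⟩
            · exact Or.inl h'
            · exact absurd (h' ▸ hy.1.1) (hXnY _ h)
            · exact Or.inr h'
          · rintro (h | h)
            · exact ⟨h ▸ hxl, Or.inl h⟩
            · exact ⟨h ▸ hxb, Or.inr (Or.inr h)⟩
        rw [this, Finset.card_pair hne]
      · intro v hv
        simp only [List.mem_cons, List.not_mem_nil, or_false] at hv
        rcases hv with h | h | h
        · exact Or.inl (h ▸ hxl)
        · exact Or.inr (h ▸ hy.1.1)
        · exact Or.inl (h ▸ hxb)
    | succ m hm ih =>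
      intro hmX
      obtain ⟨l, h1, h2, h3, h4, h5, h6, h7⟩ := ih (by omega)
      obtain ⟨x0, hx0⟩ : (X \ X.filter (· ∈ l)).Nonempty := by
        rw [← Finset.card_pos]
        have := Finset.card_sdiff_add_card_eq_card (Finset.filter_subset (· ∈ l) X)
        omega
      simp only [Finset.mem_sdiff, Finset.mem_filter, not_and] at hx0
      obtain ⟨l', g1, g2, g3, g4, g5, g6, g7⟩ := path_step hsym hXY hR k hdeg' hY h1 h2 h3 h4
        hxl hxb hx0.1 (hx0.2 hx0.1) hm (by omega) h5 h6 h7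
      refine ⟨l', g1, g2, g3, g4, by omega, ?_, g7⟩
      have : X.filter (· ∈ l') = insert x0 (X.filter (· ∈ l)) := by
        ext v
        simp only [Finset.mem_filter, Finset.mem_insert]
        constructor
        · rintro ⟨h, h'⟩
          have := (g6 v h).1 h'
          tauto
        · rintro (h | h)
          · have : v ∈ X := h ▸ hx0.1
            exact ⟨this, (g6 v this).2 (Or.inr h)⟩
          · exact ⟨h.1, (g6 v h.1).2 (Or.inl h.2)⟩
      rw [this, Finset.card_insert_of_notMem, h6]
      simp only [Finset.mem_filter, not_and]
      exact hx0.2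
  have hX2 : 2 ≤ X.card := by
    have : ({xl, xb} : Finset V) ⊆ X := by
      intro v hv
      simp only [Finset.mem_insert, Finset.mem_singleton] at hv
      rcases hv with h | h
      · exact h ▸ hxl
      · exact h ▸ hxb
    have := Finset.card_le_card this
    rwa [Finset.card_pair hne] at this
  obtain ⟨l, h1, h2, h3, h4, h5, h6, h7⟩ := main X.card hX2 le_rfl
  refine ⟨l, h1.imp (fun a b h => h.1), h2, h3, h4, h5, ?_, h7, ?_⟩
  · have := Finset.eq_of_subset_of_card_le (Finset.filter_subset (· ∈ l) X) h6.ge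
    intro v hv
    rw [← this] at hv
    exact (Finset.mem_filter.1 hv).2
  · have e1 : l.toFinset = X.filter (· ∈ l) ∪ Y.filter (· ∈ l) := by
      ext v
      simp only [List.mem_toFinset, Finset.mem_union, Finset.mem_filter]
      constructor
      · intro hv
        rcases h7 v hv with h | h
        · exact Or.inl ⟨h, hv⟩
        · exact Or.inr ⟨h, hv⟩
      · rintro (h | h) <;> exact h.2
    have e2 := List.toFinset_card_of_nodup h2
    rw [e1, Finset.card_union_of_disjoint] at e2
    · omega
    · exact Finset.disjoint_filter_filter hXY


theorem lds_adj_link {p n m i : ℕ} (h : i + 1 < 2 * p + 1) :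
    (LinkedDoubleStar (2 * p + 1) n m).Adj (Sum.inl ⟨i, by omega⟩) (Sum.inl ⟨i + 1, h⟩) := by
  refine (SimpleGraph.fromRel_adj _ _ _).2 ⟨?_, Or.inl ?_⟩
  · simp
  · simp [ldsRel]

theorem lds_adj_left {p n m : ℕ} (j : Fin n) :
    (LinkedDoubleStar (2 * p + 1) n m).Adj (Sum.inl ⟨0, by omega⟩) (Sum.inr (Sum.inl j)) := by
  refine (SimpleGraph.fromRel_adj _ _ _).2 ⟨?_, Or.inl ?_⟩
  · simp
  · simp [ldsRel]

theorem lds_adj_right {p n m : ℕ} (j : Fin m) :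
    (LinkedDoubleStar (2 * p + 1) n m).Adj (Sum.inl ⟨2 * p, by omega⟩) (Sum.inr (Sum.inr j)) := by
  refine (SimpleGraph.fromRel_adj _ _ _).2 ⟨?_, Or.inl ?_⟩
  · simp
  · simp [ldsRel]

theorem card_le_of_inj_Ico {α : Type*} [Fintype α] (g : α → ℕ) (hg : Function.Injective g)
    (a b : ℕ) (h : ∀ x, a ≤ g x ∧ g x < b) : Fintype.card α ≤ b - a := by
  have := Finset.card_le_card_of_injOn (s := Finset.univ) (t := Finset.Ico a b) g
    (fun x _ => by simpa using h x) hg.injOn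
  simpa using this

theorem lower_bound (p n r : ℕ) (hn : 1 ≤ n) (hr : r ≤ n + 3 * p + 2) :
    ¬ IsRamseyLDS (2 * p + 1) n 2 r := by
  intro H
  rcases H (twoCliques r (2 * p + n + 2)) with ⟨f, hf, hadj⟩ | ⟨f, hf, hadj⟩
  · have hs : ∀ a b, (LinkedDoubleStar (2 * p + 1) n 2).Adj a b →
        ((f a : ℕ) < 2 * p + n + 2 ↔ (f b : ℕ) < 2 * p + n + 2) := fun a b h => (hadj h).2
    have hlink : ∀ i (h : i < 2 * p + 1), ((f (Sum.inl ⟨0, by omega⟩) : ℕ) < 2 * p + n + 2 ↔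
        (f (Sum.inl ⟨i, h⟩) : ℕ) < 2 * p + n + 2) := by
      intro i
      induction i with
      | zero => intro h; exact Iff.rfl
      | succ i ih => intro h; exact (ih (by omega)).trans (hs _ _ (lds_adj_link h))
    have hall : ∀ x, ((f (Sum.inl ⟨0, by omega⟩) : ℕ) < 2 * p + n + 2 ↔
        (f x : ℕ) < 2 * p + n + 2) := by
      rintro (i | i | i)
      · exact hlink i i.2
      · exact hs _ _ (lds_adj_left i)
      · exact (hlink (2 * p) (by omega)).trans (hs _ _ (lds_adj_right i))
    have hinj : Function.Injective (fun x => (f x : ℕ)) := fun a b h => hf (Fin.ext h)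
    by_cases h0 : (f (Sum.inl ⟨0, by omega⟩) : ℕ) < 2 * p + n + 2
    · have := card_le_of_inj_Ico _ hinj 0 (2 * p + n + 2) (fun x => ⟨by omega, (hall x).1 h0⟩)
      simp at this
      omega
    · have := card_le_of_inj_Ico _ hinj (2 * p + n + 2) r
        (fun x => ⟨by have := hall x; omega, (f x).2⟩)
      simp at this
      omega
  · have hs : ∀ a b, (LinkedDoubleStar (2 * p + 1) n 2).Adj a b →
        ¬ ((f a : ℕ) < 2 * p + n + 2 ↔ (f b : ℕ) < 2 * p + n + 2) := by
      intro a b h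
      have := hadj h
      rw [SimpleGraph.compl_adj] at this
      exact fun h' => this.2 ⟨this.1, h'⟩
    have hlink : ∀ i (h : i < 2 * p + 1), ((f (Sum.inl ⟨0, by omega⟩) : ℕ) < 2 * p + n + 2 ↔
        ((f (Sum.inl ⟨i, h⟩) : ℕ) < 2 * p + n + 2 ↔ i % 2 = 0)) := by
      intro i
      induction i with
      | zero => intro h; simp
      | succ i ih =>
        intro h
        have h1 := ih (by omega)
        have h2 := hs _ _ (lds_adj_link h)
        rw [h1]
        omega
    have hinj : Function.Injective (fun x => (f x : ℕ)) := fun a b h => hf (Fin.ext h)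
    by_cases h0 : (f (Sum.inl ⟨0, by omega⟩) : ℕ) < 2 * p + n + 2
    · let e : Fin p ⊕ Fin n → (Fin (2 * p + 1) ⊕ Fin n ⊕ Fin 2) := fun x => match x with
        | Sum.inl i => Sum.inl ⟨2 * i + 1, by omega⟩
        | Sum.inr j => Sum.inr (Sum.inl j)
      have he : Function.Injective e := by
        rintro (i | i) (j | j) h <;> simp [e] at h ⊢
        · exact Fin.ext h
        · exact h
      have := card_le_of_inj_Ico _ (hinj.comp he) (2 * p + n + 2) r (by
        intro x
        refine ⟨?_, (f (e x)).2⟩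
        rcases x with i | j
        · have := hlink (2 * i + 1) (by omega)
          simp only [Function.comp, e]
          omega
        · have := hs _ _ (lds_adj_left (p := p) (m := 2) j)
          simp only [Function.comp, e]
          omega)
      simp at this
      omega
    · let e : Fin (p + 1) → (Fin (2 * p + 1) ⊕ Fin n ⊕ Fin 2) := fun i =>
        Sum.inl ⟨2 * i, by omega⟩
      have he : Function.Injective e := by
        intro i j h
        simp [e] at h
        exact Fin.ext h
      have := card_le_of_inj_Ico _ (hinj.comp he) (2 * p + n + 2) r (by
        intro i
        refine ⟨?_, (f (e i)).2⟩
        have := hlink (2 * i) (by omega)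
        simp only [Function.comp, e]
        omega)
      simp at this
      omega

theorem ramsey_of_upper (p n : ℕ) (hn : 1 ≤ n) (hup : IsRamseyLDS (2 * p + 1) n 2 (n + 3 * p + 3)) :
    ramseyLDS (2 * p + 1) n 2 = n + 3 * p + 3 := by
  apply le_antisymm
  · exact Nat.sInf_le ⟨by omega, hup⟩
  · refine le_csInf (s := {r | 0 < r ∧ IsRamseyLDS (2 * p + 1) n 2 r})
      ⟨n + 3 * p + 3, by omega, hup⟩ ?_
    rintro r ⟨_, hr⟩
    by_contra hcon
    exact lower_bound p n r hn (by omega) hr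


/-- cyclic sequences `g 0, …, g (L-1)` forming a cycle of `G` -/
def FCyc {V : Type*} (G : SimpleGraph V) (g : ℕ → V) (L : ℕ) : Prop :=
  3 ≤ L ∧ (∀ i j, i < L → j < L → g i = g j → i = j) ∧
    (∀ i, i + 1 < L → G.Adj (g i) (g (i + 1))) ∧ G.Adj (g (L - 1)) (g 0)

/-- a cycle in list form -/
def IsCyc {V : Type*} (G : SimpleGraph V) (l : List V) : Prop :=
  l.IsChain G.Adj ∧ l.Nodup ∧ 3 ≤ l.length ∧
    ∀ a ∈ l.getLast?, ∀ b ∈ l.head?, G.Adj a b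

theorem IsCyc.fcyc {V : Type*} {G : SimpleGraph V} {l : List V} (h : IsCyc G l) :
    ∃ g, FCyc G g l.length := by
  obtain ⟨h1, h2, h3, h4⟩ := h
  have hne : l ≠ [] := by rintro rfl; simp at h3
  let g : ℕ → V := fun i => l.getD i (l.head hne)
  have hg : ∀ i (h : i < l.length), g i = l[i] := fun i h => by
    simp only [g]; rw [List.getD_eq_getElem _ _ h]
  refine ⟨g, h3, ?_, ?_, ?_⟩
  · intro i j hi hj hij
    rw [hg i hi, hg j hj] at hij
    exact (List.Nodup.getElem_inj_iff h2).1 hij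
  · intro i hi
    rw [hg i (by omega), hg _ hi]
    exact List.isChain_iff_getElem.1 h1 i hi
  · apply h4
    · rw [hg _ (by omega), List.getLast?_eq_getElem?]
      simp
    · rw [hg _ (by omega), List.head?_eq_getElem?]
      simp

/-- reindexing a sequence -/
theorem FCyc.sub {V : Type*} {G H : SimpleGraph V} {g : ℕ → V} {L : ℕ} (h : FCyc G g L)
    (σ : ℕ → ℕ) (M : ℕ) (hM : 3 ≤ M) (hσ : ∀ t, t < M → σ t < L)
    (hinj : ∀ s t, s < M → t < M → σ s = σ t → s = t)
    (hadj : ∀ t, t + 1 < M → H.Adj (g (σ t)) (g (σ (t + 1))))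
    (hcl : H.Adj (g (σ (M - 1))) (g (σ 0))) : FCyc H (fun t => g (σ t)) M :=
  ⟨hM, fun i j hi hj hij => hinj i j hi hj (h.2.1 _ _ (hσ i hi) (hσ j hj) hij), hadj, hcl⟩

theorem FCyc.ne {V : Type*} {G : SimpleGraph V} {g : ℕ → V} {L : ℕ} (h : FCyc G g L)
    {i j : ℕ} (hi : i < L) (hj : j < L) (hij : i ≠ j) : g i ≠ g j :=
  fun e => hij (h.2.1 i j hi hj e)

theorem FCyc.compl_adj {V : Type*} {G : SimpleGraph V} {g : ℕ → V} {L : ℕ} (h : FCyc G g L)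
    {i j : ℕ} (hi : i < L) (hj : j < L) (hij : i ≠ j) (hn : ¬ G.Adj (g i) (g j)) :
    Gᶜ.Adj (g i) (g j) := by
  rw [SimpleGraph.compl_adj]
  exact ⟨h.ne hi hj hij, hn⟩

theorem skip_one {V : Type*} {G : SimpleGraph V} {g : ℕ → V} {L i : ℕ} (h : FCyc G g L)
    (hL : 4 ≤ L) (hi : i + 2 < L) (hadj : G.Adj (g i) (g (i + 2))) : ∃ g', FCyc G g' (L - 1) := by
  refine ⟨_, h.sub (fun t => if t ≤ i then t else t + 1) (L - 1) (by omega) ?_ ?_ ?_ ?_⟩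
  · intro t ht; split_ifs <;> omega
  · intro s t hs ht hst; split_ifs at hst <;> omega
  · intro t ht
    rcases lt_trichotomy t i with h1 | h1 | h1
    · rw [if_pos (by omega), if_pos (by omega)]; exact h.2.2.1 t (by omega)
    · subst h1; rw [if_pos (by omega), if_neg (by omega)]; exact hadj
    · rw [if_neg (by omega), if_neg (by omega)]; exact h.2.2.1 (t + 1) (by omega)
  · rw [if_neg (by omega), if_pos (by omega)]
    have := h.2.2.2
    rwa [show L - 1 - 1 + 1 = L - 1 by omega]

theorem skip_two {V : Type*} {G : SimpleGraph V} {g : ℕ → V} {L i : ℕ} (h : FCyc G g L)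
    (hL : 5 ≤ L) (hi : i + 3 < L) (hadj : G.Adj (g i) (g (i + 3))) : ∃ g', FCyc G g' (L - 2) := by
  refine ⟨_, h.sub (fun t => if t ≤ i then t else t + 2) (L - 2) (by omega) ?_ ?_ ?_ ?_⟩
  · intro t ht; split_ifs <;> omega
  · intro s t hs ht hst; split_ifs at hst <;> omega
  · intro t ht
    rcases lt_trichotomy t i with h1 | h1 | h1
    · rw [if_pos (by omega), if_pos (by omega)]; exact h.2.2.1 t (by omega)
    · subst h1; rw [if_pos (by omega), if_neg (by omega)]; exact hadj
    · rw [if_neg (by omega), if_neg (by omega)]; exact h.2.2.1 (t + 2) (by omega)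
  · rw [if_neg (by omega), if_pos (by omega)]
    have := h.2.2.2
    rwa [show L - 2 - 1 + 2 = L - 1 by omega]

/-- if both chords of lengths two and three are blue there is a blue cycle of order `2p+2` -/
theorem zigzag {V : Type*} {G : SimpleGraph V} {g : ℕ → V} {L p : ℕ} (h : FCyc G g L)
    (hp : 1 ≤ p) (hL : 2 * p + 4 ≤ L) (h2 : ∀ i, i + 2 < L → ¬ G.Adj (g i) (g (i + 2)))
    (h3 : ∀ i, i + 3 < L → ¬ G.Adj (g i) (g (i + 3))) : ∃ g', FCyc Gᶜ g' (2 * p + 2) := by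
  have b2 : ∀ i, i + 2 < L → Gᶜ.Adj (g i) (g (i + 2)) := fun i hi =>
    h.compl_adj (by omega) hi (by omega) (h2 i hi)
  have b3 : ∀ i, i + 3 < L → Gᶜ.Adj (g i) (g (i + 3)) := fun i hi =>
    h.compl_adj (by omega) hi (by omega) (h3 i hi)
  refine ⟨_, h.sub (fun t => if t ≤ p then 2 * t else 2 * p + 3 - 2 * (t - p - 1)) (2 * p + 2)
    (by omega) ?_ ?_ ?_ ?_⟩
  · intro t ht; split_ifs <;> omega
  · intro s t hs ht hst; split_ifs at hst <;> omega
  · intro t ht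
    rcases lt_trichotomy t p with h1 | h1 | h1
    · rw [if_pos (by omega), if_pos (by omega)]; exact b2 (2 * t) (by omega)
    · subst h1; rw [if_pos (by omega), if_neg (by omega)]
      have := b3 (2 * t) (by omega)
      rwa [show 2 * t + 3 - 2 * (t + 1 - t - 1) = 2 * t + 3 by omega]
    · rw [if_neg (by omega), if_neg (by omega)]
      have := b2 (2 * p + 3 - 2 * (t + 1 - p - 1)) (by omega)
      rw [show 2 * p + 3 - 2 * (t + 1 - p - 1) + 2 = 2 * p + 3 - 2 * (t - p - 1) by omega] at this
      exact this.symm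
  · rw [if_neg (by omega), if_pos (by omega)]
    have := b3 0 (by omega)
    rw [show 2 * p + 3 - 2 * (2 * p + 2 - 1 - p - 1) = 3 by omega]
    exact this.symm

theorem cyclic_two_chords {V : Type*} {G : SimpleGraph V} {g : ℕ → V} {L : ℕ} (h : FCyc G g L)
    (hL : 4 ≤ L) (hno : ¬ ∃ g', FCyc G g' (L - 1)) :
    (∀ i, i + 2 < L → Gᶜ.Adj (g i) (g (i + 2))) ∧ Gᶜ.Adj (g (L - 2)) (g 0) ∧
      Gᶜ.Adj (g (L - 1)) (g 1) := by
  refine ⟨fun i hi => ?_, ?_, ?_⟩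
  · exact h.compl_adj (by omega) hi (by omega) (fun hadj => hno (skip_one h hL hi hadj))
  · refine h.compl_adj (by omega) (by omega) (by omega) (fun hadj => hno ?_)
    refine ⟨_, h.sub (fun t => t) (L - 1) (by omega) ?_ ?_ ?_ ?_⟩
    · intro t ht; omega
    · intro s t hs ht hst; exact hst
    · intro t ht; exact h.2.2.1 t (by omega)
    · rw [show L - 1 - 1 = L - 2 by omega]; exact hadj
  · refine h.compl_adj (by omega) (by omega) (by omega) (fun hadj => hno ?_)
    refine ⟨_, h.sub (fun t => t + 1) (L - 1) (by omega) ?_ ?_ ?_ ?_⟩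
    · intro t ht; omega
    · intro s t hs ht hst; omega
    · intro t ht; exact h.2.2.1 (t + 1) (by omega)
    · rw [show L - 1 - 1 + 1 = L - 1 by omega]; exact hadj

theorem odd_case {V : Type*} {G : SimpleGraph V} {g : ℕ → V} {p : ℕ} (hp : 4 ≤ p)
    (h : FCyc G g (2 * p + 3)) :
    (∃ g', FCyc G g' (2 * p + 2)) ∨ (∃ g', FCyc Gᶜ g' (2 * p + 2)) := by
  by_contra hcon
  push Not at hcon
  obtain ⟨hr, hb⟩ := hcon
  obtain ⟨c1, c2, c3⟩ := cyclic_two_chords h (by omega) (fun ⟨g', h'⟩ => hr g' h')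
  have hy := h.sub (H := Gᶜ) (fun j => if j ≤ p + 1 then 2 * j else 2 * j - (2 * p + 3))
    (2 * p + 3) (by omega) (by intro t ht; split_ifs <;> omega)
    (by intro s t hs ht hst; split_ifs at hst <;> omega)
    (by
      intro t ht
      rcases lt_trichotomy t (p + 1) with h1 | h1 | h1
      · rw [if_pos (by omega), if_pos (by omega)]; exact c1 (2 * t) (by omega)
      · subst h1; rw [if_pos (by omega), if_neg (by omega)]
        rw [show 2 * (p + 1 + 1) - (2 * p + 3) = 1 by omega]
        exact c3
      · rw [if_neg (by omega), if_neg (by omega)]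
        have := c1 (2 * t - (2 * p + 3)) (by omega)
        rwa [show 2 * t - (2 * p + 3) + 2 = 2 * (t + 1) - (2 * p + 3) by omega] at this)
    (by
      rw [if_neg (by omega), if_pos (by omega)]
      rw [show 2 * (2 * p + 3 - 1) - (2 * p + 3) = 2 * p + 3 - 2 by omega]
      exact c2)
  obtain ⟨d1, _, _⟩ := cyclic_two_chords hy (by omega) (fun ⟨g', h'⟩ => hb g' h')
  rw [compl_compl] at d1
  have e04 := d1 0 (by omega)
  have e26 := d1 1 (by omega)
  have e15 := d1 (p + 2) (by omega)
  rw [if_pos (by omega), if_pos (by omega)] at e04 e26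
  rw [if_neg (by omega), if_neg (by omega), show 2 * (p + 2) - (2 * p + 3) = 1 by omega,
    show 2 * (p + 2 + 2) - (2 * p + 3) = 5 by omega] at e15
  refine hr _ (h.sub (fun t => if t = 0 then 0 else if t = 1 then 4 else if t = 2 then 5 else
    if t = 3 then 1 else if t = 4 then 2 else t + 1) (2 * p + 2) (by omega) ?_ ?_ ?_ ?_)
  · intro t ht; split_ifs <;> omega
  · intro s t hs ht hst; split_ifs at hst <;> omega
  · intro t ht
    rcases Nat.lt_or_ge t 5 with h5 | h5
    · interval_cases t
      · exact e04
      · exact h.2.2.1 4 (by omega)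
      · exact e15.symm
      · exact h.2.2.1 1 (by omega)
      · exact e26
    · repeat rw [if_neg (by omega)]
      exact h.2.2.1 (t + 1) (by omega)
  · repeat rw [if_neg (by omega)]
    have := h.2.2.2
    simpa using this

/-- descent to a monochromatic cycle of order exactly `2p+2` -/
theorem descent {V : Type*} {p : ℕ} (hp : 4 ≤ p) : ∀ (L : ℕ) (G : SimpleGraph V) (g : ℕ → V),
    2 * p + 2 ≤ L → FCyc G g L →
    (∃ g', FCyc G g' (2 * p + 2)) ∨ (∃ g', FCyc Gᶜ g' (2 * p + 2)) := by
  intro L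
  induction L using Nat.strong_induction_on with
  | _ L ih =>
    intro G g hL h
    rcases Nat.lt_or_ge L (2 * p + 4) with h4 | h4
    · rcases Nat.lt_or_ge L (2 * p + 3) with h3 | h3
      · have : L = 2 * p + 2 := by omega
        subst this
        exact Or.inl ⟨g, h⟩
      · have : L = 2 * p + 3 := by omega
        subst this
        exact odd_case hp h
    · by_cases h2 : ∃ i, i + 2 < L ∧ G.Adj (g i) (g (i + 2))
      · obtain ⟨i, hi, hadj⟩ := h2
        obtain ⟨g', hg'⟩ := skip_one h (by omega) hi hadj
        exact ih (L - 1) (by omega) G g' (by omega) hg'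
      by_cases h3 : ∃ i, i + 3 < L ∧ G.Adj (g i) (g (i + 3))
      · obtain ⟨i, hi, hadj⟩ := h3
        obtain ⟨g', hg'⟩ := skip_two h (by omega) hi hadj
        exact ih (L - 2) (by omega) G g' (by omega) hg'
      push Not at h2 h3
      exact Or.inr (zigzag h (by omega) h4 h2 h3)


theorem FCyc.rot {V : Type*} {G : SimpleGraph V} {g : ℕ → V} {L : ℕ} (h : FCyc G g L)
    (s : ℕ) (hs : s < L) : FCyc G (fun t => g (if s + t < L then s + t else s + t - L)) L := by
  have h3 := h.1
  refine h.sub (fun t => if s + t < L then s + t else s + t - L) L h.1 ?_ ?_ ?_ ?_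
  · intro t ht; split_ifs <;> omega
  · intro a b ha hb hab; split_ifs at hab <;> omega
  · intro t ht
    rcases lt_trichotomy (s + t + 1) L with h1 | h1 | h1
    · rw [if_pos (by omega), if_pos (by omega)]; exact h.2.2.1 _ h1
    · rw [if_pos (by omega), if_neg (by omega)]
      have := h.2.2.2
      rwa [show s + t = L - 1 by omega, show s + (t + 1) - L = 0 by omega]
    · rw [if_neg (by omega), if_neg (by omega)]
      have := h.2.2.1 (s + t - L) (by omega)
      rwa [show s + (t + 1) - L = s + t - L + 1 by omega]
  · rcases Nat.eq_zero_or_pos s with h0 | h0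
    · subst h0
      rw [if_pos (by omega), if_pos (by omega)]
      simpa using h.2.2.2
    · rw [if_neg (by omega), if_pos (by omega)]
      have := h.2.2.1 (s - 1) (by omega)
      rw [show s - 1 + 1 = s by omega] at this
      rwa [show s + (L - 1) - L = s - 1 by omega]

theorem FCyc.append1 {V : Type*} {G : SimpleGraph V} {g : ℕ → V} {L : ℕ} (h : FCyc G g L)
    {z : V} (hz : ∀ i, i < L → g i ≠ z) (h1 : G.Adj (g (L - 1)) z) (h2 : G.Adj z (g 0)) :
    FCyc G (fun t => if t < L then g t else z) (L + 1) := by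
  have h3 := h.1
  refine ⟨by omega, ?_, ?_, ?_⟩
  · intro i j hi hj hij
    dsimp only at hij
    split_ifs at hij with c1 c2 c2
    · exact h.2.1 i j c1 c2 hij
    · exact absurd hij (hz i c1)
    · exact absurd hij.symm (hz j c2)
    · omega
  · intro i hi
    dsimp only
    rw [if_pos (by omega)]
    by_cases c : i + 1 < L
    · rw [if_pos c]; exact h.2.2.1 i c
    · rw [if_neg c, show i = L - 1 by omega]; exact h1
  · dsimp only
    rw [if_neg (by omega), if_pos (by omega)]; exact h2

theorem FCyc.append2 {V : Type*} {G : SimpleGraph V} {g : ℕ → V} {L : ℕ} (h : FCyc G g L)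
    {z w : V} (hz : ∀ i, i < L → g i ≠ z) (hw : ∀ i, i < L → g i ≠ w)
    (h1 : G.Adj (g (L - 1)) z) (hzw : G.Adj z w) (h2 : G.Adj w (g 0)) :
    FCyc G (fun t => if t < L then g t else if t = L then z else w) (L + 2) := by
  have h3 := h.1
  refine ⟨by omega, ?_, ?_, ?_⟩
  · intro i j hi hj hij
    dsimp only at hij
    split_ifs at hij with c1 c2 c3 c2 c3 c4 c5 c6
    · exact h.2.1 i j c1 c2 hij
    · exact absurd hij (hz i c1)
    · exact absurd hij (hw i c1)
    · exact absurd hij.symm (hz j c3)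
    · omega
    · exact absurd hij hzw.ne
    · exact absurd hij.symm (hw j c5)
    · exact absurd hij.symm hzw.ne
    · omega
  · intro i hi
    dsimp only
    rcases lt_trichotomy (i + 1) L with c | c | c
    · rw [if_pos (by omega), if_pos c]; exact h.2.2.1 i c
    · rw [if_pos (by omega), if_neg (by omega), if_pos c, show i = L - 1 by omega]; exact h1
    · rw [if_neg (by omega), if_pos (by omega), if_neg (by omega), if_neg (by omega)]; exact hzw
  · dsimp only
    rw [if_neg (by omega), if_neg (by omega), if_pos (by omega)]; exact h2

theorem alt_cyc {V : Type*} {B : SimpleGraph V} {m : ℕ} (hm : 2 ≤ m) (a b : ℕ → V)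
    (ha : ∀ i j, i < m → j < m → a i = a j → i = j)
    (hb : ∀ i j, i < m → j < m → b i = b j → i = j)
    (hab : ∀ i j, i < m → j < m → a i ≠ b j)
    (h1 : ∀ i, i < m → B.Adj (a i) (b i)) (h2 : ∀ i, i + 1 < m → B.Adj (b i) (a (i + 1)))
    (h3 : B.Adj (b (m - 1)) (a 0)) :
    FCyc B (fun t => if t % 2 = 0 then a (t / 2) else b (t / 2)) (2 * m) := by
  refine ⟨by omega, ?_, ?_, ?_⟩
  · intro i j hi hj hij
    dsimp only at hij
    split_ifs at hij with c1 c2 c2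
    · have := ha _ _ (by omega) (by omega) hij; omega
    · exact absurd hij (hab _ _ (by omega) (by omega))
    · exact absurd hij.symm (hab _ _ (by omega) (by omega))
    · have := hb _ _ (by omega) (by omega) hij; omega
  · intro i hi
    dsimp only
    by_cases c : i % 2 = 0
    · rw [if_pos c, if_neg (by omega), show (i + 1) / 2 = i / 2 by omega]
      exact h1 _ (by omega)
    · rw [if_neg c, if_pos (by omega), show (i + 1) / 2 = i / 2 + 1 by omega]
      exact h2 _ (by omega)
  · dsimp only
    rw [if_neg (by omega), if_pos (by omega), show (2 * m - 1) / 2 = m - 1 by omega]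
    exact h3

theorem enum_fin {V : Type*} [Inhabited V] (A : Finset V) :
    ∃ a : ℕ → V, (∀ i, i < A.card → a i ∈ A) ∧
      (∀ i j, i < A.card → j < A.card → a i = a j → i = j) := by
  have hl : A.toList.length = A.card := Finset.length_toList A
  have hg : ∀ i (h : i < A.card), A.toList.getD i default = A.toList[i]'(by omega) := fun i h =>
    List.getD_eq_getElem _ _ _
  refine ⟨fun i => A.toList.getD i default, ?_, ?_⟩
  · intro i hi
    dsimp only
    rw [hg i hi, ← Finset.mem_toList]
    exact List.getElem_mem _
  · intro i j hi hj hij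
    dsimp only at hij
    rw [hg i hi, hg j hj] at hij
    exact (List.Nodup.getElem_inj_iff (Finset.nodup_toList A)).1 hij

theorem bip_cyc {V : Type*} {B : SimpleGraph V} {m : ℕ} (hm : 2 ≤ m) {S T : Finset V}
    (hS : m ≤ S.card) (hT : m ≤ T.card) (hST : ∀ s ∈ S, ∀ t ∈ T, B.Adj s t) :
    ∃ g, FCyc B g (2 * m) := by
  obtain ⟨s0, hs0⟩ : S.Nonempty := by rw [← Finset.card_pos]; omega
  have : Inhabited V := ⟨s0⟩
  obtain ⟨a, ha1, ha2⟩ := enum_fin S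
  obtain ⟨b, hb1, hb2⟩ := enum_fin T
  refine ⟨_, alt_cyc hm a b (fun i j hi hj => ha2 i j (by omega) (by omega))
    (fun i j hi hj => hb2 i j (by omega) (by omega)) ?_ ?_ ?_ ?_⟩
  · intro i j hi hj
    exact (hST _ (ha1 i (by omega)) _ (hb1 j (by omega))).ne
  · intro i hi
    exact hST _ (ha1 i (by omega)) _ (hb1 i (by omega))
  · intro i hi
    exact (hST _ (ha1 (i + 1) (by omega)) _ (hb1 i (by omega))).symm
  · exact (hST _ (ha1 0 (by omega)) _ (hb1 (m - 1) (by omega))).symm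

/-- a cycle glued from two paths -/
theorem isCyc_glue {V : Type*} {G : SimpleGraph V} {a b : List V} {a1 a2 b1 b2 : V}
    (ha : a.IsChain G.Adj) (hb : b.IsChain G.Adj) (hnd : (a ++ b).Nodup)
    (ha1 : a.head? = some a1) (ha2 : a.getLast? = some a2) (hb1 : b.head? = some b1)
    (hb2 : b.getLast? = some b2) (h1 : G.Adj a2 b1) (h2 : G.Adj b2 a1)
    (hlen : 3 ≤ (a ++ b).length) : IsCyc G (a ++ b) := by
  refine ⟨chain_app ha hb ha2 hb1 h1, hnd, hlen, ?_⟩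
  rw [List.getLast?_append, List.head?_append, hb2, ha1]
  intro x hx y hy
  simp at hx hy
  subst hx hy
  exact h2

/-- pair `(x, y)` connects any two vertices of `Z` up to a direct blue edge -/
def Conn {V : Type*} (B : SimpleGraph V) (Z : Finset V) (q : V × V) : Prop :=
  (∀ z ∈ Z, B.Adj z q.1 ∨ B.Adj z q.2) ∧
  (∀ z ∈ Z, ∀ w ∈ Z, z ≠ w → B.Adj z w ∨ (B.Adj z q.1 ∧ B.Adj w q.1) ∨
    (B.Adj z q.2 ∧ B.Adj w q.2))

/-- path of `B` with both ends in `Z` -/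
def ZPath {V : Type*} (B : SimpleGraph V) (Z : Finset V) (p : List V) : Prop :=
  p.IsChain B.Adj ∧ ∃ a ∈ Z, ∃ b ∈ Z, p.head? = some a ∧ p.getLast? = some b

/-- all the vertices of a list of pairs -/
def prs {V : Type*} (Q : List (V × V)) : List V := Q.flatMap (fun q => [q.1, q.2])

theorem ZPath.join {V : Type*} {B : SimpleGraph V} {Z : Finset V} {p1 p2 : List V} {x b1 b2 : V}
    (h1 : ZPath B Z p1) (h2 : ZPath B Z p2) (hb1 : p1.getLast? = some b1)
    (hb2 : p2.getLast? = some b2) (hx1 : B.Adj b1 x) (hx2 : B.Adj b2 x) :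
    ZPath B Z (p1 ++ ([x] ++ p2.reverse)) := by
  obtain ⟨c1, a1, ha1, _, _, e1, _⟩ := h1
  obtain ⟨c2, a2, ha2, _, _, e2, _⟩ := h2
  refine ⟨chain_app (w := x) c1 (chain_app (u := x) (w := b2) (by simp)
    (chain_rev (fun _ _ h => h.symm) c2) (by simp) ?_ hx2.symm) hb1 (by simp) hx1,
    a1, ha1, a2, ha2, ?_, ?_⟩
  · rw [List.head?_reverse, hb2]
  · rw [List.head?_append, e1]; rfl
  · rw [List.getLast?_append, List.getLast?_append, List.getLast?_reverse, e2]; rfl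

theorem ZPath.join0 {V : Type*} {B : SimpleGraph V} {Z : Finset V} {p1 p2 : List V} {b1 b2 : V}
    (h1 : ZPath B Z p1) (h2 : ZPath B Z p2) (hb1 : p1.getLast? = some b1)
    (hb2 : p2.getLast? = some b2) (hb : B.Adj b1 b2) :
    ZPath B Z (p1 ++ p2.reverse) := by
  obtain ⟨c1, a1, ha1, _, _, e1, _⟩ := h1
  obtain ⟨c2, a2, ha2, _, _, e2, _⟩ := h2
  refine ⟨chain_app (w := b2) c1 (chain_rev (fun _ _ h => h.symm) c2) hb1 ?_ hb,
    a1, ha1, a2, ha2, ?_, ?_⟩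
  · rw [List.head?_reverse, hb2]
  · rw [List.head?_append, e1]; rfl
  · rw [List.getLast?_append, List.getLast?_reverse, e2]; rfl

theorem merge1 {V : Type*} [DecidableEq V] {B : SimpleGraph V} {Z : Finset V} (p : List V)
    (q : V × V) (hp : ZPath B Z p) (hq : Conn B Z q) (hnd : (p ++ [q.1, q.2]).Nodup)
    (hlen : 3 ≤ p.length) : ∃ l, IsCyc B l ∧ p.length ≤ l.length := by
  obtain ⟨c, a, ha, b, hb, e1, e2⟩ := hp
  rw [List.nodup_append] at hnd
  obtain ⟨n1, n2, n3⟩ := hnd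
  have hab : a ≠ b := by
    rintro rfl
    rw [List.head?_eq_getElem?] at e1
    rw [List.getLast?_eq_getElem?] at e2
    obtain ⟨l1, f1⟩ := List.getElem?_eq_some_iff.1 e1
    obtain ⟨l2, f2⟩ := List.getElem?_eq_some_iff.1 e2
    have := (List.Nodup.getElem_inj_iff n1).1 (f1.trans f2.symm)
    omega
  have key : ∀ x, (x = q.1 ∨ x = q.2) → B.Adj a x → B.Adj b x →
      ∃ l, IsCyc B l ∧ p.length ≤ l.length := by
    intro x hx h1 h2
    refine ⟨p ++ [x], isCyc_glue (b1 := x) (b2 := x) c (by simp) ?_ e1 e2 rfl rfl h2 h1.symm ?_, ?_⟩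
    · rw [List.nodup_append]
      refine ⟨n1, by simp, ?_⟩
      intro u hu v hv
      refine n3 u hu v ?_
      simp at hv ⊢
      rw [hv]
      exact hx
    · simp; omega
    · simp
  rcases hq.2 a ha b hb hab with h | h | h
  · refine ⟨p, ⟨c, n1, hlen, ?_⟩, le_rfl⟩
    rw [e1, e2]
    intro x hx y hy
    simp at hx hy
    subst hx hy
    exact h.symm
  · exact key q.1 (Or.inl rfl) h.1 h.2
  · exact key q.2 (Or.inr rfl) h.1 h.2

theorem merge_all {V : Type*} [DecidableEq V] {B : SimpleGraph V} {Z : Finset V} :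
    ∀ (Q : List (V × V)) (P : List (List V)), P.length = Q.length → 1 ≤ P.length →
    (∀ p ∈ P, ZPath B Z p) → (∀ q ∈ Q, Conn B Z q) → (P.flatten ++ prs Q).Nodup →
    3 ≤ P.flatten.length →
    ∃ l, IsCyc B l ∧ P.flatten.length + P.length ≤ l.length + 2 ∧
      P.flatten.length ≤ l.length := by
  intro Q
  induction Q with
  | nil => intro P h1 h2; simp at h1; simp [h1] at h2
  | cons q Q ih =>
    intro P hPQ hP1 hP hQ hnd hlen
    have hcnt : ∀ v, List.count v P.flatten + (List.count v [q.1, q.2] + List.count v (prs Q)) ≤ 1 := by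
      intro v
      have := (List.nodup_iff_count_le_one.1 hnd) v
      simp only [prs, List.flatMap_cons, List.count_append] at this ⊢
      exact this
    match P, hPQ, hP1, hP, hcnt, hnd, hlen with
    | [], _, h, _, _, _, _ => simp at h
    | [p], hPQ, _, hP, hcnt, hnd, hlen =>
      have hQ0 : Q = [] := by simpa using hPQ
      subst hQ0
      simp at hlen
      obtain ⟨l, h1, h2⟩ := merge1 p q (hP p (by simp)) (hQ q (by simp))
        (by simpa [prs] using hnd) hlen
      exact ⟨l, h1, by simp; omega, by simpa using h2⟩
    | [p1, p2], hPQ, _, hP, hcnt, hnd, hlen =>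
      have z1 := hP p1 (by simp)
      have z2 := hP p2 (by simp)
      obtain ⟨_, _, _, b1, hb1, _, e1⟩ := id z1
      obtain ⟨_, _, _, b2, hb2, _, e2⟩ := id z2
      have hne : b1 ≠ b2 := by
        rintro rfl
        have := hcnt b1
        simp only [List.flatten_cons, List.flatten_nil, List.append_nil, List.count_append] at this
        have c1 := List.count_pos_iff.2 (List.mem_of_getLast? e1)
        have c2 := List.count_pos_iff.2 (List.mem_of_getLast? e2)
        omega
      have key : ∀ x, (x = q.1 ∨ x = q.2) → B.Adj b1 x → B.Adj b2 x →
          ∃ l, IsCyc B l ∧ [p1, p2].flatten.length + [p1, p2].length ≤ l.length + 2 ∧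
            [p1, p2].flatten.length ≤ l.length := by
        intro x hx h1 h2
        obtain ⟨l, g1, g2, g3⟩ := ih [p1 ++ ([x] ++ p2.reverse)] (by simp at hPQ ⊢; omega) (by simp)
          (by simpa using z1.join z2 e1 e2 h1 h2) (fun q' h => hQ q' (by simp [h])) (by
            rw [List.nodup_iff_count_le_one]
            intro v
            have := hcnt v
            simp only [List.flatten_cons, List.flatten_nil, List.append_nil, List.count_append,
              List.count_reverse, List.count_cons, List.count_nil] at this ⊢
            rcases hx with rfl | rfl <;> omega) (by simp at hlen ⊢; omega)
        refine ⟨l, g1, ?_, ?_⟩ <;> simp at g2 g3 ⊢ <;> omega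
      rcases (hQ q (by simp)).2 b1 hb1 b2 hb2 hne with h | h | h
      · obtain ⟨l, g1, g2, g3⟩ := ih [p1 ++ p2.reverse] (by simp at hPQ ⊢; omega) (by simp)
          (by simpa using z1.join0 z2 e1 e2 h) (fun q' h => hQ q' (by simp [h])) (by
            rw [List.nodup_iff_count_le_one]
            intro v
            have := hcnt v
            simp only [List.flatten_cons, List.flatten_nil, List.append_nil, List.count_append,
              List.count_reverse] at this ⊢
            omega) (by simp at hlen ⊢; omega)
        refine ⟨l, g1, ?_, ?_⟩ <;> simp at g2 g3 ⊢ <;> omega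
      · exact key q.1 (Or.inl rfl) h.1 h.2
      · exact key q.2 (Or.inr rfl) h.1 h.2
    | p1 :: p2 :: p3 :: R, hPQ, _, hP, hcnt, hnd, hlen =>
      have z1 := hP p1 (by simp)
      have z2 := hP p2 (by simp)
      have z3 := hP p3 (by simp)
      obtain ⟨_, _, _, b1, hb1, _, e1⟩ := id z1
      obtain ⟨_, _, _, b2, hb2, _, e2⟩ := id z2
      obtain ⟨_, _, _, b3, hb3, _, e3⟩ := id z3
      have key : ∀ (x : V) (r1 r2 r3 : List V) (c1 c2 : V), (x = q.1 ∨ x = q.2) →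
          ZPath B Z r1 → ZPath B Z r2 → ZPath B Z r3 → r1.getLast? = some c1 →
          r2.getLast? = some c2 → B.Adj c1 x → B.Adj c2 x →
          (∀ v, List.count v r1 + List.count v r2 + List.count v r3 =
            List.count v p1 + List.count v p2 + List.count v p3) →
          (r1.length + r2.length + r3.length = p1.length + p2.length + p3.length) →
          ∃ l, IsCyc B l ∧ (p1 :: p2 :: p3 :: R).flatten.length +
            (p1 :: p2 :: p3 :: R).length ≤ l.length + 2 ∧
            (p1 :: p2 :: p3 :: R).flatten.length ≤ l.length := by
        intro x r1 r2 r3 c1 c2 hx y1 y2 y3 f1 f2 h1 h2 hc hl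
        obtain ⟨l, g1, g2, g3⟩ := ih ((r1 ++ ([x] ++ r2.reverse)) :: r3 :: R)
          (by simp at hPQ ⊢; exact hPQ) (by simp) (by
            intro p hp
            simp only [List.mem_cons] at hp
            rcases hp with rfl | rfl | hp
            · exact y1.join y2 f1 f2 h1 h2
            · exact y3
            · exact hP p (by simp [hp])) (fun q' h => hQ q' (by simp [h])) (by
            rw [List.nodup_iff_count_le_one]
            intro v
            have := hcnt v
            have hc' := hc v
            simp only [List.flatten_cons, List.count_append,
              List.count_reverse, List.count_cons, List.count_nil] at this ⊢
            rcases hx with rfl | rfl <;> omega) (by simp at hlen ⊢; omega)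
        refine ⟨l, g1, ?_, ?_⟩ <;> simp at g2 g3 ⊢ <;> omega
      have hq := (hQ q (by simp)).1
      rcases hq b1 hb1 with h1 | h1 <;> rcases hq b2 hb2 with h2 | h2
      · exact key q.1 p1 p2 p3 b1 b2 (Or.inl rfl) z1 z2 z3 e1 e2 h1 h2 (fun v => by omega) (by omega)
      · rcases hq b3 hb3 with h3 | h3
        · exact key q.1 p1 p3 p2 b1 b3 (Or.inl rfl) z1 z3 z2 e1 e3 h1 h3 (fun v => by omega)
            (by omega)
        · exact key q.2 p2 p3 p1 b2 b3 (Or.inr rfl) z2 z3 z1 e2 e3 h2 h3 (fun v => by omega)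
            (by omega)
      · rcases hq b3 hb3 with h3 | h3
        · exact key q.1 p2 p3 p1 b2 b3 (Or.inl rfl) z2 z3 z1 e2 e3 h2 h3 (fun v => by omega)
            (by omega)
        · exact key q.2 p1 p3 p2 b1 b3 (Or.inr rfl) z1 z3 z2 e1 e3 h1 h3 (fun v => by omega)
            (by omega)
      · exact key q.2 p1 p2 p3 b1 b2 (Or.inr rfl) z1 z2 z3 e1 e2 h1 h2 (fun v => by omega) (by omega)


theorem path_system {V : Type*} [DecidableEq V] (B : SimpleGraph V) (Z : Finset V) (h : ℕ) :
    ∀ d, h + d ≤ Z.card →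
    (∃ P : List (List V), P.length + d = Z.card ∧ (∀ p ∈ P, ZPath B Z p) ∧ P.flatten.Nodup ∧
      (∀ v ∈ P.flatten, v ∈ Z) ∧ P.flatten.length = Z.card) ∨
    (∃ K ⊆ Z, h + 1 ≤ K.card ∧ ∀ a ∈ K, ∀ b ∈ K, a ≠ b → ¬ B.Adj a b) := by
  intro d
  induction d with
  | zero =>
    intro _
    left
    have hfl : (Z.toList.map (fun z => [z])).flatten = Z.toList := by
      rw [← List.flatMap_def]; simp
    refine ⟨Z.toList.map (fun z => [z]), by simp, ?_, ?_, ?_, ?_⟩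
    · intro p hp
      simp only [List.mem_map, Finset.mem_toList] at hp
      obtain ⟨z, hz, rfl⟩ := hp
      exact ⟨by simp, z, hz, z, hz, rfl, rfl⟩
    · rw [hfl]; exact Finset.nodup_toList Z
    · rw [hfl]; simp
    · rw [hfl]; simp
  | succ d ih =>
    intro hd
    rcases ih (by omega) with ⟨P, h1, h2, h3, h4, h5⟩ | hK
    swap
    · exact Or.inr hK
    obtain ⟨z0, hz0⟩ : Z.Nonempty := by rw [← Finset.card_pos]; omega
    let lst : List V → V := fun p => p.getLastD z0
    have hlst : ∀ p ∈ P, p.getLast? = some (lst p) := by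
      intro p hp
      obtain ⟨_, _, _, b, _, _, e⟩ := h2 p hp
      simp [lst, List.getLastD_eq_getLast?, e]
    by_cases hb : ∃ p ∈ P, ∃ p' ∈ P, p ≠ p' ∧ B.Adj (lst p) (lst p')
    · left
      obtain ⟨p, hp, p', hp', hne, hadj⟩ := hb
      have hp'2 : p' ∈ P.erase p := (List.mem_erase_of_ne hne.symm).2 hp'
      have hperm : P.Perm (p :: p' :: (P.erase p).erase p') :=
        (List.perm_cons_erase hp).trans ((List.perm_cons_erase hp'2).cons p)
      have hpf := hperm.flatten
      refine ⟨(p ++ p'.reverse) :: (P.erase p).erase p', ?_, ?_, ?_, ?_, ?_⟩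
      · have := hperm.length_eq
        simp only [List.length_cons] at this ⊢
        omega
      · intro r hr
        simp only [List.mem_cons] at hr
        rcases hr with rfl | hr
        · exact (h2 p hp).join0 (h2 p' hp') (hlst p hp) (hlst p' hp') hadj
        · exact h2 r (List.mem_of_mem_erase (List.mem_of_mem_erase hr))
      · rw [hpf.nodup_iff] at h3
        rw [List.nodup_iff_count_le_one] at h3 ⊢
        intro v
        have := h3 v
        simp only [List.flatten_cons, List.count_append, List.count_reverse] at this ⊢
        omega
      · intro v hv
        apply h4
        rw [hpf.mem_iff]
        simp only [List.flatten_cons, List.mem_append, List.mem_reverse] at hv ⊢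
        tauto
      · have := hpf.length_eq
        simp only [List.flatten_cons, List.length_append, List.length_reverse] at this ⊢
        omega
    · right
      push Not at hb
      have hmemlst : ∀ p ∈ P, lst p ∈ p := fun p hp => List.mem_of_getLast? (hlst p hp)
      have hnd : (P.map lst).Nodup := by
        have h6 := (List.nodup_flatten.1 h3).2
        unfold List.Nodup
        rw [List.pairwise_map]
        refine h6.imp_of_mem ?_
        intro p p' hp hp' hdis heq
        exact hdis (hmemlst p hp) (heq ▸ hmemlst p' hp')
      refine ⟨(P.map lst).toFinset, ?_, ?_, ?_⟩
      · intro v hv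
        simp only [List.mem_toFinset, List.mem_map] at hv
        obtain ⟨p, hp, rfl⟩ := hv
        exact h4 _ (List.mem_flatten.2 ⟨p, hp, hmemlst p hp⟩)
      · rw [List.toFinset_card_of_nodup hnd, List.length_map]
        omega
      · intro a ha b hb' hab
        simp only [List.mem_toFinset, List.mem_map] at ha hb'
        obtain ⟨p, hp, rfl⟩ := ha
        obtain ⟨p', hp', rfl⟩ := hb'
        exact hb p hp p' hp' (fun e => hab (by rw [e]))

/-- path through a clique with prescribed ends -/
theorem clique_path {V : Type*} [DecidableEq V] {G : SimpleGraph V} {K : Finset V}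
    (hK : ∀ a ∈ K, ∀ b ∈ K, a ≠ b → G.Adj a b) {q q' : V} (hq : q ∈ K) (hq' : q' ∈ K)
    (hne : q ≠ q') : ∃ l : List V, l.IsChain G.Adj ∧ l.Nodup ∧ l.head? = some q ∧
      l.getLast? = some q' ∧ (∀ v ∈ l, v ∈ K) ∧ l.length = K.card := by
  have hmem : ∀ v ∈ q :: (((K.erase q).erase q').toList ++ [q']), v ∈ K := by
    intro v hv
    simp only [List.mem_cons, List.mem_append, Finset.mem_toList, Finset.mem_erase,
      List.not_mem_nil, or_false] at hv
    rcases hv with rfl | ⟨_, _, h⟩ | rfl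
    · exact hq
    · exact h
    · exact hq'
  have hnd : (q :: (((K.erase q).erase q').toList ++ [q'])).Nodup := by
    rw [List.nodup_cons, List.nodup_append]
    refine ⟨by simp [hne], Finset.nodup_toList _, by simp, ?_⟩
    intro a ha b hb
    simp at ha hb
    rw [hb]; exact ha.1
  refine ⟨q :: (((K.erase q).erase q').toList ++ [q']), ?_, hnd, rfl, ?_, hmem, ?_⟩
  · apply List.Pairwise.isChain
    refine List.Pairwise.imp_of_mem ?_ hnd
    intro a b ha hb hab
    exact hK a (hmem a ha) b (hmem b hb) hab
  · rw [← List.cons_append, List.getLast?_append]; rfl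
  · have h1 : q' ∈ K.erase q := Finset.mem_erase.2 ⟨hne.symm, hq'⟩
    have h2 := Finset.card_erase_of_mem hq
    have h3 := Finset.card_erase_of_mem h1
    have h4 := Finset.card_pos.2 ⟨_, h1⟩
    have h5 := Finset.card_pos.2 ⟨_, hq⟩
    simp
    omega

theorem range_path {V : Type*} {G : SimpleGraph V} (f : ℕ → V) (m : ℕ) (hm : 1 ≤ m)
    (hinj : ∀ i j, i < m → j < m → f i = f j → i = j)
    (hadj : ∀ i, i + 1 < m → G.Adj (f i) (f (i + 1))) :
    ((List.range m).map f).IsChain G.Adj ∧ ((List.range m).map f).Nodup ∧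
      ((List.range m).map f).head? = some (f 0) ∧
      ((List.range m).map f).getLast? = some (f (m - 1)) := by
  refine ⟨?_, ?_, ?_, ?_⟩
  · rw [List.isChain_iff_getElem]
    intro i hi
    simp at hi ⊢
    exact hadj i hi
  · apply List.Nodup.map_on _ List.nodup_range
    intro i hi j hj hij
    simp at hi hj
    exact hinj i j hi hj hij
  · rw [List.head?_eq_getElem?, List.getElem?_eq_getElem (by simp; omega)]
    simp
  · rw [List.getLast?_eq_getElem?, List.getElem?_eq_getElem (by simp; omega)]
    simp

/-- two disjoint edges from a clique to the cycle give a longer cycle -/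
theorem clique_two_edges {V : Type*} [DecidableEq V] {G : SimpleGraph V} {g : ℕ → V} {L : ℕ}
    (h : FCyc G g L) {K : Finset V} (hK : ∀ a ∈ K, ∀ b ∈ K, a ≠ b → G.Adj a b)
    (hKg : ∀ i, i < L → g i ∉ K) (hcard : L / 2 + 1 ≤ K.card) {q q' : V} (hq : q ∈ K)
    (hq' : q' ∈ K) (hne : q ≠ q') {j : ℕ} (hj0 : 0 < j) (hj : j < L) (h0 : G.Adj q (g 0))
    (h1 : G.Adj q' (g j)) : ∃ L' > L, ∃ g', FCyc G g' L' := by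
  have h3 := h.1
  rcases Nat.lt_or_ge (2 * j) L with hjL | hjL
  · -- keep the outer arc
    obtain ⟨l, c1, c2, c3, c4, c5, c6⟩ := clique_path hK hq hq' hne
    obtain ⟨r1, r2, r3, r4⟩ := range_path (G := G) (fun t => if j + t < L then g (j + t) else g 0)
      (L - j + 1) (by omega)
      (by
        intro a b ha hb hab
        split_ifs at hab with k1 k2 k2
        · have := h.2.1 _ _ k1 k2 hab; omega
        · have := h.2.1 _ _ k1 (by omega) hab; omega
        · have := h.2.1 _ _ (by omega) k2 hab; omega
        · omega)
      (by
        intro i hi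
        rw [if_pos (by omega)]
        by_cases k : j + (i + 1) < L
        · rw [if_pos k]; exact h.2.2.1 (j + i) (by omega)
        · rw [if_neg k, show j + i = L - 1 by omega]; exact h.2.2.2)
    have hc := isCyc_glue r1 c1 (by
        rw [List.nodup_append]
        refine ⟨r2, c2, ?_⟩
        intro a ha b hb hab
        subst hab
        simp only [List.mem_map, List.mem_range] at ha
        obtain ⟨t, ht, rfl⟩ := ha
        have := c5 _ hb
        split_ifs at this with k
        · exact hKg _ k this
        · exact hKg _ (by omega) this) r3 r4 c3 c4
      (by rw [if_neg (by omega)]; exact h0.symm)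
      (by rw [if_pos (by omega)]; simpa using h1) (by simp; omega)
    obtain ⟨g', hg'⟩ := hc.fcyc
    refine ⟨_, ?_, g', hg'⟩
    simp
    omega
  · obtain ⟨l, c1, c2, c3, c4, c5, c6⟩ := clique_path hK hq' hq hne.symm
    obtain ⟨r1, r2, r3, r4⟩ := range_path (G := G) g (j + 1) (by omega)
      (fun a b ha hb => h.2.1 a b (by omega) (by omega))
      (fun i hi => h.2.2.1 i (by omega))
    have hc := isCyc_glue r1 c1 (by
        rw [List.nodup_append]
        refine ⟨r2, c2, ?_⟩
        intro a ha b hb hab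
        subst hab
        simp only [List.mem_map, List.mem_range] at ha
        obtain ⟨t, ht, rfl⟩ := ha
        exact hKg _ (by omega) (c5 _ hb)) r3 r4 c3 c4
      (by simpa using h1.symm) (by simpa using h0) (by simp; omega)
    obtain ⟨g', hg'⟩ := hc.fcyc
    refine ⟨_, ?_, g', hg'⟩
    simp
    omega


theorem prs_range {V : Type*} (g : ℕ → V) (h : ℕ) :
    prs ((List.range h).map (fun i => (g (2 * i), g (2 * i + 1)))) = (List.range (2 * h)).map g := by
  induction h with
  | zero => simp [prs]
  | succ h ih =>
    rw [List.range_succ, List.map_append, show 2 * (h + 1) = 2 * h + 1 + 1 by ring,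
      List.range_succ, List.range_succ]
    unfold prs at ih ⊢
    rw [List.flatMap_append, ih]
    simp

theorem cyc_main {V : Type*} [Fintype V] {G : SimpleGraph V} {g : ℕ → V} {L p : ℕ}
    (h : FCyc G g L) (hL4 : 4 ≤ L) (hLp : L ≤ 2 * p + 1) (hV : 3 * p + 5 ≤ Fintype.card V) :
    ∃ L' > L, (∃ g', FCyc G g' L') ∨ (∃ g', FCyc Gᶜ g' L') := by
  classical
  by_contra hcon
  push Not at hcon
  have hR : ∀ L' > L, ∀ g', ¬ FCyc G g' L' := fun L' hL' => (hcon L' hL').1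
  have hB : ∀ L' > L, ∀ g', ¬ FCyc Gᶜ g' L' := fun L' hL' => (hcon L' hL').2
  set C := (Finset.range L).image g with hC
  have hCcard : C.card = L := by
    rw [hC, Finset.card_image_of_injOn, Finset.card_range]
    intro i hi j hj hij
    simp at hi hj
    exact h.2.1 i j hi hj hij
  have hCmem : ∀ i, i < L → g i ∈ C := fun i hi =>
    Finset.mem_image.2 ⟨i, Finset.mem_range.2 hi, rfl⟩
  set Z := Finset.univ \ C with hZ
  have hZcard : Z.card + L = Fintype.card V := by
    have := Finset.card_sdiff_add_card_eq_card (Finset.subset_univ C)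
    rw [Finset.card_univ, ← hZ] at this
    omega
  have hZg : ∀ z ∈ Z, ∀ i, i < L → g i ≠ z := by
    intro z hz i hi e
    rw [hZ, Finset.mem_sdiff] at hz
    exact hz.2 (e ▸ hCmem i hi)
  have hblue : ∀ z ∈ Z, ∀ i, i < L → ¬ G.Adj z (g i) → Gᶜ.Adj z (g i) := by
    intro z hz i hi hn
    rw [SimpleGraph.compl_adj]
    exact ⟨fun e => hZg z hz i hi e.symm, hn⟩
  have F1 : ∀ z ∈ Z, ∀ i, i + 1 < L → G.Adj z (g i) → ¬ G.Adj z (g (i + 1)) := by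
    intro z hz i hi h1 h2
    have hr := h.rot (i + 1) hi
    refine hR (L + 1) (by omega) _ (hr.append1 (z := z) ?_ ?_ ?_)
    · intro t ht; apply hZg z hz; split_ifs <;> omega
    · rw [if_neg (by omega), show i + 1 + (L - 1) - L = i by omega]; exact h1.symm
    · rw [if_pos (by omega)]; exact h2
  have F2 : ∀ z ∈ Z, ∀ w ∈ Z, ∀ i, i + 1 < L → G.Adj z (g i) → G.Adj w (g (i + 1)) →
      ¬ G.Adj z w := by
    intro z hz w hw i hi h1 h2 h3
    have hr := h.rot (i + 1) hi
    refine hR (L + 2) (by omega) _ (hr.append2 (z := z) (w := w) ?_ ?_ ?_ h3 ?_)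
    · intro t ht; apply hZg z hz; split_ifs <;> omega
    · intro t ht; apply hZg w hw; split_ifs <;> omega
    · rw [if_neg (by omega), show i + 1 + (L - 1) - L = i by omega]; exact h1.symm
    · rw [if_pos (by omega)]; exact h2
  have hconn : ∀ i, i + 1 < L → Conn Gᶜ Z (g i, g (i + 1)) := by
    intro i hi
    have c1 : ∀ z ∈ Z, Gᶜ.Adj z (g i) ∨ Gᶜ.Adj z (g (i + 1)) := by
      intro z hz
      by_cases h1 : G.Adj z (g i)
      · exact Or.inr (hblue z hz _ hi (F1 z hz i hi h1))
      · exact Or.inl (hblue z hz _ (by omega) h1)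
    refine ⟨c1, ?_⟩
    intro z hz w hw hzw
    by_cases k1 : G.Adj z (g i)
    · have k2 := hblue z hz _ hi (F1 z hz i hi k1)
      by_cases k3 : G.Adj w (g (i + 1))
      · left
        rw [SimpleGraph.compl_adj]
        exact ⟨hzw, F2 z hz w hw i hi k1 k3⟩
      · exact Or.inr (Or.inr ⟨k2, hblue w hw _ hi k3⟩)
    · have k2 := hblue z hz _ (by omega) k1
      by_cases k3 : G.Adj w (g i)
      · have k4 := hblue w hw _ hi (F1 w hw i hi k3)
        by_cases k5 : G.Adj z (g (i + 1))
        · left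
          rw [SimpleGraph.compl_adj]
          exact ⟨hzw, fun e => F2 w hw z hz i hi k3 k5 e.symm⟩
        · exact Or.inr (Or.inr ⟨hblue z hz _ hi k5, k4⟩)
      · exact Or.inr (Or.inl ⟨k2, hblue w hw _ (by omega) k3⟩)
  -- the system of paths
  have hZh : L / 2 + 4 ≤ Z.card := by omega
  rcases path_system Gᶜ Z (L / 2) (Z.card - L / 2) (by omega) with
    ⟨P, q1, q2, q3, q4, q5⟩ | ⟨K, hKZ, hKc, hK⟩
  · obtain ⟨l, l1, l2, _⟩ := merge_all
      ((List.range (L / 2)).map (fun i => (g (2 * i), g (2 * i + 1)))) P (by simp; omega)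
      (by omega) q2 (by
        intro q hq
        simp only [List.mem_map, List.mem_range] at hq
        obtain ⟨i, hi, rfl⟩ := hq
        exact hconn (2 * i) (by omega)) (by
        rw [prs_range, List.nodup_append]
        refine ⟨q3, ?_, ?_⟩
        · apply List.Nodup.map_on _ List.nodup_range
          intro i hi j hj hij
          simp at hi hj
          exact h.2.1 i j (by omega) (by omega) hij
        · intro a ha b hb hab
          simp only [List.mem_map, List.mem_range] at hb
          obtain ⟨i, hi, rfl⟩ := hb
          exact hZg a (q4 a ha) i (by omega) hab.symm) (by omega)
    obtain ⟨g', hg'⟩ := l1.fcyc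
    exact hB l.length (by omega) g' hg'
  have hKr : ∀ a ∈ K, ∀ b ∈ K, a ≠ b → G.Adj a b := by
    intro a ha b hb hab
    by_contra hn
    exact hK a ha b hb hab ((SimpleGraph.compl_adj _ _ _).2 ⟨hab, hn⟩)
  have hKg : ∀ i, i < L → g i ∉ K := fun i hi hk => hZg _ (hKZ hk) i hi rfl
  have hshare0 : ∀ q ∈ K, ∀ q' ∈ K, ∀ i j, i < j → j < L → G.Adj q (g i) → G.Adj q' (g j) →
      q = q' := by
    intro q hq q' hq' i j hij hj h1 h2
    by_contra hne
    obtain ⟨L', hL', g', hg'⟩ := clique_two_edges (h.rot i (by omega)) hKr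
      (fun t ht => by apply hKg; split_ifs <;> omega) hKc hq hq' hne (j := j - i) (by omega)
      (by omega) (by simpa [show i < L by omega] using h1)
      (by rw [if_pos (by omega), show i + (j - i) = j by omega]; exact h2)
    exact hR L' hL' g' hg'
  have hshare : ∀ q ∈ K, ∀ q' ∈ K, ∀ i j, i < L → j < L → i ≠ j → G.Adj q (g i) →
      G.Adj q' (g j) → q = q' := by
    intro q hq q' hq' i j hi hj hij h1 h2
    rcases lt_or_gt_of_ne hij with h' | h'
    · exact hshare0 q hq q' hq' i j h' hj h1 h2
    · exact (hshare0 q' hq' q hq j i h' hi h2 h1).symm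
  have hdich : (∃ i0, i0 < L ∧ ∀ q ∈ K, ∀ i, i < L → G.Adj q (g i) → i = i0) ∨
      (∃ q0 ∈ K, ∀ q ∈ K, ∀ i, i < L → G.Adj q (g i) → q = q0) := by
    by_cases he : ∃ q ∈ K, ∃ i, i < L ∧ G.Adj q (g i)
    · obtain ⟨q0, hq0, i0, hi0, h0⟩ := he
      by_cases hall : ∀ q ∈ K, ∀ i, i < L → G.Adj q (g i) → i = i0
      · exact Or.inl ⟨i0, hi0, hall⟩
      · right
        push Not at hall
        obtain ⟨q1, hq1, i1, hi1, h1, hne⟩ := hall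
        have e1 := hshare q1 hq1 q0 hq0 i1 i0 hi1 hi0 hne h1 h0
        subst e1
        refine ⟨q1, hq0, ?_⟩
        intro q hq i hi h2
        by_cases e : i = i0
        · exact hshare q hq q1 hq1 i i1 hi hi1 (by omega) h2 h1
        · exact hshare q hq q1 hq1 i i0 hi hi0 e h2 h0
    · left
      push Not at he
      exact ⟨0, by omega, fun q hq i hi h1 => absurd h1 (he q hq i hi)⟩
  rcases hdich with ⟨i0, hi0, hall⟩ | ⟨q0, hq0, hall⟩
  · obtain ⟨g', hg'⟩ := bip_cyc (B := Gᶜ) (m := L / 2 + 1) (by omega) (S := K)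
      (T := C.erase (g i0)) (by omega) (by rw [Finset.card_erase_of_mem (hCmem i0 hi0)]; omega)
      (by
        intro q hq x hx
        simp only [hC, Finset.mem_erase, Finset.mem_image, Finset.mem_range] at hx
        obtain ⟨hx0, i, hi, rfl⟩ := hx
        refine hblue q (hKZ hq) i hi (fun hadj => hx0 ?_)
        rw [hall q hq i hi hadj])
    exact hB _ (by omega) g' hg'
  · have hK0 := Finset.card_erase_of_mem hq0
    have hblueK : ∀ q ∈ K.erase q0, ∀ x ∈ C, Gᶜ.Adj q x := by
      intro q hq x hx
      simp only [hC, Finset.mem_image, Finset.mem_range] at hx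
      obtain ⟨i, hi, rfl⟩ := hx
      rw [Finset.mem_erase] at hq
      exact hblue q (hKZ hq.2) i hi (fun hadj => hq.1 (hall q hq.2 i hi hadj))
    rcases Nat.lt_or_ge K.card (L / 2 + 2) with hKs | hKs
    · obtain ⟨z, hz⟩ : (Z \ K).Nonempty := by
        rw [← Finset.card_pos]
        have := Finset.card_sdiff_add_card_eq_card hKZ
        omega
      rw [Finset.mem_sdiff] at hz
      obtain ⟨i, hi, hzi⟩ : ∃ i, i < 2 ∧ Gᶜ.Adj z (g i) := by
        rcases (hconn 0 (by omega)).1 z hz.1 with h1 | h1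
        · exact ⟨0, by omega, h1⟩
        · exact ⟨1, by omega, h1⟩
      obtain ⟨j, hj, hj4, hzj⟩ : ∃ j, 2 ≤ j ∧ j < 4 ∧ Gᶜ.Adj z (g j) := by
        rcases (hconn 2 (by omega)).1 z hz.1 with h1 | h1
        · exact ⟨2, by omega, by omega, h1⟩
        · exact ⟨3, by omega, by omega, h1⟩
      have hgij : g i ≠ g j := h.ne (by omega) (by omega) (by omega)
      have : Inhabited V := ⟨z⟩
      obtain ⟨a, ha1, ha2⟩ := enum_fin (K.erase q0)
      obtain ⟨b, hb1, hb2⟩ := enum_fin ((C.erase (g i)).erase (g j))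
      have hbc : ((C.erase (g i)).erase (g j)).card = L - 2 := by
        rw [Finset.card_erase_of_mem, Finset.card_erase_of_mem (hCmem i (by omega))]
        · omega
        · exact Finset.mem_erase.2 ⟨hgij.symm, hCmem j (by omega)⟩
      rw [hbc] at hb1 hb2
      rw [hK0] at ha1 ha2
      have hbm : ∀ t, t < L - 2 → b t ≠ g j ∧ b t ≠ g i ∧ b t ∈ C := by
        intro t ht
        have := hb1 t ht
        simpa only [Finset.mem_erase] using this
      -- the two enumerations
      let a' : ℕ → V := fun t => if t = 0 then z else a (t - 1)
      let b' : ℕ → V := fun t => if t = 0 then g i else if t = L / 2 then g j else b (t - 1)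
      have hb'C : ∀ t, t < L / 2 + 1 → b' t ∈ C := by
        intro t ht
        simp only [b']
        split_ifs
        · exact hCmem i (by omega)
        · exact hCmem j (by omega)
        · exact (hbm (t - 1) (by omega)).2.2
      have ha'K : ∀ t, t < L / 2 + 1 → t ≠ 0 → a' t ∈ K.erase q0 := by
        intro t ht h0
        simp only [a', if_neg h0]
        exact ha1 (t - 1) (by omega)
      have ha'Z : ∀ t, t < L / 2 + 1 → a' t ∈ Z := by
        intro t ht
        by_cases h0 : t = 0
        · simp only [a', if_pos h0]; exact hz.1
        · exact hKZ (Finset.mem_of_mem_erase (ha'K t ht h0))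
      refine hB (2 * (L / 2 + 1)) (by omega) _ (alt_cyc (m := L / 2 + 1) (by omega) a' b' ?_ ?_ ?_
        ?_ ?_ ?_)
      · intro s t hs ht hst
        simp only [a'] at hst
        split_ifs at hst with k1 k2 k2
        · omega
        · exact absurd (hst ▸ Finset.mem_of_mem_erase (ha1 (t - 1) (by omega))) hz.2
        · exact absurd (hst ▸ Finset.mem_of_mem_erase (ha1 (s - 1) (by omega))) hz.2
        · have := ha2 _ _ (by omega) (by omega) hst; omega
      · intro s t hs ht hst
        simp only [b'] at hst
        split_ifs at hst with k1 k2 k3 k4 k5 k6 k7 k8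
        · omega
        · exact absurd hst hgij
        · exact absurd hst.symm (hbm (t - 1) (by omega)).2.1
        · exact absurd hst.symm hgij
        · omega
        · exact absurd hst.symm (hbm (t - 1) (by omega)).1
        · exact absurd hst (hbm (s - 1) (by omega)).2.1
        · exact absurd hst (hbm (s - 1) (by omega)).1
        · have := hb2 _ _ (by omega) (by omega) hst; omega
      · intro s t hs ht hst
        have h1 := ha'Z s hs
        rw [hst, hZ, Finset.mem_sdiff] at h1
        exact h1.2 (hb'C t ht)
      · intro t ht
        by_cases h0 : t = 0
        · simp only [a', b', if_pos h0]; exact hzi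
        · exact hblueK _ (ha'K t ht h0) _ (hb'C t ht)
      · intro t ht
        exact (hblueK _ (ha'K (t + 1) ht (by omega)) _ (hb'C t (by omega))).symm
      · simp only [a', b']
        rw [if_neg (by omega), if_pos (by omega)]
        simpa using hzj.symm
    · obtain ⟨g', hg'⟩ := bip_cyc (B := Gᶜ) (m := L / 2 + 1) (by omega) (S := K.erase q0)
        (T := C) (by omega) (by omega) hblueK
      exact hB _ (by omega) g' hg'

theorem exists_c4 {V : Type*} [Fintype V] (G : SimpleGraph V) (hV : 12 ≤ Fintype.card V) :
    (∃ g, FCyc G g 4) ∨ (∃ g, FCyc Gᶜ g 4) := by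
  classical
  obtain ⟨U, _, hU⟩ := Finset.exists_subset_card_eq
    (show 3 ≤ (Finset.univ : Finset V).card by rw [Finset.card_univ]; omega)
  obtain ⟨u, v, w, huv, huw, hvw, rfl⟩ := Finset.card_eq_three.1 hU
  obtain ⟨z, hz, z', hz', hzz, heq⟩ := Finset.exists_ne_map_eq_of_card_lt_of_maps_to
    (s := Finset.univ \ ({u, v, w} : Finset V)) (t := (Finset.univ : Finset (Bool × Bool × Bool)))
    (f := fun z => (decide (G.Adj u z), decide (G.Adj v z), decide (G.Adj w z)))
    (by
      have := Finset.card_sdiff_add_card_eq_card (Finset.subset_univ ({u, v, w} : Finset V))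
      rw [Finset.card_univ] at this
      have h8 : (Finset.univ : Finset (Bool × Bool × Bool)).card = 8 := by decide
      omega) (by intro a _; simp)
  simp only [Prod.mk.injEq, decide_eq_decide] at heq
  simp only [Finset.mem_sdiff, Finset.mem_univ, Finset.mem_insert, Finset.mem_singleton,
    true_and, not_or] at hz hz'
  have mk : ∀ (H : SimpleGraph V) (x y : V), x ≠ y → H.Adj x z → H.Adj x z' → H.Adj y z →
      H.Adj y z' → ∃ g, FCyc H g 4 := by
    intro H x y hxy h1 h2 h3 h4
    have : IsCyc H [x, z, y, z'] := by
      refine ⟨by simp [h1, h3.symm, h4], ?_, by simp, ?_⟩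
      · simp [h1.ne, h2.ne, h3.ne.symm, h4.ne, hxy, hzz]
      · simpa using h2.symm
    exact this.fcyc
  have bl : ∀ x y, x ≠ y → ¬ G.Adj x y → Gᶜ.Adj x y := fun x y h1 h2 =>
    (SimpleGraph.compl_adj _ _ _).2 ⟨h1, h2⟩
  obtain ⟨e1, e2, e3⟩ := heq
  by_cases c1 : G.Adj u z <;> by_cases c2 : G.Adj v z <;> by_cases c3 : G.Adj w z
  · exact Or.inl (mk G u v huv c1 (e1.1 c1) c2 (e2.1 c2))
  · exact Or.inl (mk G u v huv c1 (e1.1 c1) c2 (e2.1 c2))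
  · exact Or.inl (mk G u w huw c1 (e1.1 c1) c3 (e3.1 c3))
  · exact Or.inr (mk Gᶜ v w hvw (bl _ _ (Ne.symm hz.2.1) c2)
      (bl _ _ (Ne.symm hz'.2.1) (fun h => c2 (e2.2 h))) (bl _ _ (Ne.symm hz.2.2) c3)
      (bl _ _ (Ne.symm hz'.2.2) (fun h => c3 (e3.2 h))))
  · exact Or.inl (mk G v w hvw c2 (e2.1 c2) c3 (e3.1 c3))
  · exact Or.inr (mk Gᶜ u w huw (bl _ _ (Ne.symm hz.1) c1)
      (bl _ _ (Ne.symm hz'.1) (fun h => c1 (e1.2 h))) (bl _ _ (Ne.symm hz.2.2) c3)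
      (bl _ _ (Ne.symm hz'.2.2) (fun h => c3 (e3.2 h))))
  · exact Or.inr (mk Gᶜ u v huv (bl _ _ (Ne.symm hz.1) c1)
      (bl _ _ (Ne.symm hz'.1) (fun h => c1 (e1.2 h))) (bl _ _ (Ne.symm hz.2.1) c2)
      (bl _ _ (Ne.symm hz'.2.1) (fun h => c2 (e2.2 h))))
  · exact Or.inr (mk Gᶜ u v huv (bl _ _ (Ne.symm hz.1) c1)
      (bl _ _ (Ne.symm hz'.1) (fun h => c1 (e1.2 h))) (bl _ _ (Ne.symm hz.2.1) c2)
      (bl _ _ (Ne.symm hz'.2.1) (fun h => c2 (e2.2 h))))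

/-- there is a monochromatic cycle of order exactly `2p+2` -/
theorem exists_mono_cycle {V : Type*} [Fintype V] (G : SimpleGraph V) (p : ℕ) (hp : 4 ≤ p)
    (hV : 3 * p + 5 ≤ Fintype.card V) :
    (∃ g, FCyc G g (2 * p + 2)) ∨ (∃ g, FCyc Gᶜ g (2 * p + 2)) := by
  have main : ∀ d L, L + d = 2 * p + 2 → 4 ≤ L → ((∃ g, FCyc G g L) ∨ (∃ g, FCyc Gᶜ g L)) →
      (∃ g, FCyc G g (2 * p + 2)) ∨ (∃ g, FCyc Gᶜ g (2 * p + 2)) := by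
    intro d
    induction d using Nat.strong_induction_on with
    | _ d ih =>
      intro L hL h4 hmono
      rcases Nat.eq_zero_or_pos d with h0 | h0
      · have : L = 2 * p + 2 := by omega
        subst this
        exact hmono
      have step : ∃ L' > L, (∃ g', FCyc G g' L') ∨ (∃ g', FCyc Gᶜ g' L') := by
        rcases hmono with ⟨g, hg⟩ | ⟨g, hg⟩
        · exact cyc_main hg h4 (by omega) hV
        · obtain ⟨L', hL', h'⟩ := cyc_main hg h4 (by omega) hV
          rw [compl_compl] at h'
          exact ⟨L', hL', h'.symm⟩
      obtain ⟨L', hL', h'⟩ := step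
      rcases Nat.lt_or_ge L' (2 * p + 2) with k | k
      · exact ih (2 * p + 2 - L') (by omega) L' (by omega) (by omega) h'
      · rcases h' with ⟨g', hg'⟩ | ⟨g', hg'⟩
        · exact descent hp L' G g' k hg'
        · have := descent hp L' Gᶜ g' k hg'
          rw [compl_compl] at this
          exact this.symm
  exact main (2 * p + 2 - 4) 4 (by omega) le_rfl (exists_c4 G (by omega))


section phaseTwo
open Classical

variable {V : Type*}

lemma mkT {G : SimpleGraph V} {p n : ℕ} (f : ℕ → V)
    (hinj : ∀ i j, i < 2*p+1 → j < 2*p+1 → f i = f j → i = j)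
    (hadj : ∀ i, i+1 < 2*p+1 → G.Adj (f i) (f (i+1)))
    (A' B' : Finset V) (hA : n ≤ A'.card) (hB : 2 ≤ B'.card) (hAB : n+2 ≤ (A' ∪ B').card)
    (hA' : ∀ a ∈ A', (∀ t, t < 2*p+1 → f t ≠ a) ∧ G.Adj (f 0) a)
    (hB' : ∀ a ∈ B', (∀ t, t < 2*p+1 → f t ≠ a) ∧ G.Adj (f (2*p)) a) : HasT G p n := by
  obtain ⟨h1, h2, h3, h4⟩ := range_path (G := G) f (2*p+1) (by omega) hinj hadj
  obtain ⟨A, B, hAs, hBs, hAc, hBc, hd⟩ := mini_hall A' B' n 2 hA hB hAB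
  refine ⟨(List.range (2*p+1)).map f, f 0, f (2*p), A, B, h1, h2, by simp, h3, by simpa using h4,
    hAc, hBc, hd, ?_, ?_⟩
  · intro a ha
    refine ⟨?_, (hA' a (hAs ha)).2⟩
    simp only [List.mem_map, List.mem_range, not_exists, not_and]
    exact (hA' a (hAs ha)).1
  · intro a ha
    refine ⟨?_, (hB' a (hBs ha)).2⟩
    simp only [List.mem_map, List.mem_range, not_exists, not_and]
    exact (hB' a (hBs ha)).1

lemma FCyc.adj_of {G : SimpleGraph V} {g : ℕ → V} {L : ℕ} (h : FCyc G g L) {a b : ℕ}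
    (hab : (b = a + 1 ∧ b < L) ∨ (a = b + 1 ∧ a < L) ∨ (a = L - 1 ∧ b = 0)
      ∨ (b = L - 1 ∧ a = 0)) : G.Adj (g a) (g b) := by
  obtain ⟨_, _, h1, h2⟩ := h
  rcases hab with ⟨rfl, hb⟩ | ⟨rfl, hb⟩ | ⟨rfl, rfl⟩ | ⟨rfl, rfl⟩
  · exact h1 _ hb
  · exact (h1 _ hb).symm
  · exact h2
  · exact h2.symm

lemma star0 {G : SimpleGraph V} {g : ℕ → V} {p n : ℕ} (hp : 4 ≤ p)
    (h : FCyc G g (2*p+2)) (D E : Finset V)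
    (hD : ∀ z ∈ D, (∀ i, i < 2*p+2 → g i ≠ z) ∧ G.Adj (g 0) z)
    (hE : ∀ z ∈ E, (∀ i, i < 2*p+2 → g i ≠ z) ∧ G.Adj (g 2) z)
    (h1 : n ≤ D.card + 1) (h2 : 1 ≤ E.card) (h3 : n + 1 ≤ (D ∪ E).card) : HasT G p n := by
  have n1 : g 1 ∉ D := fun hh => (hD _ hh).1 1 (by omega) rfl
  have n2 : g 1 ∉ E := fun hh => (hE _ hh).1 1 (by omega) rfl
  refine mkT (fun t => g (if t = 0 then 0 else 2*p+2-t)) ?_ ?_ (insert (g 1) D) (insert (g 1) E)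
    ?_ ?_ ?_ ?_ ?_
  · intro i j hi hj hij
    have := h.2.1 _ _ (by split_ifs <;> omega) (by split_ifs <;> omega) hij
    split_ifs at this <;> omega
  · intro i hi
    rcases Nat.eq_zero_or_pos i with rfl | hi0
    · exact h.adj_of (Or.inr (Or.inr (Or.inr ⟨by simp, by simp⟩)))
    · refine h.adj_of (Or.inr (Or.inl ⟨?_, ?_⟩)) <;> (try simp only [if_neg (Nat.succ_ne_zero i)]) <;> split_ifs <;> omega
  · rw [Finset.card_insert_of_notMem n1]; omega
  · rw [Finset.card_insert_of_notMem n2]; omega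
  · have : insert (g 1) D ∪ insert (g 1) E = insert (g 1) (D ∪ E) := by ext; simp
    rw [this, Finset.card_insert_of_notMem (by simp [n1, n2])]; omega
  · intro a ha
    rcases Finset.mem_insert.1 ha with rfl | ha
    · refine ⟨fun t ht => h.ne (by split_ifs <;> omega) (by omega) (by split_ifs <;> omega), ?_⟩
      exact h.adj_of (by simp)
    · exact ⟨fun t ht => (hD a ha).1 _ (by split_ifs <;> omega), (hD a ha).2⟩
  · intro a ha
    have e : (if 2*p = 0 then 0 else 2*p+2-2*p) = 2 := by split_ifs <;> omega
    simp only [e]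
    rcases Finset.mem_insert.1 ha with rfl | ha
    · refine ⟨fun t ht => h.ne (by split_ifs <;> omega) (by omega) (by split_ifs <;> omega), ?_⟩
      exact h.adj_of (by omega)
    · exact ⟨fun t ht => (hE a ha).1 _ (by split_ifs <;> omega), (hE a ha).2⟩

lemma star1 {G : SimpleGraph V} {g : ℕ → V} {p n : ℕ} (hp : 4 ≤ p)
    (h : FCyc G g (2*p+2)) (D E : Finset V)
    (hD : ∀ z ∈ D, (∀ i, i < 2*p+2 → g i ≠ z) ∧ G.Adj (g 2) z)
    (hE : ∀ z ∈ E, (∀ i, i < 2*p+2 → g i ≠ z) ∧ G.Adj (g 0) z)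
    (h1 : n ≤ D.card + 1) (h2 : 1 ≤ E.card) (h3 : n + 1 ≤ (D ∪ E).card) : HasT G p n := by
  have n1 : g 1 ∉ D := fun hh => (hD _ hh).1 1 (by omega) rfl
  have n2 : g 1 ∉ E := fun hh => (hE _ hh).1 1 (by omega) rfl
  refine mkT (fun t => g (if t = 2*p then 0 else t+2)) ?_ ?_ (insert (g 1) D) (insert (g 1) E)
    ?_ ?_ ?_ ?_ ?_
  · intro i j hi hj hij
    have := h.2.1 _ _ (by split_ifs <;> omega) (by split_ifs <;> omega) hij
    split_ifs at this <;> omega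
  · intro i hi
    apply h.adj_of
    split_ifs <;> omega
  · rw [Finset.card_insert_of_notMem n1]; omega
  · rw [Finset.card_insert_of_notMem n2]; omega
  · have : insert (g 1) D ∪ insert (g 1) E = insert (g 1) (D ∪ E) := by ext; simp
    rw [this, Finset.card_insert_of_notMem (by simp [n1, n2])]; omega
  · intro a ha
    have e : (if 0 = 2*p then 0 else 0+2) = 2 := by split_ifs <;> omega
    simp only [e]
    rcases Finset.mem_insert.1 ha with rfl | ha
    · refine ⟨fun t ht => h.ne (by split_ifs <;> omega) (by omega) (by split_ifs <;> omega), ?_⟩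
      exact h.adj_of (by omega)
    · exact ⟨fun t ht => (hD a ha).1 _ (by split_ifs <;> omega), (hD a ha).2⟩
  · intro a ha
    simp only [if_true]
    rcases Finset.mem_insert.1 ha with rfl | ha
    · refine ⟨fun t ht => h.ne (by split_ifs <;> omega) (by omega) (by split_ifs <;> omega), ?_⟩
      exact h.adj_of (by omega)
    · exact ⟨fun t ht => (hE a ha).1 _ (by split_ifs <;> omega), (hE a ha).2⟩

lemma redT {G : SimpleGraph V} {g : ℕ → V} {p n d : ℕ} (hp : 4 ≤ p)
    (h : FCyc G g (2*p+2)) (D E : Finset V) (hd : 1 ≤ d) (hd2 : d + 3 ≤ 2*p+2)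
    (hr : G.Adj (g (d+2)) (g 1))
    (hD : ∀ z ∈ D, (∀ i, i < 2*p+2 → g i ≠ z) ∧ G.Adj (g 0) z)
    (hE : ∀ z ∈ E, (∀ i, i < 2*p+2 → g i ≠ z) ∧ G.Adj (g d) z)
    (h1 : n + 1 ≤ D.card) (h2 : 1 ≤ E.card) : HasT G p n := by
  have n1 : g (d+1) ∉ D := fun hh => (hD _ hh).1 (d+1) (by omega) rfl
  have n2 : g (d+1) ∉ E := fun hh => (hE _ hh).1 (d+1) (by omega) rfl
  refine mkT (fun t => g (if t = 0 then 0 else if t ≤ 2*p-d then 2*p+2-t else t-(2*p-d))) ?_ ?_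
    D (insert (g (d+1)) E) ?_ ?_ ?_ ?_ ?_
  · intro i j hi hj hij
    have := h.2.1 _ _ (by split_ifs <;> omega) (by split_ifs <;> omega) hij
    split_ifs at this <;> omega
  · intro i hi
    by_cases hi2 : i = 2*p-d
    · have e1 : (if i = 0 then 0 else if i ≤ 2*p-d then 2*p+2-i else i-(2*p-d)) = d+2 := by
        split_ifs <;> omega
      have e2 : (if i+1 = 0 then 0 else if i+1 ≤ 2*p-d then 2*p+2-(i+1) else i+1-(2*p-d)) = 1 := by
        split_ifs <;> omega
      simp only [e1, e2]; exact hr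
    · rcases Nat.eq_zero_or_pos i with rfl | hi0
      · refine h.adj_of (Or.inr (Or.inr (Or.inr ⟨?_, by simp⟩)))
        rw [if_neg (by omega), if_pos (by omega)]
      · by_cases hi3 : i < 2*p-d
        · refine h.adj_of (Or.inr (Or.inl ⟨?_, ?_⟩)) <;> (try simp only [if_neg (Nat.succ_ne_zero i)]) <;> split_ifs <;> omega
        · refine h.adj_of (Or.inl ⟨?_, ?_⟩) <;> (try simp only [if_neg (Nat.succ_ne_zero i)]) <;> split_ifs <;> omega
  · omega
  · rw [Finset.card_insert_of_notMem n2]; omega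
  · have : insert (g (d+1)) D ⊆ D ∪ insert (g (d+1)) E := by
      intro x; simp; tauto
    have := Finset.card_le_card this
    rw [Finset.card_insert_of_notMem n1] at this; omega
  · intro a ha
    exact ⟨fun t ht => (hD a ha).1 _ (by split_ifs <;> omega), (hD a ha).2⟩
  · intro a ha
    have e : (if 2*p = 0 then 0 else if 2*p ≤ 2*p-d then 2*p+2-2*p else 2*p-(2*p-d)) = d := by
      split_ifs <;> omega
    simp only [e]
    rcases Finset.mem_insert.1 ha with rfl | ha
    · refine ⟨fun t ht => h.ne (by split_ifs <;> omega) (by omega) (by split_ifs <;> omega), ?_⟩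
      exact h.adj_of (by omega)
    · exact ⟨fun t ht => (hE a ha).1 _ (by split_ifs <;> omega), (hE a ha).2⟩

lemma finishT {B : SimpleGraph V} {p n : ℕ} {l : List V} {xa xb zs e2 : V} {A Γ : Finset V}
    (hl : l.IsChain B.Adj) (hnd : l.Nodup) (hlen : l.length + 1 = 2*p) (hh : l.head? = some xa)
    (hlast : l.getLast? = some xb) (h1 : zs ∉ l) (h2 : e2 ∉ l) (h3 : zs ≠ e2)
    (h4 : B.Adj zs xa) (h5 : B.Adj xb e2) (hA : A.card = n) (hΓ : Γ.card = 2)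
    (hd : Disjoint A Γ) (hA' : ∀ a ∈ A, a ∉ l ∧ a ≠ zs ∧ a ≠ e2 ∧ B.Adj zs a)
    (hΓ' : ∀ a ∈ Γ, a ∉ l ∧ a ≠ zs ∧ a ≠ e2 ∧ B.Adj e2 a) : HasT B p n := by
  refine ⟨[zs] ++ (l ++ [e2]), zs, e2, A, Γ, ?_, ?_, ?_, by simp, ?_, hA, hΓ, hd, ?_, ?_⟩
  · refine chain_app (u := zs) (w := xa) (by simp) ?_ (by simp) ?_ h4
    · exact chain_app (u := xb) (w := e2) hl (by simp) hlast (by simp) h5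
    · cases l with
      | nil => simp at hh
      | cons a t => simpa using hh
  · have : (l ++ [e2]).Nodup := by
      rw [List.nodup_append]; refine ⟨hnd, by simp, ?_⟩
      intro a ha b hb; simp at hb; rintro rfl; subst hb; exact h2 ha
    simp only [List.singleton_append, List.nodup_cons]
    exact ⟨by simp [h1, h3], this⟩
  · simp; omega
  · rw [← List.append_assoc, List.getLast?_append]; simp
  · intro a ha; obtain ⟨q1, q2, q3, q4⟩ := hA' a ha; exact ⟨by simp [q1, q2, q3], q4⟩
  · intro a ha; obtain ⟨q1, q2, q3, q4⟩ := hΓ' a ha; exact ⟨by simp [q1, q2, q3], q4⟩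

end phaseTwo


section phaseTwoBlue
open Classical

variable {V : Type*}

lemma exists_big (B : SimpleGraph V) (C Z : Finset V) (d m : ℕ)
    (h : ∀ c ∈ C, d ≤ (Z.filter (B.Adj c)).card) (hlt : m * Z.card < C.card * d) :
    ∃ z ∈ Z, m + 1 ≤ (C.filter (B.Adj z)).card := by
  by_contra hcon
  push Not at hcon
  have e : ∑ c ∈ C, (Z.filter (B.Adj c)).card = ∑ z ∈ Z, (C.filter (B.Adj z)).card := by
    have := Finset.sum_card_bipartiteAbove_eq_sum_card_bipartiteBelow (s := C) (t := Z) B.Adj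
    simp only [Finset.bipartiteAbove, Finset.bipartiteBelow] at this
    simp only [B.adj_comm] at this ⊢
    convert this using 4
  have h1 : C.card * d ≤ ∑ c ∈ C, (Z.filter (B.Adj c)).card := by
    simpa using Finset.card_nsmul_le_sum C _ d h
  have h2 : ∑ z ∈ Z, (C.filter (B.Adj z)).card ≤ Z.card * m := by
    simpa using Finset.sum_le_card_nsmul Z _ m (fun z hz => by have := hcon z hz; omega)
  rw [mul_comm] at hlt
  omega

/-- common part: given `zs`, choose the leaves and the spine inside. -/
lemma blue_common {B : SimpleGraph V} {p n : ℕ} (hp : 4 ≤ p) (hn : n + 2 ≤ p)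
    {C Z Y : Finset V} (hCZ : Disjoint C Z) (hYZ : Y ⊆ Z)
    (hC : p + n + 2 ≤ C.card) (hY : Y.card + 2 ≤ 2 * p)
    (hdeg : ∀ c ∈ C, p ≤ (Y.filter (B.Adj c)).card)
    {xb g1 g2 zs : V} (hxb : xb ∈ C) (hg1 : g1 ∈ C) (hg2 : g2 ∈ C)
    (hb1 : xb ≠ g1) (hb2 : xb ≠ g2) (h12 : g1 ≠ g2)
    (hzs : zs ∈ Z) (hzY : zs ∉ Y) (hbig : n + 4 ≤ (C.filter (B.Adj zs)).card)
    (W : Finset V) (hW : W ⊆ Z) (hzW : zs ∉ W)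
    (hWl : ∀ Y' ⊆ Y, Y'.card + 1 = p → ∃ e ∈ W, e ∉ Y')
    (hWb : ∀ e ∈ W, B.Adj xb e ∧ B.Adj g1 e ∧ B.Adj g2 e) : HasT B p n := by
  have hd := Finset.disjoint_left.1 hCZ
  set T : Finset V := {xb, g1, g2} with hT
  have hTc : T.card = 3 := by rw [hT]; exact Finset.card_eq_three.2 ⟨_, _, _, hb1, hb2, h12, rfl⟩
  have h1 : n + 1 ≤ (C.filter (B.Adj zs) \ T).card := by
    have := Finset.le_card_sdiff T (C.filter (B.Adj zs)); omega
  obtain ⟨P, hPs, hPc⟩ := Finset.exists_subset_card_eq h1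
  have hPne : P.Nonempty := Finset.card_pos.1 (by omega)
  obtain ⟨xa, hxa⟩ := hPne
  have hP : ∀ a ∈ P, a ∈ C ∧ B.Adj zs a ∧ a ∉ T := by
    intro a ha; have := hPs ha
    simp only [Finset.mem_sdiff, Finset.mem_filter] at this
    exact ⟨this.1.1, this.1.2, this.2⟩
  set A := P.erase xa with hA
  have hAc : A.card = n := by rw [hA, Finset.card_erase_of_mem hxa]; omega
  obtain ⟨Γ, hΓ⟩ : ∃ Γ : Finset V, Γ = {g1, g2} := ⟨_, rfl⟩
  have hΓc : Γ.card = 2 := by rw [hΓ]; exact Finset.card_pair h12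
  have hxaT := (hP xa hxa).2.2
  simp only [hT, Finset.mem_insert, Finset.mem_singleton, not_or] at hxaT
  have hsub : ({xa, xb} : Finset V) ⊆ C \ (A ∪ Γ) := by
    intro v hv
    simp only [Finset.mem_insert, Finset.mem_singleton] at hv
    rcases hv with rfl | rfl
    · simp only [Finset.mem_sdiff, Finset.mem_union, hA, hΓ, Finset.mem_erase, Finset.mem_insert,
        Finset.mem_singleton]
      refine ⟨(hP _ hxa).1, ?_⟩
      tauto
    · simp only [Finset.mem_sdiff, Finset.mem_union, hA, hΓ, Finset.mem_erase, Finset.mem_insert,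
        Finset.mem_singleton]
      refine ⟨hxb, ?_⟩
      rintro (⟨_, q⟩ | q | q)
      · exact (hP _ q).2.2 (by simp [hT])
      · exact hb1 q
      · exact hb2 q
  have hcc : p ≤ (C \ (A ∪ Γ)).card := by
    have := Finset.le_card_sdiff (A ∪ Γ) C
    have := Finset.card_union_le A Γ
    omega
  obtain ⟨X, hX1, hX2, hXc⟩ := Finset.exists_subsuperset_card_eq hsub
    (by rw [Finset.card_pair hxaT.1]; omega) hcc
  have hXm : ∀ x ∈ X, x ∈ C ∧ x ∉ A ∧ x ∉ Γ := by
    intro x hx; have := hX2 hx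
    simp only [Finset.mem_sdiff, Finset.mem_union, not_or] at this; exact this
  have hXY : Disjoint X Y := Finset.disjoint_left.2 fun x hx hy => hd (hXm x hx).1 (hYZ hy)
  obtain ⟨l, l1, l2, l3, l4, l5, l6, l7, l8⟩ := path_cover (B := B) hXY p
    (fun x hx => hdeg x (hXm x hx).1) (by omega) hY
    (hX1 (by simp : xa ∈ _)) (hX1 (by simp : xb ∈ _)) hxaT.1
  obtain ⟨e, heW, heY⟩ := hWl (Y.filter (· ∈ l)) (Finset.filter_subset _ _) (by omega)
  have hel : e ∉ l := by
    intro hel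
    rcases l7 e hel with q | q
    · exact hd (hXm e q).1 (hW heW)
    · exact heY (Finset.mem_filter.2 ⟨q, hel⟩)
  have hzl : zs ∉ l := by
    intro hel
    rcases l7 zs hel with q | q
    · exact hd (hXm zs q).1 hzs
    · exact hzY q
  have hlC : ∀ a ∈ C, a ∉ X → a ∉ l := by
    intro a ha hx hl
    rcases l7 a hl with q | q
    · exact hx q
    · exact hd ha (hYZ q)
  obtain ⟨w1, w2, w3⟩ := hWb e heW
  refine finishT (A := A) (Γ := Γ) l1 l2 (by omega) l3 l4 hzl hel ?_ (hP _ hxa).2.1 w1 hAc hΓc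
    ?_ ?_ ?_
  · rintro rfl; exact hzW heW
  · refine Finset.disjoint_left.2 fun a ha hg => ?_
    refine (hP a (Finset.mem_of_mem_erase ha)).2.2 ?_
    simp only [hΓ, Finset.mem_insert, Finset.mem_singleton] at hg
    simp only [hT, Finset.mem_insert, Finset.mem_singleton]
    exact Or.inr hg
  · intro a ha
    have q := hP a (Finset.mem_of_mem_erase ha)
    refine ⟨hlC a q.1 fun hx => (hXm a hx).2.1 ha, ?_, ?_, q.2.1⟩
    · rintro rfl; exact hd q.1 hzs
    · rintro rfl; exact hd q.1 (hW heW)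
  · intro a ha
    have q : a ∈ C ∧ B.Adj e a := by
      simp only [hΓ, Finset.mem_insert, Finset.mem_singleton] at ha
      rcases ha with rfl | rfl
      · exact ⟨hg1, w2.symm⟩
      · exact ⟨hg2, w3.symm⟩
    refine ⟨hlC a q.1 fun hx => (hXm a hx).2.2 ha, ?_, ?_, q.2⟩
    · rintro rfl; exact hd q.1 hzs
    · rintro rfl; exact hd q.1 (hW heW)

lemma erase_deg {B : SimpleGraph V} {Z : Finset V} {z c : V} {k : ℕ}
    (h : k + 1 ≤ (Z.filter (B.Adj c)).card) : k ≤ ((Z.erase z).filter (B.Adj c)).card := by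
  rw [Finset.filter_erase]
  have := Finset.pred_card_le_card_erase (s := Z.filter (B.Adj c)) (a := z)
  omega

lemma blue_i {B : SimpleGraph V} {p n : ℕ} (hp : 4 ≤ p) (hn : n + 2 ≤ p)
    {C Z : Finset V} (hCZ : Disjoint C Z) (hC : C.card = 2 * p + 2) (hZ : Z.card = n + p + 1)
    (hdeg : ∀ c ∈ C, p + 2 ≤ (Z.filter (B.Adj c)).card) : HasT B p n := by
  obtain ⟨zs, hzs, hbig⟩ := exists_big B C Z (p+2) (n+3) hdeg (by rw [hC, hZ]; nlinarith)
  have hdeg1 : ∀ c ∈ C, p + 1 ≤ ((Z.erase zs).filter (B.Adj c)).card :=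
    fun c hc => erase_deg (hdeg c hc)
  have hc1 : (Z.erase zs).card = n + p := by rw [Finset.card_erase_of_mem hzs]; omega
  obtain ⟨e, he, hbig2⟩ := exists_big B C (Z.erase zs) (p+1) 2 hdeg1 (by rw [hC, hc1]; nlinarith)
  have hdeg2 : ∀ c ∈ C, p ≤ (((Z.erase zs).erase e).filter (B.Adj c)).card :=
    fun c hc => erase_deg (hdeg1 c hc)
  have hc2 : ((Z.erase zs).erase e).card + 1 = n + p := by
    rw [Finset.card_erase_of_mem he]; omega
  obtain ⟨T, hTs, hTc⟩ := Finset.exists_subset_card_eq hbig2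
  obtain ⟨xb, g1, g2, a1, a2, a3, rfl⟩ := Finset.card_eq_three.1 hTc
  have b1 := hTs (by simp : xb ∈ _)
  have b2 := hTs (by simp : g1 ∈ _)
  have b3 := hTs (by simp : g2 ∈ _)
  rw [Finset.mem_filter] at b1 b2 b3
  have hez := Finset.mem_erase.1 he
  refine blue_common hp hn hCZ (Y := (Z.erase zs).erase e) ?_ (by omega) (by omega) hdeg2
    b1.1 b2.1 b3.1 a1 a2 a3 hzs (by simp) hbig {e} (by simpa using hez.2) ?_ ?_ ?_
  · exact (Finset.erase_subset _ _).trans (Finset.erase_subset _ _)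
  · simpa using Ne.symm hez.1
  · intro Y' hY' _
    exact ⟨e, by simp, fun q => by simpa using hY' q⟩
  · intro x hx
    rw [Finset.mem_singleton] at hx; subst hx
    exact ⟨b1.2.symm, b2.2.symm, b3.2.symm⟩

lemma blue_ii {B : SimpleGraph V} {p n : ℕ} (hp : 4 ≤ p) (hn : n + 2 ≤ p)
    {C Z : Finset V} (hCZ : Disjoint C Z) (hC : p + n + 2 ≤ C.card) (hZ : Z.card = n + p + 1)
    (hdeg : ∀ c ∈ C, p + 1 ≤ (Z.filter (B.Adj c)).card)
    {xb g1 g2 : V} (hxb : xb ∈ C) (hg1 : g1 ∈ C) (hg2 : g2 ∈ C)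
    (hb1 : xb ≠ g1) (hb2 : xb ≠ g2) (h12 : g1 ≠ g2)
    (hw1 : ∀ z ∈ Z, B.Adj xb z → B.Adj g1 z) (hw2 : ∀ z ∈ Z, B.Adj xb z → B.Adj g2 z) :
    HasT B p n := by
  obtain ⟨zs, hzs, hbig⟩ := exists_big B C Z (p+1) (n+3) hdeg (by
    rw [hZ]
    calc (n+3)*(n+p+1) < (p+n+2)*(p+1) := by nlinarith
      _ ≤ C.card * (p+1) := Nat.mul_le_mul_right _ hC)
  have hdeg1 : ∀ c ∈ C, p ≤ ((Z.erase zs).filter (B.Adj c)).card :=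
    fun c hc => erase_deg (hdeg c hc)
  have hc1 : (Z.erase zs).card = n + p := by rw [Finset.card_erase_of_mem hzs]; omega
  refine blue_common hp hn hCZ (Y := Z.erase zs) (Finset.erase_subset _ _) hC (by omega) hdeg1
    hxb hg1 hg2 hb1 hb2 h12 hzs (by simp) hbig ((Z.erase zs).filter (B.Adj xb)) ?_ (by simp) ?_ ?_
  · exact (Finset.filter_subset _ _).trans (Finset.erase_subset _ _)
  · intro Y' _ hc
    apply Finset.exists_mem_notMem_of_card_lt_card
    have := hdeg1 xb hxb
    omega
  · intro x hx
    rw [Finset.mem_filter] at hx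
    have := Finset.mem_of_mem_erase hx.1
    exact ⟨hx.2, hw1 x this hx.2, hw2 x this hx.2⟩

lemma blue_iii {B : SimpleGraph V} {p n : ℕ} (hn1 : 1 ≤ n) (hp : 4 ≤ p) (hn : n + 2 ≤ p)
    {C Z : Finset V} (hCZ : Disjoint C Z) (hC : p + 1 ≤ C.card) (hZ : Z.card = n + p + 1)
    (hdeg : ∀ c ∈ C, p + 1 ≤ (Z.filter (B.Adj c)).card)
    {s s' c : V} (hs : s ∈ C) (hs' : s' ∈ C) (hss : s ≠ s') (hc : c ∉ C) (hcZ : c ∉ Z)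
    (hsc : B.Adj s c) (hs1 : ∀ z ∈ Z, B.Adj s z) (hs2 : ∀ z ∈ Z, B.Adj s' z) :
    HasT B p n := by
  have hd := Finset.disjoint_left.1 hCZ
  obtain ⟨X, hX1, hX2, hXc⟩ := Finset.exists_subsuperset_card_eq
    (s := {s, s'}) (t := C) (n := p+1) (by
      intro v hv; simp only [Finset.mem_insert, Finset.mem_singleton] at hv
      rcases hv with rfl | rfl <;> assumption)
    (by rw [Finset.card_pair hss]; omega) hC
  have hXY : Disjoint X Z := Finset.disjoint_left.2 fun x hx hy => hd (hX2 hx) hy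
  obtain ⟨l, l1, l2, l3, l4, l5, l6, l7, l8⟩ := path_cover (B := B) hXY (p+1)
    (fun x hx => hdeg x (hX2 hx)) (by omega) (by omega)
    (hX1 (by simp : s ∈ _)) (hX1 (by simp : s' ∈ _)) hss
  have hu := Finset.card_filter_add_card_filter_not (s := Z) (fun v => v ∈ l)
  set U := Z.filter (fun v => v ∉ l) with hU
  have hUc : U.card = n + 1 := by omega
  have hcU : c ∉ U := fun q => hcZ (Finset.mem_filter.1 q).1
  have hcl : c ∉ l := fun q => (l7 c q).elim (fun q => hc (hX2 q)) hcZ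
  obtain ⟨A, A2, e1, e2, e3, e4, e5⟩ := mini_hall (insert c U) U n 2
    (by rw [Finset.card_insert_of_notMem hcU]; omega) (by omega) (by
      have : insert c U ⊆ insert c U ∪ U := Finset.subset_union_left
      have := Finset.card_le_card this
      rw [Finset.card_insert_of_notMem hcU] at this; omega)
  refine ⟨l, s, s', A, A2, l1, l2, by omega, l3, l4, e3, e4, e5, ?_, ?_⟩
  · intro a ha
    rcases Finset.mem_insert.1 (e1 ha) with rfl | q
    · exact ⟨hcl, hsc⟩
    · rw [hU, Finset.mem_filter] at q; exact ⟨q.2, hs1 a q.1⟩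
  · intro a ha
    have q := e2 ha
    rw [hU, Finset.mem_filter] at q; exact ⟨q.2, hs2 a q.1⟩

end phaseTwoBlue


section phaseTwoMain
open Classical

variable {V : Type*}

/-- index `i + 2` around the cycle -/
def nxt (L k i : ℕ) : ℕ := if i + k < L then i + k else i + k - L

lemma phase2 [Fintype V] {G : SimpleGraph V} {g : ℕ → V} {p n : ℕ} (hp : 4 ≤ p) (hn2 : 2 ≤ n)
    (hn : n + 2 ≤ p) (hV : Fintype.card V = n + 3 * p + 3) (h : FCyc G g (2*p+2)) :
    HasT G p n ∨ HasT Gᶜ p n := by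
  by_contra hcon
  rw [not_or] at hcon
  obtain ⟨hR, hB⟩ := hcon
  obtain ⟨Bl, hBl⟩ : ∃ Bl, Bl = Gᶜ := ⟨_, rfl⟩
  rw [← hBl] at hB
  obtain ⟨L, hL⟩ : ∃ L, L = 2*p+2 := ⟨_, rfl⟩
  rw [← hL] at h
  have hinj : Set.InjOn g (Finset.range L : Set ℕ) := by
    intro i hi j hj hij
    exact h.2.1 i j (by simpa using hi) (by simpa using hj) hij
  obtain ⟨C, hC⟩ : ∃ C, C = (Finset.range L).image g := ⟨_, rfl⟩
  have hCc : C.card = 2*p+2 := by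
    rw [hC, Finset.card_image_of_injOn hinj, Finset.card_range, hL]
  obtain ⟨Z, hZ⟩ : ∃ Z, Z = Finset.univ \ C := ⟨_, rfl⟩
  have hZc : Z.card = n + p + 1 := by
    have := Finset.card_sdiff_add_card_eq_card (Finset.subset_univ C)
    rw [← hZ, Finset.card_univ] at this; omega
  have hCZ : Disjoint C Z := by rw [hZ]; exact Finset.disjoint_sdiff
  have hgC : ∀ i, i < L → g i ∈ C := fun i hi => by
    rw [hC]; exact Finset.mem_image_of_mem _ (Finset.mem_range.2 hi)
  have hCg : ∀ c ∈ C, ∃ i, i < L ∧ g i = c := fun c hc => by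
    rw [hC, Finset.mem_image] at hc
    obtain ⟨i, hi, rfl⟩ := hc; exact ⟨i, Finset.mem_range.1 hi, rfl⟩
  have hZg : ∀ z ∈ Z, ∀ i, i < L → g i ≠ z := by
    intro z hz i hi e
    exact Finset.disjoint_left.1 hCZ (hgC i hi) (e ▸ hz)
  obtain ⟨D, hD⟩ : ∃ D : ℕ → Finset V, ∀ i, D i = Z.filter (G.Adj (g i)) := ⟨_, fun _ => rfl⟩
  have hDm : ∀ i z, z ∈ D i ↔ z ∈ Z ∧ G.Adj (g i) z := by
    intro i z; rw [hD, Finset.mem_filter]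
  have hnl : ∀ k i, k < L → i < L → nxt L k i < L := by
    intro k i hk hi; unfold nxt; split_ifs <;> omega
  -- blue degrees
  have hblue : ∀ i, i < L → ∀ z ∈ Z, (Bl.Adj (g i) z ↔ z ∉ D i) := by
    intro i hi z hz
    rw [hBl, SimpleGraph.compl_adj, hDm]
    have := hZg z hz i hi
    tauto
  have hbdeg : ∀ i, i < L → (Z.filter (Bl.Adj (g i))).card + (D i).card = n + p + 1 := by
    intro i hi
    have := Finset.card_filter_add_card_filter_not (s := Z) (fun z => z ∈ D i)
    have e1 : Z.filter (fun z => z ∈ D i) = D i := by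
      ext z; rw [Finset.mem_filter, hDm]; tauto
    have e2 : Z.filter (fun z => z ∉ D i) = Z.filter (Bl.Adj (g i)) := by
      apply Finset.filter_congr; intro z hz; exact (hblue i hi z hz).symm
    rw [e1, e2] at this
    omega
  -- star
  have hrotD : ∀ i, i < L → ∀ k, k < L → ∀ z ∈ D (nxt L k i),
      (∀ t, t < 2*p+2 → (fun t => g (if i+t<L then i+t else i+t-L)) t ≠ z) ∧
      G.Adj ((fun t => g (if i+t<L then i+t else i+t-L)) k) z := by
    intro i hi k hk z hz
    rw [hDm] at hz
    refine ⟨fun t ht => hZg z hz.1 _ (by split_ifs <;> omega), ?_⟩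
    exact hz.2
  have hn0 : ∀ i, i < L → nxt L 0 i = i := by
    intro i hi; unfold nxt; split_ifs <;> omega
  have hst0 : ∀ i, i < L → n ≤ (D i).card → 1 ≤ (D (nxt L 2 i)).card →
      (D i ∪ D (nxt L 2 i)).card ≤ n := by
    intro i hi a b
    by_contra hc
    have r := h.rot i hi
    rw [hL] at r
    refine hR (star0 hp r (D i) (D (nxt L 2 i)) ?_ ?_ (by omega) b (by omega))
    · have := hrotD i hi 0 (by omega); rw [hn0 i hi, hL] at this; exact this
    · have := hrotD i hi 2 (by omega); rw [hL] at this; rw [hL]; exact this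
  have hst1 : ∀ i, i < L → n ≤ (D (nxt L 2 i)).card → 1 ≤ (D i).card →
      (D (nxt L 2 i) ∪ D i).card ≤ n := by
    intro i hi a b
    by_contra hc
    have r := h.rot i hi
    rw [hL] at r
    refine hR (star1 hp r (D (nxt L 2 i)) (D i) ?_ ?_ (by omega) b (by omega))
    · have := hrotD i hi 2 (by omega); rw [hL] at this; rw [hL]; exact this
    · have := hrotD i hi 0 (by omega); rw [hn0 i hi, hL] at this; exact this
  have hpn : ∀ i, i < L → nxt L 2 (nxt L (L-2) i) = i := by
    intro i hi; unfold nxt; split_ifs <;> omega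
  have hstar : ∀ i, i < L → n ≤ (D i).card → ∀ k, (k = 2 ∨ k = L-2) →
      D (nxt L k i) = ∅ ∨ (D i ∪ D (nxt L k i)).card ≤ n := by
    intro i hi a k hk
    rcases Finset.eq_empty_or_nonempty (D (nxt L k i)) with q | q
    · exact Or.inl q
    · right
      have q := Finset.card_pos.2 q
      rcases hk with rfl | rfl
      · exact hst0 i hi a q
      · have := hst1 (nxt L (L-2) i) (hnl _ _ (by omega) hi)
        rw [hpn i hi] at this
        exact this a q
  have hbigE : ∀ i, i < L → n+1 ≤ (D i).card → ∀ k, (k = 2 ∨ k = L-2) → D (nxt L k i) = ∅ := by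
    intro i hi a k hk
    rcases hstar i hi (by omega) k hk with q | q
    · exact q
    · have := Finset.card_le_card (Finset.subset_union_left (s₁ := D i) (s₂ := D (nxt L k i)))
      omega
  have hsub : ∀ i, i < L → n = (D i).card → ∀ k, (k = 2 ∨ k = L-2) → D (nxt L k i) ⊆ D i := by
    intro i hi a k hk
    rcases hstar i hi (by omega) k hk with q | q
    · rw [q]; simp
    · have e := Finset.eq_of_subset_of_card_le
        (Finset.subset_union_left (s₁ := D i) (s₂ := D (nxt L k i))) (by omega)
      rw [e]; exact Finset.subset_union_right
  -- the sets H and F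
  obtain ⟨H, hH⟩ : ∃ H, H = (Finset.range L).filter (fun i => n+1 ≤ (D i).card) := ⟨_, rfl⟩
  obtain ⟨F, hF⟩ : ∃ F, F = (Finset.range L).filter (fun i => D i = ∅) := ⟨_, rfl⟩
  have hHm : ∀ i, i ∈ H ↔ i < L ∧ n+1 ≤ (D i).card := by
    intro i; rw [hH, Finset.mem_filter, Finset.mem_range]
  have hFm : ∀ i, i ∈ F ↔ i < L ∧ D i = ∅ := by
    intro i; rw [hF, Finset.mem_filter, Finset.mem_range]
  have hHF : Disjoint H F := by
    refine Finset.disjoint_left.2 fun i a b => ?_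
    rw [hHm] at a; rw [hFm] at b; rw [b.2] at a; simp at a
  have hnF : ∀ i ∈ H, ∀ k, (k = 2 ∨ k = L-2) → nxt L k i ∈ F := by
    intro i hi k hk
    rw [hHm] at hi; rw [hFm]
    exact ⟨hnl _ _ (by omega) hi.1, hbigE i hi.1 hi.2 k hk⟩
  have hnxinj : ∀ i j, i < L → j < L → nxt L 2 i = nxt L 2 j → i = j := by
    intro i j hi hj; unfold nxt; split_ifs <;> omega
  have himg : H.image (nxt L 2) ⊆ F := by
    intro x hx; rw [Finset.mem_image] at hx; obtain ⟨i, hi, rfl⟩ := hx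
    exact hnF i hi 2 (Or.inl rfl)
  have himgc : (H.image (nxt L 2)).card = H.card := by
    apply Finset.card_image_of_injOn
    intro i hi j hj
    exact hnxinj i j ((hHm i).1 hi).1 ((hHm j).1 hj).1
  have hHlF : H.card ≤ F.card := by rw [← himgc]; exact Finset.card_le_card himg
  have hHFs : H ∪ F ⊆ Finset.range L := by
    intro i; rw [Finset.mem_union, hHm, hFm, Finset.mem_range]; tauto
  have hHFc : H.card + F.card ≤ L := by
    have := Finset.card_le_card hHFs
    rw [Finset.card_union_of_disjoint hHF, Finset.card_range] at this; exact this
  have hHs : H ⊆ Finset.range L := Finset.subset_union_left.trans hHFs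
  have hlow : ∀ i, i < L → i ∉ H → p + 1 ≤ (Z.filter (Bl.Adj (g i))).card := by
    intro i hi hh
    rw [hHm] at hh
    have := hbdeg i hi; by_contra; exact hh ⟨hi, by omega⟩
  -- case (i)
  by_cases c1 : ∀ i, i < L → (D i).card + 1 ≤ n
  · refine hB (blue_i hp hn hCZ hCc hZc ?_)
    intro c hc
    obtain ⟨i, hi, rfl⟩ := hCg c hc
    have := hbdeg i hi; have := c1 i hi; omega
  push Not at c1
  obtain ⟨i, hi, hDi⟩ := c1
  by_cases c2 : H.card + n ≤ p
  · -- case (ii)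
    obtain ⟨C', hC'⟩ : ∃ C', C' = (Finset.range L \ H).image g := ⟨_, rfl⟩
    have hC's : C' ⊆ C := by
      rw [hC', hC]; exact Finset.image_subset_image Finset.sdiff_subset
    have hC'c : p + n + 2 ≤ C'.card := by
      rw [hC', Finset.card_image_of_injOn (hinj.mono (by
        exact_mod_cast Finset.sdiff_subset))]
      have := Finset.le_card_sdiff H (Finset.range L)
      rw [Finset.card_range] at this; omega
    have hm : ∀ j, j < L → j ∉ H → g j ∈ C' := by
      intro j hj hh
      rw [hC']; apply Finset.mem_image_of_mem; simp [hj, hh]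
    have hC'm : ∀ c ∈ C', ∃ j, j < L ∧ j ∉ H ∧ g j = c := by
      intro c hc
      rw [hC', Finset.mem_image] at hc
      obtain ⟨j, hj, rfl⟩ := hc
      simp at hj; exact ⟨j, hj.1, hj.2, rfl⟩
    have hdeg' : ∀ c ∈ C', p + 1 ≤ (Z.filter (Bl.Adj c)).card := by
      intro c hc
      obtain ⟨j, a, b, rfl⟩ := hC'm c hc
      exact hlow j a b
    have hdC' : Disjoint C' Z := Finset.disjoint_of_subset_left hC's hCZ
    have hne : ∀ i, i < L → nxt L 2 i ≠ nxt L (L-2) i ∧ nxt L 2 i ≠ i ∧ nxt L (L-2) i ≠ i := by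
      intro i hi; unfold nxt; refine ⟨?_, ?_, ?_⟩ <;> split_ifs <;> omega
    rcases Finset.eq_empty_or_nonempty H with hE | ⟨j, hj⟩
    · have hnH : ∀ j, j ∉ H := by rw [hE]; simp
      have hDi' : n = (D i).card := by
        by_contra hc; exact hnH i ((hHm i).2 ⟨hi, by omega⟩)
      have l1 := hnl 2 i (by omega) hi
      have l2 := hnl (L-2) i (by omega) hi
      obtain ⟨q1, q2, q3⟩ := hne i hi
      refine hB (blue_ii hp hn hdC' hC'c hZc hdeg' (hm i hi (hnH _)) (hm _ l1 (hnH _))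
        (hm _ l2 (hnH _)) (h.ne hi l1 q2.symm) (h.ne hi l2 q3.symm) (h.ne l1 l2 q1) ?_ ?_)
      · intro z hz; rw [hblue _ hi z hz, hblue _ l1 z hz]
        exact fun a b => a (hsub i hi hDi' 2 (Or.inl rfl) b)
      · intro z hz; rw [hblue _ hi z hz, hblue _ l2 z hz]
        exact fun a b => a (hsub i hi hDi' (L-2) (Or.inr rfl) b)
    · have hjL := ((hHm j).1 hj).1
      have l1 := hnl 2 j (by omega) hjL
      have l2 := hnl (L-2) j (by omega) hjL
      obtain ⟨q1, q2, q3⟩ := hne j hjL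
      have f1 := hnF j hj 2 (Or.inl rfl)
      have f2 := hnF j hj (L-2) (Or.inr rfl)
      obtain ⟨xb, hx1, hx2⟩ := Finset.exists_mem_notMem_of_card_lt_card
        (s := {g (nxt L 2 j), g (nxt L (L-2) j)}) (t := C')
        (lt_of_le_of_lt Finset.card_le_two (by omega))
      simp only [Finset.mem_insert, Finset.mem_singleton, not_or] at hx2
      refine hB (blue_ii hp hn hdC' hC'c hZc hdeg' hx1
        (hm _ l1 fun a => Finset.disjoint_left.1 hHF a f1)
        (hm _ l2 fun a => Finset.disjoint_left.1 hHF a f2) hx2.1 hx2.2 (h.ne l1 l2 q1) ?_ ?_)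
      · intro z hz _; rw [hblue _ l1 z hz, ((hFm _).1 f1).2]; simp
      · intro z hz _; rw [hblue _ l2 z hz, ((hFm _).1 f2).2]; simp
  · -- case (iii)
    have hred : ∀ s ∈ F, ∀ c, c < L → s ≠ c → (c ∈ H ∨ H.card ≤ p) → G.Adj (g s) (g c) := by
      intro s hs c hc hsc hor
      by_contra hna
      have hsL := ((hFm s).1 hs).1
      have hsH : s ∉ H := fun a => Finset.disjoint_left.1 hHF a hs
      obtain ⟨s', hs', hs'2⟩ := Finset.exists_mem_notMem_of_card_lt_card
        (s := {s, c}) (t := F) (lt_of_le_of_lt Finset.card_le_two (by omega))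
      simp only [Finset.mem_insert, Finset.mem_singleton, not_or] at hs'2
      have hs'L := ((hFm s').1 hs').1
      have hs'H : s' ∉ H := fun a => Finset.disjoint_left.1 hHF a hs'
      obtain ⟨S, hS⟩ : ∃ S, S = Finset.range L \ insert c H := ⟨_, rfl⟩
      have hSc : p + 1 ≤ S.card := by
        have := Finset.le_card_sdiff (insert c H) (Finset.range L)
        rw [← hS, Finset.card_range] at this
        rcases hor with q | q
        · rw [Finset.insert_eq_of_mem q] at this; omega
        · have := Finset.card_insert_le c H; omega
      have hSm : ∀ j, j ∈ S ↔ j < L ∧ j ≠ c ∧ j ∉ H := by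
        intro j; rw [hS]; simp
      have hSi : Set.InjOn g (S : Set ℕ) := hinj.mono (by
        rw [hS]; exact_mod_cast Finset.sdiff_subset)
      have hSC : S.image g ⊆ C := by
        intro x hx; rw [Finset.mem_image] at hx; obtain ⟨j, hj, rfl⟩ := hx
        exact hgC j ((hSm j).1 hj).1
      refine hB (blue_iii (by omega) hp hn (C := S.image g)
        (Finset.disjoint_of_subset_left hSC hCZ)
        (by rw [Finset.card_image_of_injOn hSi]; exact hSc) hZc ?_ (s := g s) (s' := g s')
        (c := g c) (Finset.mem_image_of_mem _ ((hSm s).2 ⟨hsL, hsc, hsH⟩))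
        (Finset.mem_image_of_mem _ ((hSm s').2 ⟨hs'L, hs'2.2, hs'H⟩))
        (h.ne hsL hs'L (Ne.symm hs'2.1)) ?_ ?_ ?_ ?_ ?_)
      · intro x hx; rw [Finset.mem_image] at hx; obtain ⟨j, hj, rfl⟩ := hx
        rw [hSm] at hj; exact hlow j hj.1 hj.2.2
      · intro hx; rw [Finset.mem_image] at hx; obtain ⟨j, hj, e⟩ := hx
        rw [hSm] at hj
        exact hj.2.1 (h.2.1 j c hj.1 hc e)
      · intro q; exact Finset.disjoint_left.1 hCZ (hgC c hc) q
      · rw [hBl, SimpleGraph.compl_adj]; exact ⟨h.ne hsL hc hsc, hna⟩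
      · intro z hz; rw [hblue _ hsL z hz, ((hFm _).1 hs).2]; simp
      · intro z hz; rw [hblue _ hs'L z hz, ((hFm _).1 hs').2]; simp
    -- red tree
    have hfin : ∀ i ∈ H, ∀ j ∈ H, i ≠ j → nxt L 1 j ≠ i → (nxt L 1 i ∈ H ∨ H.card ≤ p) →
        False := by
      intro i hi j hj hij hji hor
      have hiL := ((hHm i).1 hi).1
      have hjL := ((hHm j).1 hj).1
      have hj2 := hnF j hj 2 (Or.inl rfl)
      have hi1L := hnl 1 i (by omega) hiL
      have hne2 : nxt L 2 j ≠ i := fun e => Finset.disjoint_left.1 hHF hi (e ▸ hj2)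
      obtain ⟨d, hd⟩ : ∃ d, d = if i ≤ j then j - i else j + L - i := ⟨_, rfl⟩
      have hdj : nxt L d i = j := by
        unfold nxt; rw [hd]; split_ifs <;> omega
      have hd1 : 1 ≤ d := by rw [hd]; split_ifs <;> omega
      have hd2 : d + 3 ≤ L := by
        unfold nxt at hji hne2
        rw [hd]; split_ifs at hji hne2 ⊢ <;> omega
      have hdj2 : nxt L (d+2) i = nxt L 2 j := by
        rw [← hdj]; unfold nxt; split_ifs <;> omega
      have hneq : nxt L 2 j ≠ nxt L 1 i := by
        rw [← hdj2]; unfold nxt; split_ifs <;> omega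
      have hadj := hred _ hj2 _ hi1L hneq hor
      rw [← hdj2] at hadj
      have r := h.rot i hiL
      have k1 := hrotD i hiL 0 (by omega)
      have k2 := hrotD i hiL d (by omega)
      rw [hn0 i hiL] at k1
      rw [hdj] at k2
      have a1 := ((hHm i).1 hi).2
      have a2 := ((hHm j).1 hj).2
      refine hR (redT (n := n) hp (by rw [← hL]; exact r) (D i) (D j) hd1 (by omega) hadj k1 k2
        a1 (by omega))
    by_cases c3 : H.card ≤ p
    · obtain ⟨i, j, hi, hj, hij⟩ := Finset.one_lt_card_iff.1 (by omega : 1 < H.card)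
      by_cases e : nxt L 1 j = i
      · refine hfin j hj i hi hij.symm ?_ (Or.inr c3)
        intro e2
        have hiL := ((hHm i).1 hi).1
        have hjL := ((hHm j).1 hj).1
        unfold nxt at e e2
        split_ifs at e e2 <;> omega
      · exact hfin i hi j hj hij e (Or.inr c3)
    · have key : ∃ i ∈ H, nxt L 1 i ∈ H := by
        obtain ⟨i0, hi0⟩ := Finset.card_pos.1 (by omega : 0 < H.card)
        have hi0L := ((hHm i0).1 hi0).1
        by_cases q : nxt L 1 i0 ∈ H
        · exact ⟨i0, hi0, q⟩
        · have hall : H ∪ F = Finset.range L := by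
            apply Finset.eq_of_subset_of_card_le hHFs
            rw [Finset.card_union_of_disjoint hHF, Finset.card_range]; omega
          have hFi : H.image (nxt L 2) = F :=
            Finset.eq_of_subset_of_card_le himg (by omega)
          have : nxt L 1 i0 ∈ H ∪ F := by
            rw [hall, Finset.mem_range]; exact hnl _ _ (by omega) hi0L
          have q2 := (Finset.mem_union.1 this).resolve_left q
          rw [← hFi, Finset.mem_image] at q2
          obtain ⟨j, hj, e⟩ := q2
          have hjL := ((hHm j).1 hj).1
          refine ⟨j, hj, ?_⟩
          have : nxt L 1 j = i0 := by
            unfold nxt at e ⊢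
            split_ifs at e ⊢ <;> omega
          rw [this]; exact hi0
      obtain ⟨i, hi, hi1⟩ := key
      obtain ⟨j, hj, hj2⟩ := Finset.exists_mem_notMem_of_card_lt_card
        (s := {i, nxt L (L-1) i}) (t := H) (lt_of_le_of_lt Finset.card_le_two (by omega))
      simp only [Finset.mem_insert, Finset.mem_singleton, not_or] at hj2
      refine hfin i hi j hj (Ne.symm hj2.1) ?_ (Or.inl hi1)
      intro e
      apply hj2.2
      have hiL := ((hHm i).1 hi).1
      have hjL := ((hHm j).1 hj).1
      unfold nxt at e ⊢
      split_ifs at e ⊢ <;> omega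

end phaseTwoMain

/-- if `p ≥ 4` and `2 ≤ n ≤ p − 2` then `r(S_c(n,2)) = n + 3p + 3`. -/
theorem lds_ramsey_eq_two (p n : ℕ) (hp : 4 ≤ p) (hn2 : 2 ≤ n) (hnp : n ≤ p - 2) :
    ramseyLDS (2 * p + 1) n 2 = n + 3 * p + 3 := by
  apply ramsey_of_upper p n (by omega)
  intro G
  have hn : n + 2 ≤ p := by omega
  rcases exists_mono_cycle G p hp (by rw [Fintype.card_fin]; omega) with ⟨g, hg⟩ | ⟨g, hg⟩
  · rcases phase2 hp hn2 hn (by simp) hg with q | q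
    · exact Or.inl q.hasCopy
    · exact Or.inr q.hasCopy
  · rcases phase2 hp hn2 hn (by simp) hg with q | q
    · exact Or.inr q.hasCopy
    · rw [compl_compl] at q
      exact Or.inl q.hasCopy
end
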